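/- arXiv:2404.08074 — 5 statements merged into one kernel-verified Lean document; each statement's English description precedes it below -/
import Mathlib

section
/- Let γ ∈ ℝ \ {0}, β ∈ (0,1), and define W_ζ(ζ) := 1 + (γ/(4i))·[coth(π(ζ−iβ)/2) − coth(π(ζ+iβ)/2)]. Let f be holomorphic on an open neighborhood of iβ with f'(iβ) ≠ 0, and suppose f(iβ) = ib is purely imaginary (b := Im f(iβ)). Then the function ζ ↦ W_ζ(ζ)/f'(ζ) − (γ/(2πi))·(f(ζ) − ib)^{-1} extends holomorphically to a neighborhood of iβ, and the value of the extension at iβ equals (1/f'(iβ))·( 1 + (γ/4)·cot(πβ) − (γ/(4πi))·f''(iβ)/f'(iβ) ). Consequently, this value vanishes if and only if f''(iβ)/f'(iβ) = πi·(4/γ + cot(πβ)); in particular, if κ ∈ ℝ satisfies γ = −4 sin(πβ)/(cos(πβ) − κ sin(πβ)), then the value vanishes if and only if f''(iβ)/f'(iβ) = πiκ. -/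
/-- Complex hyperbolic cotangent. -/
noncomputable def cCoth (z : ℂ) : ℂ := Complex.cosh z / Complex.sinh z

/-- The derivative `W_ζ` of the complex relative velocity potential for a point vortex of
strength `γ` at `iβ` and a mirror vortex of strength `-γ` at `-iβ` in the strip. -/
noncomputable def Wzeta (γ β : ℝ) (z : ℂ) : ℂ :=
  1 + (γ : ℂ) / (4 * Complex.I) *
    (cCoth ((Real.pi : ℂ) / 2 * (z - Complex.I * β)) -
      cCoth ((Real.pi : ℂ) / 2 * (z + Complex.I * β)))

open Complex Filter Topology in
lemma fac_aux (f : ℂ → ℂ) (a : ℂ) (hf : AnalyticAt ℂ f a) :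
    ∃ F : ℂ → ℂ, AnalyticAt ℂ F a ∧ (∀ z, f z = f a + (z - a) * F z) ∧ F a = deriv f a ∧
      deriv (deriv f) a = 2 * deriv F a := by
  have hF : AnalyticAt ℂ (dslope f a) a := by
    obtain ⟨p, hp⟩ := hf
    exact ⟨_, hp.has_fpower_series_dslope_fslope⟩
  have hfac : ∀ z, f z = f a + (z - a) * dslope f a z := by
    intro z
    have := sub_smul_dslope f a z
    rw [smul_eq_mul] at this
    rw [this]; ring
  refine ⟨dslope f a, hF, hfac, dslope_same f a, ?_⟩
  have h1 : deriv f =ᶠ[𝓝 a] fun z => dslope f a z + (z - a) * deriv (dslope f a) z := by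
    filter_upwards [hF.eventually_analyticAt] with z hz
    have h2 : HasDerivAt (fun z => f a + (z - a) * dslope f a z)
        (1 * dslope f a z + (z - a) * deriv (dslope f a) z) z :=
      (((hasDerivAt_id z).sub_const a).mul hz.differentiableAt.hasDerivAt).const_add _
    rw [← funext hfac] at h2
    rw [h2.deriv, one_mul]
  rw [h1.deriv_eq]
  have h3 : HasDerivAt (fun z => dslope f a z + (z - a) * deriv (dslope f a) z)
      (deriv (dslope f a) a + (1 * deriv (dslope f a) a + (a - a) * deriv (deriv (dslope f a)) a)) a :=
    hF.differentiableAt.hasDerivAt.add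
      (((hasDerivAt_id a).sub_const a).mul hF.deriv.differentiableAt.hasDerivAt)
  rw [h3.deriv]; ring

open Complex Filter Topology in
lemma coth_aux (β : ℝ) :
    cCoth ((Real.pi : ℂ) / 2 * (I * β + I * β)) = -I * ((Real.cot (Real.pi * β) : ℝ) : ℂ) := by
  have h : (Real.pi : ℂ) / 2 * (I * β + I * β) = ((Real.pi * β : ℝ) : ℂ) * I := by
    push_cast; ring
  rw [cCoth, h, Complex.cosh_mul_I, Complex.sinh_mul_I, Real.cot_eq_cos_div_sin]
  push_cast
  rw [div_mul_eq_div_div, Complex.div_I]; ring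

open Complex Filter Topology in
lemma main_aux (γ β : ℝ) (hs : Real.sin (Real.pi * β) ≠ 0) (f : ℂ → ℂ) 
    (hf : AnalyticAt ℂ f (I * β)) (hf' : deriv f (I * β) ≠ 0) :
    ∃ g : ℂ → ℂ, AnalyticAt ℂ g (I * β) ∧
      (∀ᶠ z in 𝓝 (I * (β : ℂ)), z ≠ I * β → g z = Wzeta γ β z / deriv f z -
          (γ : ℂ) / (2 * (Real.pi : ℂ) * I) * (f z - f (I * β))⁻¹) ∧
      g (I * β) = (deriv f (I * β))⁻¹ *
        (1 + (γ : ℂ) / 4 * ((Real.cot (Real.pi * β) : ℝ) : ℂ) -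
          (γ : ℂ) / (4 * (Real.pi : ℂ) * I) *
            (deriv (deriv f) (I * β) / deriv f (I * β))) := by
  have hcoth := coth_aux β
  have hsinh : Complex.sinh ((Real.pi : ℂ) / 2 * (I * β + I * β)) ≠ 0 := by
    have h : (Real.pi : ℂ) / 2 * (I * β + I * β) = ((Real.pi * β : ℝ) : ℂ) * I := by
      push_cast; ring
    rw [h, Complex.sinh_mul_I, ← Complex.ofReal_sin]
    exact mul_ne_zero (by exact_mod_cast hs) I_ne_zero
  have hpi : (Real.pi : ℂ) ≠ 0 := by exact_mod_cast Real.pi_ne_zero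
  have hWdef : ∀ z, Wzeta γ β z = 1 + (γ : ℂ) / (4 * Complex.I) *
    (cCoth ((Real.pi : ℂ) / 2 * (z - Complex.I * β)) -
      cCoth ((Real.pi : ℂ) / 2 * (z + Complex.I * β))) := fun z => rfl
  generalize (I * (β : ℂ)) = a at *
  obtain ⟨F, hF, hFf, hFa, hF2⟩ := fac_aux f a hf
  have hlin : ∀ z, HasDerivAt (fun z : ℂ => (Real.pi : ℂ) / 2 * (z - a)) ((Real.pi : ℂ) / 2) z := by
    intro z
    simpa using ((hasDerivAt_id z).sub_const a).const_mul ((Real.pi : ℂ) / 2)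
  have hlinA : AnalyticAt ℂ (fun z : ℂ => (Real.pi : ℂ) / 2 * (z - a)) a := by fun_prop
  have hlinB : AnalyticAt ℂ (fun z : ℂ => (Real.pi : ℂ) / 2 * (z + a)) a := by fun_prop
  have hsA : AnalyticAt ℂ (fun z : ℂ => Complex.sinh ((Real.pi : ℂ) / 2 * (z - a))) a := by fun_prop
  have hcA : AnalyticAt ℂ (fun z : ℂ => Complex.cosh ((Real.pi : ℂ) / 2 * (z - a))) a := by fun_prop
  have hsB : AnalyticAt ℂ (fun z : ℂ => Complex.sinh ((Real.pi : ℂ) / 2 * (z + a))) a := by fun_prop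
  have hcB : AnalyticAt ℂ (fun z : ℂ => Complex.cosh ((Real.pi : ℂ) / 2 * (z + a))) a := by fun_prop
  have hds : deriv (fun z : ℂ => Complex.sinh ((Real.pi : ℂ) / 2 * (z - a))) =
      fun z => Complex.cosh ((Real.pi : ℂ) / 2 * (z - a)) * ((Real.pi : ℂ) / 2) :=
    funext fun z => ((hlin z).csinh).deriv
  have hdc : HasDerivAt (fun z : ℂ => Complex.cosh ((Real.pi : ℂ) / 2 * (z - a))) 0 a := by
    simpa using (hlin a).ccosh
  obtain ⟨S, hS, hSf, hSa, hS2⟩ := fac_aux _ a hsA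
  have hSa' : S a = (Real.pi : ℂ) / 2 := by rw [hSa, hds]; simp
  have hS' : deriv S a = 0 := by
    rw [hds, (hdc.mul_const _).deriv] at hS2
    simpa using hS2.symm
  have hSf' : ∀ z, Complex.sinh ((Real.pi : ℂ) / 2 * (z - a)) = (z - a) * S z := by
    intro z; simpa using hSf z
  have hfd : AnalyticAt ℂ (deriv f) a := hf.deriv
  set N : ℂ → ℂ := fun z => (Real.pi : ℂ) / 2 * (Complex.cosh ((Real.pi : ℂ) / 2 * (z - a)) * F z) -
    S z * deriv f z with hN
  have hNA : AnalyticAt ℂ N a :=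
    (analyticAt_const.mul (hcA.mul hF)).sub (hS.mul hfd)
  have hNa : N a = 0 := by simp [hN, hSa', hFa]
  have hNd : deriv N a = -((Real.pi : ℂ) / 4) * deriv (deriv f) a := by
    have h := (((hdc.mul hF.differentiableAt.hasDerivAt).const_mul ((Real.pi : ℂ) / 2)).sub
      (hS.differentiableAt.hasDerivAt.mul hfd.differentiableAt.hasDerivAt))
    have h' : HasDerivAt N _ a := h
    rw [h'.deriv, hS', hSa', hF2]
    simp; ring
  obtain ⟨M, hM, hMf, hMa, -⟩ := fac_aux _ a hNA
  have hFa0 : F a ≠ 0 := by rwa [hFa]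
  have hSa0 : S a ≠ 0 := by rw [hSa']; exact div_ne_zero hpi two_ne_zero
  refine ⟨fun z => (1 - (γ : ℂ) / (4 * I) * (Complex.cosh ((Real.pi : ℂ) / 2 * (z + a)) /
      Complex.sinh ((Real.pi : ℂ) / 2 * (z + a)))) / deriv f z +
      (γ : ℂ) / (2 * (Real.pi : ℂ) * I) * (M z / (S z * deriv f z * F z)), ?_, ?_, ?_⟩
  · exact ((analyticAt_const.sub (analyticAt_const.mul (hcB.div hsB hsinh))).div hfd hf').add
      (analyticAt_const.mul (hM.div ((hS.mul hfd).mul hF)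
        (mul_ne_zero (mul_ne_zero hSa0 hf') hFa0)))
  · filter_upwards [hF.continuousAt.eventually_ne hFa0, hS.continuousAt.eventually_ne hSa0,
      hfd.continuousAt.eventually_ne hf'] with z h1 h2 h3 hz
    have hz' : z - a ≠ 0 := sub_ne_zero.mpr hz
    have hMz : M z = N z / (z - a) := by
      rw [hMf z, hNa]; field_simp; ring
    have hfz : f z - f a = (z - a) * F z := by rw [hFf z]; ring
    rw [hWdef, hfz, hMz, hN]
    simp only [cCoth]
    rw [hSf' z]
    generalize Complex.cosh ((Real.pi : ℂ) / 2 * (z + a)) /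
      Complex.sinh ((Real.pi : ℂ) / 2 * (z + a)) = q
    have hI := I_ne_zero
    field_simp
    ring
  · have hcc : Complex.cosh ((Real.pi : ℂ) / 2 * (a + a)) /
      Complex.sinh ((Real.pi : ℂ) / 2 * (a + a)) = -I * ((Real.cot (Real.pi * β) : ℝ) : ℂ) := hcoth
    simp only []
    rw [hcc, hMa, hNd, hSa', hFa]
    have hI := I_ne_zero
    field_simp
    ring

theorem statement2 (γ β : ℝ) (hγ : γ ≠ 0) (hβ : β ∈ Set.Ioo (0 : ℝ) 1)
    (f : ℂ → ℂ) (U : Set ℂ) (hU : IsOpen U) (hmem : Complex.I * β ∈ U)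
    (hf : DifferentiableOn ℂ f U) (hf' : deriv f (Complex.I * β) ≠ 0)
    (b : ℝ) (hb : b = (f (Complex.I * β)).im)
    (hpure : (f (Complex.I * β)).re = 0) :
    ∃ (V : Set ℂ) (g : ℂ → ℂ), IsOpen V ∧ Complex.I * β ∈ V ∧ V ⊆ U ∧
      DifferentiableOn ℂ g V ∧
      (∀ z ∈ V \ {Complex.I * (β : ℂ)},
        g z = Wzeta γ β z / deriv f z -
          (γ : ℂ) / (2 * (Real.pi : ℂ) * Complex.I) * (f z - Complex.I * b)⁻¹) ∧
      g (Complex.I * β) = (deriv f (Complex.I * β))⁻¹ *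
        (1 + (γ : ℂ) / 4 * ((Real.cot (Real.pi * β) : ℝ) : ℂ) -
          (γ : ℂ) / (4 * (Real.pi : ℂ) * Complex.I) *
            (deriv (deriv f) (Complex.I * β) / deriv f (Complex.I * β))) ∧
      (g (Complex.I * β) = 0 ↔
        deriv (deriv f) (Complex.I * β) / deriv f (Complex.I * β) =
          (Real.pi : ℂ) * Complex.I * (4 / (γ : ℂ) + ((Real.cot (Real.pi * β) : ℝ) : ℂ))) ∧
      (∀ κ : ℝ, γ = -4 * Real.sin (Real.pi * β) / (Real.cos (Real.pi * β) - κ * Real.sin (Real.pi * β)) →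
        (g (Complex.I * β) = 0 ↔
          deriv (deriv f) (Complex.I * β) / deriv f (Complex.I * β) =
            (Real.pi : ℂ) * Complex.I * κ)) := by
  have hpos : 0 < Real.sin (Real.pi * β) := by
    apply Real.sin_pos_of_pos_of_lt_pi
    · exact mul_pos Real.pi_pos hβ.1
    · nlinarith [Real.pi_pos, hβ.2]
  have hfb : f (Complex.I * β) = Complex.I * b := by
    apply Complex.ext <;> simp [hpure, hb]
  have hfa : AnalyticAt ℂ f (Complex.I * β) := hf.analyticAt (hU.mem_nhds hmem)
  obtain ⟨g, hg, hge, hga⟩ := main_aux γ β hpos.ne' f hfa hf'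
  rw [hfb] at hge
  obtain ⟨V, hV, hVo, haV⟩ := eventually_nhds_iff.mp
    (hge.and (hg.eventually_analyticAt.and (hU.mem_nhds hmem : ∀ᶠ z in nhds _, z ∈ U)))
  have hpi : (Real.pi : ℂ) ≠ 0 := by exact_mod_cast Real.pi_ne_zero
  have hγ' : (γ : ℂ) ≠ 0 := by exact_mod_cast hγ
  have hI := Complex.I_ne_zero
  have key : (g (Complex.I * β) = 0 ↔
        deriv (deriv f) (Complex.I * β) / deriv f (Complex.I * β) =
          (Real.pi : ℂ) * Complex.I * (4 / (γ : ℂ) + ((Real.cot (Real.pi * β) : ℝ) : ℂ))) := by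
    rw [hga]
    generalize deriv (deriv f) (Complex.I * β) / deriv f (Complex.I * β) = q
    generalize ((Real.cot (Real.pi * β) : ℝ) : ℂ) = c
    rw [mul_eq_zero, or_iff_right (inv_ne_zero hf')]
    have e : 1 + (γ : ℂ) / 4 * c - (γ : ℂ) / (4 * (Real.pi : ℂ) * Complex.I) * q =
        -((γ : ℂ) / (4 * (Real.pi : ℂ) * Complex.I)) *
          (q - (Real.pi : ℂ) * Complex.I * (4 / (γ : ℂ) + c)) := by
      field_simp
      ring
    rw [e, mul_eq_zero, or_iff_right, sub_eq_zero]
    exact neg_ne_zero.mpr (div_ne_zero hγ' (mul_ne_zero (mul_ne_zero (by norm_num) hpi) hI))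
  refine ⟨V, g, hVo, haV, fun z hz => (hV z hz).2.2,
    fun z hz => (hV z hz).2.1.differentiableAt.differentiableWithinAt,
    fun z hz => (hV z hz.1).1 hz.2, hga, key, ?_⟩
  intro κ hκ
  rw [key]
  have hd : Real.cos (Real.pi * β) - κ * Real.sin (Real.pi * β) ≠ 0 := by
    intro h
    rw [h, div_zero] at hκ
    exact hγ hκ
  have hk : 4 / γ + Real.cot (Real.pi * β) = κ := by
    rw [hκ, Real.cot_eq_cos_div_sin]
    have := hpos.ne'
    field_simp
    ring
  have hk' : 4 / (γ : ℂ) + ((Real.cot (Real.pi * β) : ℝ) : ℂ) = (κ : ℂ) := by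
    rw [← hk]; push_cast; ring
  rw [hk']
end

section
/- Fix F > 0 with F² > 1 and M > 0. Then there exists δ > 0 with the following property. Suppose β ∈ (−1,1) and κ ∈ ℝ satisfy cos(πβ) > κ sin(πβ); set γ := −4 sin(πβ)/(cos(πβ) − κ sin(πβ)) and a(ξ) := 1 − (γ/2)·sin(πβ)/(cosh(πξ) + cos(πβ)). Suppose w : cl(D) → ℝ is continuous, harmonic in D, not identically zero, has all partial derivatives up to second order extending continuously to cl(D), satisfies w(ξ,−η) = −w(ξ,η) (so w = 0 on {η = 0}), and w together with its gradient tends to 0 as |ξ| → ∞, uniformly in η. Assume moreover: w_ξ² + (1+w_η)² > 0 on cl(D); the Bernoulli condition (1/2)·a(ξ)²/(w_ξ(ξ,1)² + (1+w_η(ξ,1))²) + w(ξ,1)/F² = 1/2 holds for every ξ > M; sup over (M,∞)×{1} of (|w| + |w_ξ| + |w_η|) < δ; and w_ξ ≤ 0 on the segment {M} × [0,1]. Then w_ξ < 0 on D₊^M ∪ Γ^M. -/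
open Set

/-- Partial derivative in the first (horizontal) variable. -/
noncomputable def pdx (w : ℝ × ℝ → ℝ) : ℝ × ℝ → ℝ :=
  fun p => deriv (fun x => w (x, p.2)) p.1

/-- Partial derivative in the second (vertical) variable. -/
noncomputable def pdy (w : ℝ × ℝ → ℝ) : ℝ × ℝ → ℝ :=
  fun p => deriv (fun y => w (p.1, y)) p.2

/-- `w` is harmonic on the set `s ⊆ ℝ²`: it is `C²` there and satisfies Laplace's equation. -/
def HarmonicOnR2 (w : ℝ × ℝ → ℝ) (s : Set (ℝ × ℝ)) : Prop :=
  ContDiffOn ℝ 2 w s ∧ ∀ p ∈ s, pdx (pdx w) p + pdy (pdy w) p = 0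

/-- The open strip `D = ℝ × (-1,1)`. -/
def Dset : Set (ℝ × ℝ) := univ ×ˢ Ioo (-1 : ℝ) 1

/-- The closed strip `cl(D) = ℝ × [-1,1]`. -/
def clDset : Set (ℝ × ℝ) := univ ×ˢ Icc (-1 : ℝ) 1

/-- The circulation `γ(κ,β)` of the point vortex determined by the Helmholtz–Kirchhoff
equilibrium condition. -/
noncomputable def gammaPV (κ β : ℝ) : ℝ :=
  -4 * Real.sin (Real.pi * β) / (Real.cos (Real.pi * β) - κ * Real.sin (Real.pi * β))

/-- The trace `a(ξ;κ,β)` on the line `{Im ζ = 1}` of the derivative of the complex relative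
velocity potential. -/
noncomputable def avort (κ β ξ : ℝ) : ℝ :=
  1 - gammaPV κ β / 2 * Real.sin (Real.pi * β) / (Real.cosh (Real.pi * ξ) + Real.cos (Real.pi * β))

open Filter Topology

lemma isOpen_Dset : IsOpen Dset := isOpen_univ.prod isOpen_Ioo

lemma Dset_sub : Dset ⊆ clDset := fun _ hp => ⟨hp.1, Ioo_subset_Icc_self hp.2⟩

lemma hasDerivAt_x {φ : ℝ × ℝ → ℝ} {p : ℝ × ℝ} (h : DifferentiableAt ℝ φ p) :
    HasDerivAt (fun x => φ (x, p.2)) (fderiv ℝ φ p (1, 0)) p.1 := by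
  have h1 : HasDerivAt (fun x : ℝ => (x, p.2)) ((1 : ℝ), (0 : ℝ)) p.1 :=
    (hasDerivAt_id p.1).prodMk (hasDerivAt_const p.1 p.2)
  exact HasFDerivAt.comp_hasDerivAt p.1 (f := fun x : ℝ => (x, p.2)) h.hasFDerivAt h1

lemma hasDerivAt_y {φ : ℝ × ℝ → ℝ} {p : ℝ × ℝ} (h : DifferentiableAt ℝ φ p) :
    HasDerivAt (fun y => φ (p.1, y)) (fderiv ℝ φ p (0, 1)) p.2 := by
  have h1 : HasDerivAt (fun y : ℝ => (p.1, y)) ((0 : ℝ), (1 : ℝ)) p.2 :=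
    (hasDerivAt_const p.2 p.1).prodMk (hasDerivAt_id p.2)
  exact HasFDerivAt.comp_hasDerivAt p.2 (f := fun y : ℝ => (p.1, y)) h.hasFDerivAt h1

lemma pdx_eq {φ : ℝ × ℝ → ℝ} {p : ℝ × ℝ} (h : DifferentiableAt ℝ φ p) :
    pdx φ p = fderiv ℝ φ p (1, 0) := (hasDerivAt_x h).deriv

lemma pdy_eq {φ : ℝ × ℝ → ℝ} {p : ℝ × ℝ} (h : DifferentiableAt ℝ φ p) :
    pdy φ p = fderiv ℝ φ p (0, 1) := (hasDerivAt_y h).deriv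


lemma w_diffAt {w : ℝ × ℝ → ℝ} (hw : ContDiffOn ℝ 2 w Dset) {p : ℝ × ℝ} (hp : p ∈ Dset) : DifferentiableAt ℝ w p :=
  (hw.contDiffAt (isOpen_Dset.mem_nhds hp)).differentiableAt (by norm_num)

lemma fdw_diffAt {w : ℝ × ℝ → ℝ} (hw : ContDiffOn ℝ 2 w Dset) {p : ℝ × ℝ} (hp : p ∈ Dset) : DifferentiableAt ℝ (fderiv ℝ w) p :=
  ((hw.contDiffAt (isOpen_Dset.mem_nhds hp)).fderiv_right (m := 1) (by norm_num)).differentiableAt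
    (by norm_num)

lemma pdx_hasFDerivAt {w : ℝ × ℝ → ℝ} (hw : ContDiffOn ℝ 2 w Dset) {p : ℝ × ℝ} (hp : p ∈ Dset) :
    HasFDerivAt (pdx w) ((fderiv ℝ (fderiv ℝ w) p).flip (1, 0)) p := by
  have h : HasFDerivAt (fun q => fderiv ℝ w q (1, 0)) ((fderiv ℝ (fderiv ℝ w) p).flip (1, 0)) p := by
    have := (fdw_diffAt hw hp).hasFDerivAt.clm_apply (hasFDerivAt_const ((1 : ℝ), (0 : ℝ)) p)
    simpa using this
  refine h.congr_of_eventuallyEq ?_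
  filter_upwards [isOpen_Dset.mem_nhds hp] with q hq
  exact pdx_eq (w_diffAt hw hq)

lemma pdy_hasFDerivAt {w : ℝ × ℝ → ℝ} (hw : ContDiffOn ℝ 2 w Dset) {p : ℝ × ℝ} (hp : p ∈ Dset) :
    HasFDerivAt (pdy w) ((fderiv ℝ (fderiv ℝ w) p).flip (0, 1)) p := by
  have h : HasFDerivAt (fun q => fderiv ℝ w q (0, 1)) ((fderiv ℝ (fderiv ℝ w) p).flip (0, 1)) p := by
    have := (fdw_diffAt hw hp).hasFDerivAt.clm_apply (hasFDerivAt_const ((0 : ℝ), (1 : ℝ)) p)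
    simpa using this
  refine h.congr_of_eventuallyEq ?_
  filter_upwards [isOpen_Dset.mem_nhds hp] with q hq
  exact pdy_eq (w_diffAt hw hq)

lemma pd_symm {w : ℝ × ℝ → ℝ} (hw : ContDiffOn ℝ 2 w Dset) {p : ℝ × ℝ} (hp : p ∈ Dset) : pdy (pdx w) p = pdx (pdy w) p := by
  rw [pdy_eq (pdx_hasFDerivAt hw hp).differentiableAt, pdx_eq (pdy_hasFDerivAt hw hp).differentiableAt,
    (pdx_hasFDerivAt hw hp).fderiv, (pdy_hasFDerivAt hw hp).fderiv]
  have := (hw.contDiffAt (isOpen_Dset.mem_nhds hp)).isSymmSndFDerivAt (by simp)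
  exact this _ _


/-- the holomorphic gradient -/
noncomputable def hgrad (wx wy : ℝ × ℝ → ℝ) (z : ℂ) : ℂ :=
  (wx (z.re, z.im) : ℂ) - Complex.I * (wy (z.re, z.im) : ℂ)

lemma hgrad_re (wx wy : ℝ × ℝ → ℝ) (z : ℂ) : (hgrad wx wy z).re = wx (z.re, z.im) := by
  simp [hgrad]

lemma hgrad_diff {w wx wy : ℝ × ℝ → ℝ} (hw : HarmonicOnR2 w Dset)
    (hxy : ∀ p ∈ Dset, wx p = pdx w p ∧ wy p = pdy w p) {z : ℂ} (hz : (z.re, z.im) ∈ Dset) :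
    DifferentiableAt ℂ (hgrad wx wy) z := by
  have hx := pdx_hasFDerivAt hw.1 hz
  have hy := pdy_hasFDerivAt hw.1 hz
  have hpx := pdx_eq hx.differentiableAt
  have hpy := pdy_eq hy.differentiableAt
  have hs := pd_symm hw.1 hz
  rw [pdy_eq hx.differentiableAt, pdx_eq hy.differentiableAt] at hs
  have hh := hw.2 _ hz
  rw [hpx, hpy] at hh
  have hwx : wx =ᶠ[𝓝 (z.re, z.im)] pdx w := by
    filter_upwards [isOpen_Dset.mem_nhds hz] with q hq using (hxy q hq).1
  have hwy : wy =ᶠ[𝓝 (z.re, z.im)] pdy w := by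
    filter_upwards [isOpen_Dset.mem_nhds hz] with q hq using (hxy q hq).2
  have hx' := hx.differentiableAt.hasFDerivAt.congr_of_eventuallyEq hwx
  have hy' := hy.differentiableAt.hasFDerivAt.congr_of_eventuallyEq hwy
  have hc : HasFDerivAt (fun z : ℂ => (z.re, z.im)) (Complex.reCLM.prod Complex.imCLM) z :=
    (Complex.reCLM.hasFDerivAt).prodMk (Complex.imCLM.hasFDerivAt)
  have h1 := Complex.ofRealCLM.hasFDerivAt.comp z (HasFDerivAt.comp z (f := fun z : ℂ => (z.re, z.im)) hx' hc)
  have h2 := Complex.ofRealCLM.hasFDerivAt.comp z (HasFDerivAt.comp z (f := fun z : ℂ => (z.re, z.im)) hy' hc)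
  have h3 := h1.sub (h2.const_mul Complex.I)
  have h4 : HasFDerivAt (hgrad wx wy) _ z := h3
  rw [differentiableAt_complex_iff_differentiableAt_real]
  refine ⟨h4.differentiableAt, ?_⟩
  rw [h4.fderiv]
  apply Complex.ext
  · simp
    linarith
  · simp
    linarith

lemma hgrad_cont {wx wy : ℝ × ℝ → ℝ} (hx : ContinuousOn wx clDset) (hy : ContinuousOn wy clDset) :
    ContinuousOn (hgrad wx wy) {z : ℂ | z.im ∈ Icc (-1 : ℝ) 1} := by
  have hc : ContinuousOn (fun z : ℂ => (z.re, z.im)) {z : ℂ | z.im ∈ Icc (-1 : ℝ) 1} := by fun_prop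
  have hm : MapsTo (fun z : ℂ => (z.re, z.im)) {z : ℂ | z.im ∈ Icc (-1 : ℝ) 1} clDset :=
    fun z hz => ⟨mem_univ _, hz⟩
  have h1 := hx.comp hc hm
  have h2 := hy.comp hc hm
  exact (Complex.continuous_ofReal.comp_continuousOn h1).sub
    (continuousOn_const.mul (Complex.continuous_ofReal.comp_continuousOn h2))

lemma strong_max {H : ℂ → ℂ} {U : Set ℂ} (hc : IsPreconnected U) (ho : IsOpen U)
    (hd : DifferentiableOn ℂ H U) {c : ℂ} (hcU : c ∈ U) (hm : ∀ z ∈ U, (H z).re ≤ (H c).re) :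
    ∀ z ∈ U, Complex.exp (H z) = Complex.exp (H c) := by
  have := Complex.eqOn_of_isPreconnected_of_isMaxOn_norm (f := fun z => Complex.exp (H z)) hc ho
    hd.cexp hcU (by
      intro z hz
      simp only [Function.comp, Complex.norm_exp, mem_ofPred_eq]
      exact Real.exp_le_exp.2 (hm z hz))
  exact fun z hz => this hz

lemma re_eq_of_exp {a b : ℂ} (h : Complex.exp a = Complex.exp b) : a.re = b.re := by
  have := congrArg norm h
  rwa [Complex.norm_exp, Complex.norm_exp, Real.exp_eq_exp] at this

lemma rect_max {H : ℂ → ℂ} {a b c d : ℝ} (hab : a < b) (hcd : c < d)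
    (hd : ∀ z : ℂ, z.re ∈ Ioo a b → z.im ∈ Ioo c d → DifferentiableAt ℂ H z)
    (hc : ContinuousOn H (Icc a b ×ℂ Icc c d))
    (hm : ∀ z : ℂ, z.re ∈ Icc a b → z.im ∈ Icc c d → (z.re = a ∨ z.re = b ∨ z.im = c ∨ z.im = d) →
      (H z).re ≤ 0) :
    ∀ z : ℂ, z.re ∈ Icc a b → z.im ∈ Icc c d → (H z).re ≤ 0 := by
  have hcl : closure (Ioo a b ×ℂ Ioo c d) = Icc a b ×ℂ Icc c d := by
    rw [Complex.closure_reProdIm, closure_Ioo hab.ne, closure_Ioo hcd.ne]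
  have ho : IsOpen (Ioo a b ×ℂ Ioo c d) := isOpen_Ioo.reProdIm isOpen_Ioo
  have hb : Bornology.IsBounded (Ioo a b ×ℂ Ioo c d) :=
    (Metric.isBounded_Ioo a b).reProdIm (Metric.isBounded_Ioo c d)
  intro z h1 h2
  have hD : DiffContOnCl ℂ (fun z => Complex.exp (H z)) (Ioo a b ×ℂ Ioo c d) := by
    refine ⟨fun z hz => ?_, ?_⟩
    · exact (hd z hz.1 hz.2).cexp.differentiableWithinAt
    · rw [hcl]; exact hc.cexp
  have := Complex.norm_le_of_forall_mem_frontier_norm_le hb hD (C := 1) (by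
    intro z hz
    rw [frontier, hcl, ho.interior_eq] at hz
    obtain ⟨⟨hz1, hz2⟩, hz3⟩ := hz
    rw [Complex.norm_exp, Real.exp_le_one_iff]
    apply hm z hz1 hz2
    by_contra hcon
    push Not at hcon
    exact hz3 ⟨⟨lt_of_le_of_ne hz1.1 (Ne.symm hcon.1), lt_of_le_of_ne hz1.2 hcon.2.1⟩,
      ⟨lt_of_le_of_ne hz2.1 (Ne.symm hcon.2.2.1), lt_of_le_of_ne hz2.2 hcon.2.2.2⟩⟩)
    (z := z) (by rw [hcl]; exact ⟨h1, h2⟩)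
  rwa [Complex.norm_exp, Real.exp_le_one_iff] at this

/-- trace differentiation along the top -/
lemma trace_deriv {φ ψ : ℝ × ℝ → ℝ} (hφ : ContinuousOn φ clDset) (hψ : ContinuousOn ψ clDset)
    (h : ∀ p ∈ Dset, HasDerivAt (fun x => φ (x, p.2)) (ψ p) p.1) (x₀ : ℝ) :
    HasDerivAt (fun x => φ (x, 1)) (ψ (x₀, 1)) x₀ := by
  let P : ℝ × ℝ → ℝ × ℝ := fun p => (p.1, (projIcc (-1 : ℝ) 1 (by norm_num) p.2 : ℝ))
  have hP : Continuous P := by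
    refine continuous_fst.prodMk ?_
    exact continuous_subtype_val.comp (continuous_projIcc.comp continuous_snd)
  have hPm : ∀ p, P p ∈ clDset := fun p => ⟨mem_univ _, Subtype.coe_prop _⟩
  have hPe : ∀ p ∈ clDset, P p = p := by
    intro p hp
    simp only [P, projIcc_of_mem _ hp.2]
  have hφ' : Continuous (φ ∘ P) := hφ.comp_continuous hP hPm
  have hψ' : Continuous (ψ ∘ P) := hψ.comp_continuous hP hPm
  have key : ∀ x, φ (x, 1) - φ (x₀, 1) = ∫ s in x₀..x, (ψ ∘ P) (s, 1) := by
    intro x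
    have c1 : Continuous (fun y : ℝ => (φ ∘ P) (x, y) - (φ ∘ P) (x₀, y)) :=
      (hφ'.comp (Continuous.prodMk_right x)).sub (hφ'.comp (Continuous.prodMk_right x₀))
    have c2 : Continuous (fun y : ℝ => ∫ s in x₀..x, (ψ ∘ P) (s, y)) := by
      apply intervalIntegral.continuous_parametric_intervalIntegral_of_continuous'
      exact hψ'.comp continuous_swap
    have e : EqOn (fun y : ℝ => (φ ∘ P) (x, y) - (φ ∘ P) (x₀, y))
        (fun y : ℝ => ∫ s in x₀..x, (ψ ∘ P) (s, y)) (Ioo (-1) 1) := by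
      intro y hy
      have hy' : ∀ s, P (s, y) = (s, y) := fun s => hPe _ ⟨mem_univ _, Ioo_subset_Icc_self hy⟩
      simp only [Function.comp, hy']
      symm
      apply intervalIntegral.integral_eq_sub_of_hasDerivAt (f := fun s => φ (s, y))
      · intro s _
        exact h (s, y) ⟨mem_univ _, hy⟩
      · have : Continuous (fun s => (ψ ∘ P) (s, y)) := hψ'.comp (Continuous.prodMk_left y)
        simp only [Function.comp, hy'] at this
        exact this.intervalIntegrable _ _
    have e2 := e.closure c1 c2
    rw [closure_Ioo (by norm_num)] at e2
    have := e2 (show (1 : ℝ) ∈ Icc (-1 : ℝ) 1 by norm_num)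
    have h1 : ∀ s, P (s, 1) = (s, 1) := fun s => hPe _ ⟨mem_univ _, by norm_num⟩
    simpa [Function.comp, h1] using this
  have c3 : Continuous (fun s => (ψ ∘ P) (s, 1)) := hψ'.comp (Continuous.prodMk_left 1)
  have h1 : P (x₀, 1) = (x₀, 1) := hPe _ ⟨mem_univ _, by norm_num⟩
  have := (intervalIntegral.integral_hasDerivAt_right (c3.intervalIntegrable x₀ x₀)
    (c3.stronglyMeasurableAtFilter _ _) c3.continuousAt).const_add (φ (x₀, 1))
  simp only [Function.comp, h1] at this
  refine this.congr_of_eventuallyEq (Eventually.of_forall fun x => ?_)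
  have := key x
  simp only [Function.comp] at this
  linarith

lemma normal_deriv {φ ψ : ℝ × ℝ → ℝ} (hφ : ContinuousOn φ clDset) (hψ : ContinuousOn ψ clDset)
    (h : ∀ p ∈ Dset, HasDerivAt (fun y => φ (p.1, y)) (ψ p) p.2) (x₀ : ℝ) :
    HasDerivWithinAt (fun y => φ (x₀, y)) (ψ (x₀, 1)) (Iic 1) 1 := by
  have hm : MapsTo (fun y : ℝ => (x₀, y)) (Icc (-1) 1) clDset := fun y hy => ⟨mem_univ _, hy⟩
  have hc : ContinuousOn (fun y : ℝ => (x₀, y)) (Icc (-1) 1) := by fun_prop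
  have c1 := hφ.comp hc hm
  have c2 := hψ.comp hc hm
  have hI : Ioo (-1 : ℝ) 1 ∈ 𝓝[<] (1 : ℝ) := Ioo_mem_nhdsLT (by norm_num)
  apply hasDerivWithinAt_Iic_of_tendsto_deriv (s := Ioo (-1) 1)
  · intro y hy
    exact (h (x₀, y) ⟨mem_univ _, hy⟩).differentiableAt.differentiableWithinAt
  · exact (c1 1 (by norm_num)).mono Ioo_subset_Icc_self
  · exact hI
  · have t : Tendsto (fun y => ψ (x₀, y)) (𝓝[<] 1) (𝓝 (ψ (x₀, 1))) := by
      have := (c2 1 (by norm_num)).mono (Ioo_subset_Icc_self)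
      have h2 : Tendsto (fun y => ψ (x₀, y)) (𝓝[Ioo (-1) 1] 1) (𝓝 (ψ (x₀, 1))) := this
      rwa [nhdsWithin_Ioo_eq_nhdsLT (by norm_num)] at h2
    refine t.congr' ?_
    filter_upwards [hI] with y hy
    exact (h (x₀, y) ⟨mem_univ _, hy⟩).deriv.symm

lemma deriv_nonneg_of_le {f : ℝ → ℝ} {e : ℝ} (hf : HasDerivWithinAt f e (Iic 1) 1)
    (hle : ∀ y ∈ Ioo (1 / 2 : ℝ) 1, f y ≤ f 1) : 0 ≤ e := by
  rw [hasDerivWithinAt_iff_tendsto_slope] at hf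
  have hs : Iic (1 : ℝ) \ {1} = Iio 1 := by ext; simp [lt_iff_le_and_ne]
  rw [hs] at hf
  refine ge_of_tendsto hf ?_
  filter_upwards [Ioo_mem_nhdsLT (show (1 / 2 : ℝ) < 1 by norm_num)] with y hy
  rw [slope_def_field]
  exact div_nonneg_of_nonpos (by linarith [hle y hy]) (by linarith [hy.2])

lemma avort_deriv {κ β ξ : ℝ} (hκ : κ * Real.sin (Real.pi * β) < Real.cos (Real.pi * β))
    (hξ : 0 < ξ) : ∃ a', HasDerivAt (avort κ β) a' ξ ∧ avort κ β ξ * a' ≤ 0 := by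
  set s := Real.sin (Real.pi * β)
  set c := Real.cos (Real.pi * β)
  have hC : 0 ≤ -(gammaPV κ β / 2 * s) := by
    have : -(gammaPV κ β / 2 * s) = 2 * s ^ 2 / (c - κ * s) := by
      simp only [gammaPV, s, c]; ring
    rw [this]
    exact div_nonneg (by positivity) (by linarith)
  have hD : 0 < Real.cosh (Real.pi * ξ) + c := by
    have h1 : 1 < Real.cosh (Real.pi * ξ) := Real.one_lt_cosh.2 (by positivity)
    have h2 : -1 ≤ c := Real.neg_one_le_cos _
    linarith
  have hsinh : 0 < Real.sinh (Real.pi * ξ) := Real.sinh_pos_iff.2 (by positivity)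
  have hd : HasDerivAt (fun ξ => Real.cosh (Real.pi * ξ) + c) (Real.sinh (Real.pi * ξ) * Real.pi) ξ := by
    have := ((hasDerivAt_id ξ).const_mul Real.pi).cosh.add_const c
    simpa using this
  have := ((hasDerivAt_const ξ (gammaPV κ β / 2 * s)).div hd hD.ne').const_sub 1
  refine ⟨_, this, ?_⟩
  apply mul_nonpos_of_nonneg_of_nonpos
  · have : avort κ β ξ = 1 + (-(gammaPV κ β / 2 * s)) / (Real.cosh (Real.pi * ξ) + c) := by
      simp only [avort, s, c]; ring
    rw [this]; positivity
  · rw [neg_nonpos]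
    apply div_nonneg _ (by positivity)
    have : 0 ≤ -(gammaPV κ β / 2 * s) * (Real.sinh (Real.pi * ξ) * Real.pi) := by positivity
    linarith

/-- Barrier comparison used for the Hopf-type argument at the top boundary. -/
lemma hopf_barrier {w wx wy : ℝ × ℝ → ℝ} {M ξ : ℝ} (hw : HarmonicOnR2 w Dset)
    (hxy : ∀ p ∈ Dset, wx p = pdx w p ∧ wy p = pdy w p)
    (hwxc : ContinuousOn wx clDset) (hwyc : ContinuousOn wy clDset) (hξ : M < ξ)
    (weak : ∀ ξ η, M ≤ ξ → 0 ≤ η → η ≤ 1 → wx (ξ, η) ≤ 0)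
    (strict : ∀ ξ η, M < ξ → 0 < η → η < 1 → wx (ξ, η) < 0) :
    ∃ c k : ℝ, 0 < c ∧ 0 < k ∧ ∀ y ∈ Icc (1 / 2 : ℝ) 1,
      wx (ξ, y) + c * Real.sinh (k * (1 - y)) ≤ 0 := by
  obtain ⟨ρ, hρ⟩ : ∃ ρ, ρ = (ξ - M) / 2 := ⟨_, rfl⟩
  have hρ0 : 0 < ρ := by rw [hρ]; linarith
  have hρM : M < ξ - ρ := by rw [hρ]; linarith
  obtain ⟨k, hk⟩ : ∃ k, k = Real.pi / (2 * ρ) := ⟨_, rfl⟩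
  have hk0 : 0 < k := by rw [hk]; positivity
  have hkρ : k * ρ = Real.pi / 2 := by rw [hk]; field_simp
  have hbc : ContinuousOn (fun x => wx (x, 1 / 2)) (Icc (ξ - ρ) (ξ + ρ)) := by
    refine hwxc.comp (by fun_prop) ?_
    exact fun x _ => ⟨mem_univ _, by norm_num⟩
  obtain ⟨x₀, hx₀, hmax⟩ := isCompact_Icc.exists_isMaxOn ⟨ξ, by constructor <;> linarith⟩ hbc
  obtain ⟨m, hm⟩ : ∃ m, m = -wx (x₀, 1 / 2) := ⟨_, rfl⟩
  have hm0 : 0 < m := by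
    rw [hm, neg_pos]; exact strict _ _ (by linarith [hx₀.1]) (by norm_num) (by norm_num)
  have hsh : 0 < Real.sinh (k / 2) := Real.sinh_pos_iff.2 (by positivity)
  obtain ⟨c, hc⟩ : ∃ c, c = m / Real.sinh (k / 2) := ⟨_, rfl⟩
  have hc0 : 0 < c := by rw [hc]; positivity
  have hcm : c * Real.sinh (k / 2) = m := by rw [hc]; field_simp
  refine ⟨c, k, hc0, hk0, ?_⟩
  have hre : ∀ z : ℂ, (hgrad wx wy z + c * (Complex.I * Complex.sin (k * (z - ξ - Complex.I)))).re
      = wx (z.re, z.im) + c * (Real.cos (k * (z.re - ξ)) * Real.sinh (k * (1 - z.im))) := by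
    intro z
    have e : (k * (z - ξ - Complex.I) : ℂ) =
        ((k * (z.re - ξ) : ℝ) : ℂ) + ((k * (z.im - 1) : ℝ) : ℂ) * Complex.I := by
      apply Complex.ext <;> simp
    have e3 : k * (1 - z.im) = -(k * (z.im - 1)) := by ring
    rw [Complex.add_re, hgrad_re, e, Complex.sin_add_mul_I, e3, Real.sinh_neg,
      ← Complex.ofReal_sin, ← Complex.ofReal_cos, ← Complex.ofReal_sinh, ← Complex.ofReal_cosh]
    generalize Real.sin (k * (z.re - ξ)) = A₁
    generalize Real.cos (k * (z.re - ξ)) = A₂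
    generalize Real.sinh (k * (z.im - 1)) = A₃
    generalize Real.cosh (k * (z.im - 1)) = A₄
    simp
  have key := rect_max (H := fun z => hgrad wx wy z +
      c * (Complex.I * Complex.sin (k * (z - ξ - Complex.I))))
    (a := ξ - ρ) (b := ξ + ρ) (c := 1 / 2) (d := 1) (by linarith) (by norm_num)
    (by
      intro z _ h2
      refine (hgrad_diff hw hxy ⟨mem_univ _, by linarith [h2.1], h2.2⟩).add ?_
      fun_prop)
    (by
      refine ((hgrad_cont hwxc hwyc).mono ?_).add (by fun_prop)
      exact fun z hz => ⟨by linarith [hz.2.1], hz.2.2⟩)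
    (by
      intro z h1 h2 h3
      rw [hre]
      have hv := weak z.re z.im (by linarith [h1.1]) (by linarith [h2.1]) h2.2
      rcases h3 with h | h | h | h
      · have : k * (z.re - ξ) = -(Real.pi / 2) := by rw [h, ← hkρ]; ring
        rw [this, Real.cos_neg, Real.cos_pi_div_two]
        linarith
      · have : k * (z.re - ξ) = Real.pi / 2 := by rw [h, ← hkρ]; ring
        rw [this, Real.cos_pi_div_two]
        linarith
      · have h5 : wx (z.re, 1 / 2) ≤ -m := by rw [hm, neg_neg]; exact hmax h1
        have h6 : k * (1 - 1 / 2) = k / 2 := by ring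
        have h7 : Real.cos (k * (z.re - ξ)) * Real.sinh (k / 2) ≤ 1 * Real.sinh (k / 2) := by
          gcongr; exact Real.cos_le_one _
        have h8 := mul_le_mul_of_nonneg_left h7 hc0.le
        rw [h, h6]
        linarith
      · rw [h] at hv ⊢
        simpa using hv)
  intro y hy
  have := key ⟨ξ, y⟩ ⟨by simp only; linarith, by simp only; linarith⟩ hy
  rw [hre] at this
  simpa using this

lemma convex_reProdIm' {s t : Set ℝ} (hs : Convex ℝ s) (ht : Convex ℝ t) : Convex ℝ (s ×ℂ t) :=
  (hs.linear_preimage Complex.reLm).inter (ht.linear_preimage Complex.imLm)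

theorem statement5 (F M : ℝ) (hF0 : 0 < F) (hF : 1 < F ^ 2) (hM : 0 < M) :
    ∃ δ > 0, ∀ β κ : ℝ, β ∈ Ioo (-1 : ℝ) 1 →
      κ * Real.sin (Real.pi * β) < Real.cos (Real.pi * β) →
      ∀ w wx wy : ℝ × ℝ → ℝ,
      -- regularity: continuity, harmonicity, and continuous extensions of the partial
      -- derivatives up to second order to the closed strip
      ContinuousOn w clDset →
      HarmonicOnR2 w Dset →
      ContinuousOn wx clDset → ContinuousOn wy clDset →
      (∀ p ∈ Dset, wx p = pdx w p ∧ wy p = pdy w p) →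
      (∀ i j : ℕ, i + j ≤ 2 → ∃ g : ℝ × ℝ → ℝ, ContinuousOn g clDset ∧
        ∀ p ∈ Dset, g p = (pdx^[i] (pdy^[j] w)) p) →
      -- `w` is not identically zero
      (¬ ∀ p ∈ clDset, w p = 0) →
      -- odd in `η`
      (∀ ξ η : ℝ, w (ξ, -η) = -w (ξ, η)) →
      -- `w` and its gradient tend to `0` as `|ξ| → ∞`, uniformly in `η`
      (∀ ε > 0, ∃ R : ℝ, ∀ p ∈ clDset, R ≤ |p.1| → |w p| + |wx p| + |wy p| < ε) →
      -- conformality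
      (∀ p ∈ clDset, 0 < (wx p) ^ 2 + (1 + wy p) ^ 2) →
      -- Bernoulli condition for `ξ > M`
      (∀ ξ : ℝ, M < ξ →
        1 / 2 * (avort κ β ξ) ^ 2 / ((wx (ξ, 1)) ^ 2 + (1 + wy (ξ, 1)) ^ 2)
          + w (ξ, 1) / F ^ 2 = 1 / 2) →
      -- smallness on the top boundary beyond `M`
      (∀ ξ : ℝ, M < ξ → |w (ξ, 1)| + |wx (ξ, 1)| + |wy (ξ, 1)| < δ) →
      -- sign condition on the segment `L^M`
      (∀ η ∈ Icc (0 : ℝ) 1, wx (M, η) ≤ 0) →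
      -- conclusion: strict monotonicity on `D₊^M ∪ Γ^M`
      ∀ p : ℝ × ℝ, M < p.1 → 0 < p.2 → p.2 ≤ 1 → wx p < 0 := by
  have hF2 : 0 < F ^ 2 := by positivity
  obtain ⟨δ, hδ⟩ : ∃ δ, δ = (F ^ 2 - 1) / (24 * F ^ 2) := ⟨_, rfl⟩
  have hδ0 : 0 < δ := by rw [hδ]; exact div_pos (by linarith) (by positivity)
  have hδF : 24 * (F ^ 2 * δ) = F ^ 2 - 1 := by rw [hδ]; field_simp
  have hδ1 : δ < 1 / 24 := by nlinarith
  refine ⟨δ, hδ0, ?_⟩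
  intro β κ _ hκ w wx wy hwc hw hwxc hwyc hxy hreg hne hodd hdec hconf hbern hsmall hleft
  obtain ⟨g20, hg20c, hg20⟩ := hreg 2 0 (by norm_num)
  obtain ⟨g11, hg11c, hg11⟩ := hreg 1 1 (by norm_num)
  have hw_dx : ∀ p ∈ Dset, HasDerivAt (fun x => w (x, p.2)) (wx p) p.1 := by
    intro p hp
    rw [(hxy p hp).1, pdx_eq (w_diffAt hw.1 hp)]
    exact hasDerivAt_x (w_diffAt hw.1 hp)
  have hwx_dx : ∀ p ∈ Dset, HasDerivAt (fun x => wx (x, p.2)) (g20 p) p.1 := by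
    intro p hp
    have h := (pdx_hasFDerivAt hw.1 hp).differentiableAt
    have e : (fun x => wx (x, p.2)) = fun x => pdx w (x, p.2) :=
      funext fun x => (hxy (x, p.2) ⟨mem_univ _, hp.2⟩).1
    have e2 : g20 p = pdx (pdx w) p := hg20 p hp
    rw [e, e2, pdx_eq h]
    exact hasDerivAt_x h
  have hwy_dx : ∀ p ∈ Dset, HasDerivAt (fun x => wy (x, p.2)) (g11 p) p.1 := by
    intro p hp
    have h := (pdy_hasFDerivAt hw.1 hp).differentiableAt
    have e : (fun x => wy (x, p.2)) = fun x => pdy w (x, p.2) :=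
      funext fun x => (hxy (x, p.2) ⟨mem_univ _, hp.2⟩).2
    have e2 : g11 p = pdx (pdy w) p := hg11 p hp
    rw [e, e2, pdx_eq h]
    exact hasDerivAt_x h
  have hwx_dy : ∀ p ∈ Dset, HasDerivAt (fun y => wx (p.1, y)) (g11 p) p.2 := by
    intro p hp
    have h := (pdx_hasFDerivAt hw.1 hp).differentiableAt
    have e2 : g11 p = pdx (pdy w) p := hg11 p hp
    rw [e2, ← pd_symm hw.1 hp, pdy_eq h]
    refine (hasDerivAt_y h).congr_of_eventuallyEq ?_
    filter_upwards [isOpen_Ioo.mem_nhds hp.2] with y hy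
    exact (hxy (p.1, y) ⟨mem_univ _, hy⟩).1
  have tw := trace_deriv hwc hwxc hw_dx
  have twx := trace_deriv hwxc hg20c hwx_dx
  have twy := trace_deriv hwyc hg11c hwy_dx
  have nwx := normal_deriv hwxc hg11c hwx_dy
  -- differentiated Bernoulli condition
  have B : ∀ ξ, M < ξ → (wx (ξ, 1) * g20 (ξ, 1) + (1 + wy (ξ, 1)) * g11 (ξ, 1)) *
      (1 - 2 * w (ξ, 1) / F ^ 2) ≤
      ((wx (ξ, 1)) ^ 2 + (1 + wy (ξ, 1)) ^ 2) * wx (ξ, 1) / F ^ 2 := by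
    intro ξ hξ
    obtain ⟨a', ha', hneg⟩ := avort_deriv (ξ := ξ) hκ (hM.trans hξ)
    have d1 := ha'.pow 2
    have d2 := (((twx ξ).pow 2).add (((twy ξ).const_add 1).pow 2)).mul
      ((((tw ξ).const_mul 2).div_const (F ^ 2)).const_sub 1)
    have e : (avort κ β ^ 2) =ᶠ[𝓝 ξ]
        (((fun x => wx (x, 1)) ^ 2 + (fun x => 1 + wy (x, 1)) ^ 2) *
          fun x => 1 - 2 * w (x, 1) / F ^ 2) := by
      filter_upwards [isOpen_Ioi.mem_nhds hξ] with x hx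
      have hQ := hconf (x, 1) ⟨mem_univ _, by norm_num⟩
      have hb := hbern x hx
      simp only [Pi.pow_apply, Pi.mul_apply, Pi.add_apply]
      have h5 : 1 / 2 * (avort κ β x) ^ 2 / ((wx (x, 1)) ^ 2 + (1 + wy (x, 1)) ^ 2)
          = 1 / 2 - w (x, 1) / F ^ 2 := by linarith
      rw [div_eq_iff hQ.ne'] at h5
      have h6 : 2 * w (x, 1) / F ^ 2 = 2 * (w (x, 1) / F ^ 2) := by ring
      rw [h6]
      linarith
    have h := d1.unique (d2.congr_of_eventuallyEq e)
    simp only [Pi.pow_apply, Pi.add_apply] at h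
    norm_num at h
    have h7 : 2 * wx (ξ, 1) / F ^ 2 = 2 * (wx (ξ, 1) / F ^ 2) := by ring
    have h8 : ((wx (ξ, 1)) ^ 2 + (1 + wy (ξ, 1)) ^ 2) * wx (ξ, 1) / F ^ 2 =
      ((wx (ξ, 1)) ^ 2 + (1 + wy (ξ, 1)) ^ 2) * (wx (ξ, 1) / F ^ 2) := by ring
    rw [h7] at h
    rw [h8]
    linarith
  have hbot : ∀ ξ, wx (ξ, 0) = 0 := by
    intro ξ
    rw [(hxy (ξ, 0) ⟨mem_univ _, by norm_num⟩).1]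
    have : (fun x => w (x, 0)) = fun _ => 0 := by
      funext x
      have := hodd x 0
      rw [neg_zero] at this
      linarith
    simp [pdx, this]
  -- smallness consequences at the top
  have hpos : ∀ ξ, M < ξ → 0 < 1 + wy (ξ, 1) ∧ 0 < 1 - 2 * w (ξ, 1) / F ^ 2 ∧
      ((wx (ξ, 1)) ^ 2 + (1 + wy (ξ, 1)) ^ 2) / F ^ 2 * (1 + δ) <
        (1 + wy (ξ, 1)) * (1 - 2 * w (ξ, 1) / F ^ 2) := by
    intro ξ hξ
    have hs := hsmall ξ hξ
    have h1 : |w (ξ, 1)| < δ := by linarith [abs_nonneg (wx (ξ, 1)), abs_nonneg (wy (ξ, 1))]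
    have h2 : |wx (ξ, 1)| < δ := by linarith [abs_nonneg (w (ξ, 1)), abs_nonneg (wy (ξ, 1))]
    have h3 : |wy (ξ, 1)| < δ := by linarith [abs_nonneg (w (ξ, 1)), abs_nonneg (wx (ξ, 1))]
    rw [abs_lt] at h1 h2 h3
    have h4 : 2 * w (ξ, 1) / F ^ 2 < 2 * δ := by
      rw [div_lt_iff₀ hF2]; nlinarith
    refine ⟨by linarith, by linarith, ?_⟩
    have hQ : (wx (ξ, 1)) ^ 2 + (1 + wy (ξ, 1)) ^ 2 ≤ 1 + 4 * δ := by nlinarith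
    have h9 : ((wx (ξ, 1)) ^ 2 + (1 + wy (ξ, 1)) ^ 2) / F ^ 2 * (1 + δ) < 1 - 3 * δ := by
      rw [div_mul_eq_mul_div, div_lt_iff₀ hF2]
      nlinarith
    have h10 : (1 - δ) * (1 - 2 * δ) ≤ (1 + wy (ξ, 1)) * (1 - 2 * w (ξ, 1) / F ^ 2) :=
      mul_le_mul (by linarith) (by linarith) (by linarith) (by linarith)
    nlinarith
  -- the region
  have hUo : IsOpen (Ioi M ×ℂ Ioo (0 : ℝ) 1) := isOpen_Ioi.reProdIm isOpen_Ioo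
  have hUc : IsPreconnected (Ioi M ×ℂ Ioo (0 : ℝ) 1) :=
    (convex_reProdIm' (convex_Ioi M) (convex_Ioo 0 1)).isPreconnected
  have hUD : ∀ z ∈ Ioi M ×ℂ Ioo (0 : ℝ) 1, (z.re, z.im) ∈ Dset := fun z hz =>
    ⟨mem_univ _, by linarith [hz.2.1], hz.2.2⟩
  have hhU : DifferentiableOn ℂ (hgrad wx wy) (Ioi M ×ℂ Ioo (0 : ℝ) 1) := fun z hz =>
    (hgrad_diff hw hxy (hUD z hz)).differentiableWithinAt
  -- weak sign
  have weak : ∀ ξ η, M ≤ ξ → 0 ≤ η → η ≤ 1 → wx (ξ, η) ≤ 0 := by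
    intro ξ₁ η₁ hξ₁ hη₁ hη₁'
    by_contra hcon
    push Not at hcon
    let u : ℝ × ℝ → ℝ := fun p => wx p / (p.2 + δ)
    have hu1 : 0 < u (ξ₁, η₁) := div_pos hcon (by simp only; linarith)
    obtain ⟨R, hR⟩ := hdec (δ * u (ξ₁, η₁)) (by positivity)
    let K : Set (ℝ × ℝ) := Icc M (max R ξ₁) ×ˢ Icc (0 : ℝ) 1
    have hK : IsCompact K := isCompact_Icc.prod isCompact_Icc
    have hK1 : (ξ₁, η₁) ∈ K := ⟨⟨hξ₁, le_max_right _ _⟩, hη₁, hη₁'⟩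
    have hKD : K ⊆ clDset := fun p hp => ⟨mem_univ _, by linarith [hp.2.1], hp.2.2⟩
    have huc : ContinuousOn u K := by
      refine (hwxc.mono hKD).div (by fun_prop) ?_
      intro p hp
      have := hp.2.1
      linarith
    obtain ⟨p, hpK, hpm⟩ := hK.exists_isMaxOn ⟨_, hK1⟩ huc
    obtain ⟨μ, hμ⟩ : ∃ μ, μ = u p := ⟨_, rfl⟩
    have hμ1 : u (ξ₁, η₁) ≤ μ := by rw [hμ]; exact hpm hK1
    have hμ0 : 0 < μ := hu1.trans_le hμ1
    have hall : ∀ ξ η, M ≤ ξ → 0 ≤ η → η ≤ 1 → wx (ξ, η) ≤ μ * (η + δ) := by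
      intro ξ η h1 h2 h3
      by_cases hξR : ξ ≤ max R ξ₁
      · have : u (ξ, η) ≤ μ := by rw [hμ]; exact hpm (⟨⟨h1, hξR⟩, h2, h3⟩ : (ξ, η) ∈ K)
        exact (div_le_iff₀ (by linarith)).1 this
      · push Not at hξR
        have h4 := hR (ξ, η) ⟨mem_univ _, by simp only; linarith, h3⟩
          ((le_max_left R ξ₁).trans (hξR.le.trans (le_abs_self ξ)))
        have h5 : wx (ξ, η) < δ * u (ξ₁, η₁) := by
          linarith [le_abs_self (wx (ξ, η)), abs_nonneg (w (ξ, η)), abs_nonneg (wy (ξ, η))]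
        have h6 : δ * u (ξ₁, η₁) ≤ δ * μ := by gcongr
        have h7 : 0 ≤ μ * η := by positivity
        linarith
    obtain ⟨ξ, η⟩ := p
    obtain ⟨⟨hξM, -⟩, hη0, hη1⟩ := hpK
    simp only at hξM hη0 hη1
    have heq : wx (ξ, η) = μ * (η + δ) := by
      rw [hμ]; simp only [u]; rw [div_mul_cancel₀]; linarith
    have hvpos : 0 < wx (ξ, η) := by rw [heq]; positivity
    have hη0' : 0 < η := by
      rcases hη0.eq_or_lt with h | h
      · rw [← h, hbot] at hvpos; exact absurd hvpos (lt_irrefl _)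
      · exact h
    have hξM' : M < ξ := by
      rcases hξM.eq_or_lt with h | h
      · rw [← h] at hvpos; linarith [hleft η ⟨hη0, hη1⟩]
      · exact h
    rcases hη1.eq_or_lt with h1 | h1
    · -- top
      subst h1
      have e1 : g20 (ξ, 1) = 0 := by
        have hm : IsLocalMax (fun x => wx (x, 1)) ξ := by
          filter_upwards [isOpen_Ioi.mem_nhds hξM'] with x hx
          rw [heq]
          exact hall x 1 (le_of_lt hx) (by norm_num) le_rfl
        exact hm.hasDerivAt_eq_zero (twx ξ)
      have e2 : μ ≤ g11 (ξ, 1) := by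
        have hd := (nwx ξ).sub (((hasDerivAt_id (1 : ℝ)).const_mul μ).hasDerivWithinAt (s := Iic 1))
        have := deriv_nonneg_of_le hd (by
          intro y hy
          have := hall ξ y hξM (by linarith [hy.1]) hy.2.le
          simp only [Pi.sub_apply, id]
          rw [heq]
          linarith)
        linarith
      have hB := B ξ hξM'
      obtain ⟨p1, p2, p3⟩ := hpos ξ hξM'
      rw [e1] at hB
      have h8 : (1 + wy (ξ, 1)) * (1 - 2 * w (ξ, 1) / F ^ 2) * μ ≤
          (1 + wy (ξ, 1)) * (1 - 2 * w (ξ, 1) / F ^ 2) * g11 (ξ, 1) := by gcongr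
      have h9 : ((wx (ξ, 1)) ^ 2 + (1 + wy (ξ, 1)) ^ 2) * wx (ξ, 1) / F ^ 2 =
          ((wx (ξ, 1)) ^ 2 + (1 + wy (ξ, 1)) ^ 2) / F ^ 2 * (1 + δ) * μ := by
        nth_rewrite 2 [heq]; ring
      rw [h9] at hB
      have h10 := mul_lt_mul_of_pos_right p3 hμ0
      linarith
    · -- interior
      have hzU : (⟨ξ, η⟩ : ℂ) ∈ Ioi M ×ℂ Ioo (0 : ℝ) 1 := ⟨hξM', hη0', h1⟩
      have hre : ∀ z : ℂ, (hgrad wx wy z + Complex.I * (μ * z)).re = wx (z.re, z.im) - μ * z.im := by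
        intro z
        rw [Complex.add_re, hgrad_re]
        simp
        ring
      have := strong_max (H := fun z => hgrad wx wy z + Complex.I * (μ * z)) hUc hUo
        (hhU.add (by fun_prop)) hzU (by
          intro z hz
          rw [hre, hre, heq]
          have := hall z.re z.im (le_of_lt hz.1) hz.2.1.le hz.2.2.le
          simp only
          linarith)
      have hcst : ∀ y ∈ Ioo (0 : ℝ) 1, wx (ξ, y) - μ * y = μ * δ := by
        intro y hy
        have h2 := re_eq_of_exp (this ⟨ξ, y⟩ ⟨hξM', hy⟩)
        rw [hre, hre, heq] at h2
        simp only at h2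
        linarith
      have hcont : ContinuousOn (fun y => wx (ξ, y) - μ * y) (Icc 0 1) := by
        refine ContinuousOn.sub (hwxc.comp (by fun_prop) ?_) (by fun_prop)
        exact fun y hy => ⟨mem_univ _, by linarith [hy.1], hy.2⟩
      have h3 : EqOn (fun y => wx (ξ, y) - μ * y) (fun _ => μ * δ) (Icc 0 1) := by
        refine EqOn.of_subset_closure (s := Ioo 0 1) hcst hcont continuousOn_const
          Ioo_subset_Icc_self ?_
        rw [closure_Ioo (by norm_num)]
      have h4 := h3 (show (0 : ℝ) ∈ Icc (0 : ℝ) 1 by norm_num)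
      simp only [hbot] at h4
      have : 0 < μ * δ := by positivity
      linarith
  -- interior strict sign
  have strict : ∀ ξ η, M < ξ → 0 < η → η < 1 → wx (ξ, η) < 0 := by
    intro ξ η hξ hη hη1
    refine lt_of_le_of_ne (weak ξ η hξ.le hη.le hη1.le) fun h0 => hne ?_
    have hzU : (⟨ξ, η⟩ : ℂ) ∈ Ioi M ×ℂ Ioo (0 : ℝ) 1 := ⟨hξ, hη, hη1⟩
    have h1 := strong_max hUc hUo hhU hzU (by
      intro z hz
      rw [hgrad_re, hgrad_re]
      simp only
      rw [h0]
      exact weak _ _ (le_of_lt hz.1) hz.2.1.le hz.2.2.le)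
    have hSo : IsOpen (univ ×ℂ Ioo (-1 : ℝ) 1) := isOpen_univ.reProdIm isOpen_Ioo
    have hSc : IsPreconnected (univ ×ℂ Ioo (-1 : ℝ) 1) :=
      (convex_reProdIm' convex_univ (convex_Ioo (-1) 1)).isPreconnected
    have hS : DifferentiableOn ℂ (fun z => Complex.exp (hgrad wx wy z)) (univ ×ℂ Ioo (-1 : ℝ) 1) :=
      fun z hz => (hgrad_diff hw hxy ⟨mem_univ _, hz.2⟩).cexp.differentiableWithinAt
    have h2 := (hS.analyticOnNhd hSo).eqOn_of_preconnected_of_eventuallyEq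
      (g := fun _ => Complex.exp (hgrad wx wy ⟨ξ, η⟩)) analyticOnNhd_const hSc
      (z₀ := ⟨ξ, η⟩) ⟨mem_univ _, by simp only; linarith, hη1⟩ (by
        filter_upwards [hUo.mem_nhds hzU] with z hz using h1 z hz)
    have h3 : ∀ p ∈ Dset, wx p = 0 := by
      intro p hp
      have := re_eq_of_exp (h2 (⟨mem_univ _, hp.2⟩ : (⟨p.1, p.2⟩ : ℂ) ∈ univ ×ℂ Ioo (-1 : ℝ) 1))
      rw [hgrad_re, hgrad_re] at this
      simp only at this
      rw [h0] at this
      exact this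
    have h4 : ∀ p ∈ Dset, w p = 0 := by
      intro p hp
      by_contra hp0
      obtain ⟨R, hR⟩ := hdec |w p| (abs_pos.2 hp0)
      have hq : ((|R| : ℝ), p.2) ∈ Dset := ⟨mem_univ _, hp.2⟩
      have hcst : w (|R|, p.2) = w (p.1, p.2) := by
        apply is_const_of_deriv_eq_zero (f := fun x => w (x, p.2))
        · exact fun x => (hw_dx (x, p.2) ⟨mem_univ _, hp.2⟩).differentiableAt
        · intro x
          rw [(hw_dx (x, p.2) ⟨mem_univ _, hp.2⟩).deriv]
          exact h3 _ ⟨mem_univ _, hp.2⟩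
      have h5 := hR _ (Dset_sub hq) (by simp only [abs_abs]; exact le_abs_self R)
      rw [hcst] at h5
      have h6 : w (p.1, p.2) = w p := rfl
      rw [h6] at h5
      linarith [abs_nonneg (wx (|R|, p.2)), abs_nonneg (wy (|R|, p.2))]
    have hcl : clDset ⊆ closure Dset := by
      rw [Dset, closure_prod_eq, closure_univ, closure_Ioo (by norm_num)]
      exact subset_rfl
    exact EqOn.of_subset_closure (s := Dset) (g := fun _ => (0 : ℝ)) h4 hwc continuousOn_const Dset_sub hcl
  rintro ⟨ξ, η⟩ hξ hη hη1
  simp only at hξ hη hη1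
  rcases hη1.eq_or_lt with h1 | h1
  swap
  · exact strict ξ η hξ hη h1
  subst h1
  refine lt_of_le_of_ne (weak ξ 1 hξ.le hη.le le_rfl) fun h0 => ?_
  have e1 : g20 (ξ, 1) = 0 := by
    have hm : IsLocalMax (fun x => wx (x, 1)) ξ := by
      filter_upwards [isOpen_Ioi.mem_nhds hξ] with x hx
      rw [h0]
      exact weak x 1 (le_of_lt hx) (by norm_num) le_rfl
    exact hm.hasDerivAt_eq_zero (twx ξ)
  obtain ⟨c, k, hc, hk, hop⟩ := hopf_barrier hw hxy hwxc hwyc hξ weak strict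
  have e2 : 0 < g11 (ξ, 1) := by
    have hs : HasDerivAt (fun y : ℝ => c * Real.sinh (k * (1 - y))) (-(c * k)) 1 := by
      have := ((((hasDerivAt_id (1 : ℝ)).const_sub 1).const_mul k).sinh).const_mul c
      simpa using this
    have hd := (nwx ξ).add (hs.hasDerivWithinAt (s := Iic 1))
    have := deriv_nonneg_of_le hd (by
      intro y hy
      have := hop y ⟨hy.1.le, hy.2.le⟩
      simp only [Pi.add_apply]
      rw [h0]
      simpa using this)
    have : 0 < c * k := by positivity
    linarith
  have hB := B ξ hξ
  obtain ⟨p1, p2, -⟩ := hpos ξ hξ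
  rw [e1, h0] at hB
  have : 0 < (1 + wy (ξ, 1)) * g11 (ξ, 1) * (1 - 2 * w (ξ, 1) / F ^ 2) := by positivity
  simp at hB
  linarith
end

section
/- Fix F > 0 with F² > 1. Let ẅ : cl(D) → ℝ be continuous, harmonic in D, with all partial derivatives up to second order extending continuously to cl(D), satisfying ẅ(−ξ,η) = ẅ(ξ,η) and ẅ(ξ,−η) = −ẅ(ξ,η), such that ẅ and its gradient tend to 0 as |ξ| → ∞ uniformly in η, and such that ∂_η ẅ(ξ,1) − ẅ(ξ,1)/F² = π²·sech²(πξ/2) for every ξ ∈ ℝ. Then ∂_ξ ẅ < 0 on the set {(ξ,η) : ξ > 0, 0 < η ≤ 1}. -/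
open Set

lemma aux_second {f : ℝ → ℝ} {x : ℝ} (hf : ContDiffAt ℝ 2 f x) (hm : IsLocalMax f x) :
    deriv (deriv f) x ≤ 0 := by
  by_contra hpos
  push Not at hpos
  have hmin := isLocalMin_of_deriv_deriv_pos hpos hm.deriv_eq_zero hf.continuousAt
  have hc : f =ᶠ[nhds x] fun _ => f x := by
    filter_upwards [hm, hmin] with y h1 h2
    exact le_antisymm h1 h2
  have h2 : deriv (deriv f) x = 0 := by
    rw [hc.deriv.deriv_eq]
    simp
  linarith

lemma aux_add {f g : ℝ → ℝ} {x : ℝ} (hf : ContDiffAt ℝ 2 f x) (hg : ContDiffAt ℝ 2 g x) :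
    deriv (deriv (fun y => f y + g y)) x = deriv (deriv f) x + deriv (deriv g) x := by
  have h := iteratedDeriv_fun_add hf hg
  simpa [iteratedDeriv_succ, iteratedDeriv_zero] using h

lemma aux_smul {f : ℝ → ℝ} {x : ℝ} (c : ℝ) :
    deriv (deriv (fun y => c * f y)) x = c * deriv (deriv f) x := by
  have : deriv (fun y => c * f y) = fun y => c * deriv f y := by
    funext y; simp
  rw [this]; simp

lemma aux_phi' (s : ℝ) (y : ℝ) :
    HasDerivAt (fun y : ℝ => s + y - s * y ^ 2) (1 - 2 * s * y) y := by
  have := (((hasDerivAt_id' y).const_add s).fun_sub (((hasDerivAt_id' y).fun_pow 2).const_mul s))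
  refine this.congr_deriv ?_
  push_cast
  ring

lemma aux_phi (s y : ℝ) : deriv (deriv (fun y => s + y - s * y ^ 2)) y = -2 * s := by
  have : deriv (fun y : ℝ => s + y - s * y ^ 2) = fun y => 1 - 2 * s * y := by
    funext y
    exact (aux_phi' s y).deriv
  rw [this]
  have := (((hasDerivAt_id' y).const_mul (2 * s)).const_sub 1).deriv
  rw [this]; ring

lemma aux_left {f : ℝ → ℝ} {d : ℝ} (hf : HasDerivWithinAt f d (Iic 1) 1)
    (hm : ∀ y ∈ Icc (0 : ℝ) 1, f y ≤ f 1) : 0 ≤ d := by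
  have h1 : HasDerivWithinAt f d (Iio 1) 1 := hf.mono Iio_subset_Iic_self
  have h2 := (hasDerivWithinAt_iff_tendsto_slope' (by simp)).1 h1
  refine ge_of_tendsto h2 ?_
  have : Ico (0:ℝ) 1 ∈ nhdsWithin (1:ℝ) (Iio 1) := Ico_mem_nhdsLT (by norm_num)
  filter_upwards [this] with y hy
  rw [slope_def_field]
  exact div_nonneg_of_nonpos (by linarith [hm y ⟨hy.1, hy.2.le⟩]) (by linarith [hy.2])

lemma aux_right {f : ℝ → ℝ} {a b d : ℝ} (hab : a < b) (hf : HasDerivAt f d a)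
    (hm : ∀ y ∈ Icc a b, f y ≤ f a) : d ≤ 0 := by
  have h1 : HasDerivWithinAt f d (Ioi a) a := hf.hasDerivWithinAt
  have h2 := (hasDerivWithinAt_iff_tendsto_slope' (by simp)).1 h1
  refine le_of_tendsto h2 ?_
  have : Ioc a b ∈ nhdsWithin a (Ioi a) := Ioc_mem_nhdsGT hab
  filter_upwards [this] with y hy
  rw [slope_def_field]
  exact div_nonpos_of_nonpos_of_nonneg (by linarith [hm y ⟨hy.1.le, hy.2⟩]) (by linarith [hy.1])

/-- Maximum principle on a rectangle with a Robin condition at the top. -/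
lemma aux_max (κ s a b : ℝ) (hs : 0 < s) (hs1 : s < 1) (hκ : κ < 1 - 2 * s)
    (u : ℝ → ℝ → ℝ)
    (hc : ContinuousOn (fun p : ℝ × ℝ => u p.1 p.2) (Icc a b ×ˢ Icc 0 1))
    (hd : ∀ x ∈ Ioo a b, ∀ y ∈ Ioo (0:ℝ) 1, ContDiffAt ℝ 2 (fun x => u x y) x ∧
      ContDiffAt ℝ 2 (u x) y ∧ 0 ≤ deriv (deriv (fun x => u x y)) x + deriv (deriv (u x)) y)
    (hl : ∀ y ∈ Icc (0:ℝ) 1, u a y ≤ 0) (hr : ∀ y ∈ Icc (0:ℝ) 1, u b y ≤ 0)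
    (hb : ∀ x ∈ Icc a b, u x 0 ≤ 0)
    (ht : ∀ x ∈ Ioo a b, ∃ d, HasDerivWithinAt (u x) d (Iic 1) 1 ∧ d ≤ κ * u x 1) :
    ∀ x ∈ Icc a b, ∀ y ∈ Icc (0:ℝ) 1, u x y ≤ 0 := by
  intro x1 hx1 y1 hy1
  have hφ : ∀ y ∈ Icc (0:ℝ) 1, 0 < s + y - s * y ^ 2 := by
    intro y hy
    nlinarith [hy.1, hy.2, mul_nonneg hs.le (mul_nonneg hy.1 (sub_nonneg.2 hy.2)),
      mul_nonneg hy.1 (sub_nonneg.2 hs1.le)]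
  have hcomp : IsCompact (Icc a b ×ˢ Icc (0:ℝ) 1) := isCompact_Icc.prod isCompact_Icc
  have hcq : ContinuousOn (fun p : ℝ × ℝ => u p.1 p.2 / (s + p.2 - s * p.2 ^ 2))
      (Icc a b ×ˢ Icc 0 1) :=
    hc.div (by fun_prop) (fun p hp => (hφ p.2 hp.2).ne')
  obtain ⟨⟨x0, y0⟩, ⟨hx0, hy0⟩, hmax⟩ := hcomp.exists_isMaxOn ⟨(x1, y1), hx1, hy1⟩ hcq
  simp only at hx0 hy0
  set M := u x0 y0 / (s + y0 - s * y0 ^ 2) with hM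
  have hle : ∀ x ∈ Icc a b, ∀ y ∈ Icc (0:ℝ) 1, u x y ≤ M * (s + y - s * y ^ 2) := by
    intro x hx y hy
    have : u x y / (s + y - s * y ^ 2) ≤ M := hmax (show (x, y) ∈ _ from ⟨hx, hy⟩)
    exact (div_le_iff₀ (hφ y hy)).1 this
  have heq : u x0 y0 = M * (s + y0 - s * y0 ^ 2) := by
    rw [hM]; field_simp [(hφ y0 hy0).ne']
  rcases le_or_gt M 0 with hM0 | hM0
  · exact (hle x1 hx1 y1 hy1).trans (mul_nonpos_of_nonpos_of_nonneg hM0 (hφ y1 hy1).le)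
  exfalso
  have hpos : 0 < u x0 y0 := by rw [heq]; exact mul_pos hM0 (hφ y0 hy0)
  have hxa : a < x0 := lt_of_le_of_ne hx0.1 (by rintro rfl; linarith [hl y0 hy0])
  have hxb : x0 < b := lt_of_le_of_ne hx0.2 (by rintro rfl; linarith [hr y0 hy0])
  have hy0' : 0 < y0 := lt_of_le_of_ne hy0.1 (by rintro rfl; linarith [hb x0 hx0])
  rcases hy0.2.lt_or_eq with hy1' | hy1'
  · obtain ⟨c1, c2, h3⟩ := hd x0 ⟨hxa, hxb⟩ y0 ⟨hy0', hy1'⟩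
    have m1 : IsLocalMax (fun x => u x y0) x0 := by
      filter_upwards [Icc_mem_nhds hxa hxb] with x hx
      rw [heq]; exact hle x hx y0 hy0
    have h1 := aux_second c1 m1
    have cφ : ContDiffAt ℝ 2 (fun y : ℝ => (-M) * (s + y - s * y ^ 2)) y0 := by fun_prop
    have m2 : IsLocalMax (fun y => u x0 y + (-M) * (s + y - s * y ^ 2)) y0 := by
      filter_upwards [Icc_mem_nhds hy0' hy1'] with y hy
      have := hle x0 hx0 y hy
      linarith
    have h2 := aux_second (c2.add cφ) m2
    rw [aux_add c2 cφ, aux_smul, aux_phi] at h2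
    nlinarith [mul_pos hM0 hs]
  · subst hy1'
    obtain ⟨d, hd1, hd2⟩ := ht x0 ⟨hxa, hxb⟩
    have h1 := hd1.sub (((aux_phi' s 1).const_mul M).hasDerivWithinAt (s := Iic 1))
    have h2 := aux_left h1 (by
      intro y hy
      have := hle x0 hx0 y hy
      simp only [Pi.sub_apply]
      linarith)
    have : u x0 1 = M := by rw [heq]; ring
    rw [this] at hd2
    nlinarith

lemma aux_g (l t : ℝ) (hl : 0 < l) (ht : 0 ≤ t) (htp : t ≤ Real.pi) :
    Real.pi ^ 2 * Real.sinh (Real.pi * l) * Real.sin t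
      / Real.cosh (Real.pi * (l + Real.pi) / 2) ^ 4 ≤
    Real.pi ^ 2 / Real.cosh (Real.pi * (l - t) / 2) ^ 2 -
    Real.pi ^ 2 / Real.cosh (Real.pi * (l + t) / 2) ^ 2 := by
  set A := Real.pi * (l - t) / 2 with hA
  set B := Real.pi * (l + t) / 2 with hB
  set K := Real.pi * (l + Real.pi) / 2 with hK
  have hpi := Real.pi_gt_three
  have e1 : Real.pi * l = B + A := by rw [hA, hB]; ring
  have e2 : Real.pi * t = B - A := by rw [hA, hB]; ring
  have hKB : B ≤ K := by rw [hB, hK]; nlinarith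
  have hB0 : 0 ≤ B := by rw [hB]; positivity
  have hKA : |A| ≤ K := by
    rw [abs_le]; constructor <;> rw [hA, hK] <;> nlinarith
  have hcA : Real.cosh A ≤ Real.cosh K := by
    rw [Real.cosh_le_cosh]; exact hKA.trans (le_abs_self _)
  have hcB : Real.cosh B ≤ Real.cosh K := by
    rw [Real.cosh_le_cosh, abs_of_nonneg hB0]; exact hKB.trans (le_abs_self _)
  have pA := Real.cosh_pos A
  have pB := Real.cosh_pos B
  have pK := Real.cosh_pos K
  have key : Real.cosh B ^ 2 - Real.cosh A ^ 2 = Real.sinh (Real.pi * l) * Real.sinh (Real.pi * t) := by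
    rw [e1, e2, Real.sinh_add, Real.sinh_sub]
    have a1 := Real.cosh_sq A
    have b1 := Real.cosh_sq B
    linear_combination Real.cosh A ^ 2 * b1 - Real.cosh B ^ 2 * a1
  have hsl : 0 < Real.sinh (Real.pi * l) := Real.sinh_pos_iff.2 (by positivity)
  have hst : Real.sin t ≤ Real.sinh (Real.pi * t) := by
    have h1 := Real.sin_le ht
    have h2 : Real.pi * t ≤ Real.sinh (Real.pi * t) := Real.self_le_sinh_iff.2 (by positivity)
    nlinarith
  have hs0 : 0 ≤ Real.sin t := Real.sin_nonneg_of_nonneg_of_le_pi ht htp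
  have : Real.pi ^ 2 / Real.cosh A ^ 2 - Real.pi ^ 2 / Real.cosh B ^ 2 =
      Real.pi ^ 2 * Real.sinh (Real.pi * l) * Real.sinh (Real.pi * t)
        / (Real.cosh A ^ 2 * Real.cosh B ^ 2) := by
    rw [mul_assoc, ← key]; field_simp
  rw [this]
  have hden : Real.cosh A ^ 2 * Real.cosh B ^ 2 ≤ Real.cosh K ^ 4 := by
    calc _ ≤ Real.cosh K ^ 2 * Real.cosh K ^ 2 := by gcongr
      _ = _ := by ring
  have : 0 ≤ Real.sinh (Real.pi * t) := hs0.trans hst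
  gcongr

theorem statement6 (F : ℝ) (hF0 : 0 < F) (hF : 1 < F ^ 2)
    (w wx wy : ℝ × ℝ → ℝ)
    (hw : ContinuousOn w clDset)
    (hharm : HarmonicOnR2 w Dset)
    (hwx : ContinuousOn wx clDset) (hwy : ContinuousOn wy clDset)
    (hext : ∀ p ∈ Dset, wx p = pdx w p ∧ wy p = pdy w p)
    (hext2 : ∀ i j : ℕ, i + j ≤ 2 → ∃ g : ℝ × ℝ → ℝ, ContinuousOn g clDset ∧
      ∀ p ∈ Dset, g p = (pdx^[i] (pdy^[j] w)) p)
    -- even in `ξ`, odd in `η`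
    (hsym : ∀ ξ η : ℝ, w (-ξ, η) = w (ξ, η) ∧ w (ξ, -η) = -w (ξ, η))
    -- `w` and its gradient tend to `0` as `|ξ| → ∞`, uniformly in `η`
    (hdecay : ∀ ε > 0, ∃ R : ℝ, ∀ p ∈ clDset, R ≤ |p.1| → |w p| + |wx p| + |wy p| < ε)
    -- the boundary condition `ẅ_η - ẅ/F² = π² sech²(πξ/2)` on `{η = 1}`
    (hbc : ∀ ξ : ℝ, wy (ξ, 1) - w (ξ, 1) / F ^ 2 =
      Real.pi ^ 2 / Real.cosh (Real.pi * ξ / 2) ^ 2) :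
    ∀ p : ℝ × ℝ, 0 < p.1 → 0 < p.2 → p.2 ≤ 1 → wx p < 0 := by
  have hDo : IsOpen Dset := isOpen_univ.prod isOpen_Ioo
  have hDsub : Dset ⊆ clDset := prod_mono le_rfl Ioo_subset_Icc_self
  have hcd : ∀ p ∈ Dset, ContDiffAt ℝ 2 w p := fun p hp => hharm.1.contDiffAt (hDo.mem_nhds hp)
  have hcx : ∀ x y : ℝ, y ∈ Ioo (-1:ℝ) 1 → ContDiffAt ℝ 2 (fun x => w (x, y)) x := by
    intro x y hy
    exact (hcd (x, y) ⟨trivial, hy⟩).comp x (contDiffAt_id.prodMk contDiffAt_const)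
  have hcy : ∀ x y : ℝ, y ∈ Ioo (-1:ℝ) 1 → ContDiffAt ℝ 2 (fun y => w (x, y)) y := by
    intro x y hy
    exact (hcd (x, y) ⟨trivial, hy⟩).comp y (contDiffAt_const.prodMk contDiffAt_id)
  have hlap : ∀ x y : ℝ, y ∈ Ioo (-1:ℝ) 1 → deriv (deriv (fun x => w (x, y))) x +
      deriv (deriv (fun y => w (x, y))) y = 0 := by
    intro x y hy
    exact hharm.2 (x, y) ⟨trivial, hy⟩
  have htop : ∀ x : ℝ, HasDerivWithinAt (fun y => w (x, y)) (wy (x, 1)) (Iic 1) 1 := by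
    intro x
    have hmem : Ioo (0:ℝ) 1 ∈ nhdsWithin (1:ℝ) (Iio 1) := Ioo_mem_nhdsLT (by norm_num)
    have hsub : Filter.Tendsto (fun y : ℝ => (x, y)) (nhdsWithin 1 (Ioo 0 1))
        (nhdsWithin (x, 1) clDset) := by
      refine tendsto_nhdsWithin_iff.2 ⟨?_, ?_⟩
      · exact ((Continuous.prodMk_right x).tendsto 1).mono_left nhdsWithin_le_nhds
      · filter_upwards [self_mem_nhdsWithin] with y hy
        exact ⟨trivial, by linarith [hy.1], hy.2.le⟩
    have hin : (x, (1:ℝ)) ∈ clDset := ⟨trivial, by norm_num, le_rfl⟩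
    refine hasDerivWithinAt_Iic_of_tendsto_deriv (s := Ioo 0 1) ?_ ?_ hmem ?_
    · intro y hy
      exact ((hcy x y ⟨by linarith [hy.1], hy.2⟩).differentiableAt (by norm_num)).differentiableWithinAt
    · exact (hw _ hin).tendsto.comp hsub
    · have h1 := (hwy _ hin).tendsto.comp hsub
      rw [nhdsWithin_Ioo_eq_nhdsLT (by norm_num)] at h1
      refine h1.congr' ?_
      filter_upwards [hmem] with y hy
      exact (hext (x, y) ⟨trivial, by linarith [hy.1], hy.2⟩).2
  have hw0 : ∀ x, w (x, 0) = 0 := by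
    intro x
    have := (hsym x 0).2
    simp at this
    linarith
  set κ := 1 / F ^ 2 with hκ
  have hκ0 : 0 < κ := by positivity
  have hκ1 : κ < 1 := by rw [hκ, div_lt_one (by positivity)]; exact hF
  set s := (1 - κ) / 4 with hs
  have hs0 : 0 < s := by rw [hs]; linarith
  have hs1 : s < 1 := by rw [hs]; linarith
  have hsκ : κ < 1 - 2 * s := by rw [hs]; linarith
  -- main estimate at the line `ξ = l`
  have main : ∀ l : ℝ, 0 < l → ∃ c : ℝ, 0 < c ∧ ∀ y ∈ Ioo (0:ℝ) 1,
      wx (l, y) ≤ - (c * Real.sinh y) := by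
    intro l hl
    set g : ℝ → ℝ := fun ξ => Real.pi ^ 2 / Real.cosh (Real.pi * ξ / 2) ^ 2 with hg
    set u : ℝ → ℝ → ℝ := fun x y => w (x, y) + (-1) * w (2 * l - x, y) with hu
    have huc : ContinuousOn (fun p : ℝ × ℝ => u p.1 p.2) (univ ×ˢ Icc 0 1) := by
      have h1 : ContinuousOn w (univ ×ˢ Icc 0 1) :=
        hw.mono (prod_mono le_rfl (Icc_subset_Icc (by norm_num) le_rfl))
      have h2 : ContinuousOn (fun p : ℝ × ℝ => w (2 * l - p.1, p.2)) (univ ×ˢ Icc 0 1) := by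
        refine hw.comp (f := fun p : ℝ × ℝ => (2 * l - p.1, p.2)) (by fun_prop) ?_
        intro p hp
        exact ⟨trivial, by linarith [hp.2.1], hp.2.2⟩
      exact h1.add (continuousOn_const.mul h2)
    have hux : ∀ x y : ℝ, y ∈ Ioo (0:ℝ) 1 → ContDiffAt ℝ 2 (fun x => u x y) x ∧
        ContDiffAt ℝ 2 (u x) y ∧
        deriv (deriv (fun x => u x y)) x + deriv (deriv (u x)) y = 0 := by
      intro x y hy
      have hy' : y ∈ Ioo (-1:ℝ) 1 := ⟨by linarith [hy.1], hy.2⟩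
      have a1 := hcx x y hy'
      have a2 : ContDiffAt ℝ 2 (fun x => (-1) * w (2 * l - x, y)) x :=
        contDiffAt_const.mul ((hcx (2 * l - x) y hy').comp x (contDiffAt_const.sub contDiffAt_id))
      have b1 := hcy x y hy'
      have b2 : ContDiffAt ℝ 2 (fun y => (-1) * w (2 * l - x, y)) y :=
        contDiffAt_const.mul (hcy (2 * l - x) y hy')
      refine ⟨a1.add a2, b1.add b2, ?_⟩
      have e1 : deriv (deriv (fun x => w (2 * l - x, y))) x
          = deriv (deriv (fun x => w (x, y))) (2 * l - x) := by
        have : deriv (fun x => w (2 * l - x, y)) =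
            fun x => - deriv (fun x => w (x, y)) (2 * l - x) := by
          funext z
          exact deriv_comp_const_sub (f := fun x => w (x, y)) (a := 2 * l) (x := z)
        rw [this, deriv.fun_neg, deriv_comp_const_sub, neg_neg]
      rw [hu]
      simp only
      rw [aux_add a1 a2, aux_add b1 b2, aux_smul, aux_smul, e1]
      linarith [hlap x y hy', hlap (2 * l - x) y hy']
    have hut : ∀ x, HasDerivWithinAt (u x) (κ * u x 1 + (g x - g (2 * l - x))) (Iic 1) 1 := by
      intro x
      have := (htop x).add ((htop (2 * l - x)).const_mul (-1))
      refine this.congr_deriv ?_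
      have e1 := hbc x
      have e2 := hbc (2 * l - x)
      simp only [hg, hu, hκ]
      rw [← e1, ← e2]
      ring
    have hu0 : ∀ x, u x 0 = 0 := by intro x; simp [hu, hw0]
    have hul : ∀ y, u l y = 0 := by
      intro y
      simp only [hu]
      rw [show 2 * l - l = l by ring]; ring
    have hgt : ∀ t, 0 ≤ t → g (l + t) ≤ g (l - t) := by
      intro t ht
      simp only [hg]
      have hpi := Real.pi_pos
      have : Real.cosh (Real.pi * (l - t) / 2) ≤ Real.cosh (Real.pi * (l + t) / 2) := by
        rw [Real.cosh_le_cosh, abs_of_nonneg (a := Real.pi * (l + t) / 2) (by positivity), abs_le]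
        constructor <;> nlinarith
      have := Real.cosh_pos (Real.pi * (l - t) / 2)
      gcongr
    -- step 1
    have step1 : ∀ x, l ≤ x → ∀ y ∈ Icc (0:ℝ) 1, u x y ≤ 0 := by
      intro x hx y hy
      have hε : ∀ ε > 0, u x y ≤ ε * (s + y - s * y ^ 2) := by
        intro ε hε
        obtain ⟨R, hR⟩ := hdecay (ε * s / 2) (by positivity)
        set b := max x (2 * l + |R|) with hb
        have hxb : x ≤ b := le_max_left _ _
        have hRb : 2 * l + |R| ≤ b := le_max_right _ _
        have hR1 : R ≤ |b| := by
          linarith [le_abs_self R, le_abs_self b]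
        have hR2 : R ≤ |2 * l - b| := by
          linarith [le_abs_self R, neg_le_abs (2 * l - b)]
        have := aux_max κ s l b hs0 hs1 hsκ (fun x y => u x y + (-ε) * (s + y - s * y ^ 2))
          ((huc.mono (prod_mono (subset_univ _) le_rfl)).add (by fun_prop)) ?_ ?_ ?_ ?_ ?_
          x ⟨hx, hxb⟩ y hy
        · linarith
        · intro x _ y hy
          obtain ⟨a1, a2, a3⟩ := hux x y hy
          have cφ : ContDiffAt ℝ 2 (fun y : ℝ => (-ε) * (s + y - s * y ^ 2)) y := by fun_prop
          have cc : ContDiffAt ℝ 2 (fun _ : ℝ => (-ε) * (s + y - s * y ^ 2)) x := contDiffAt_const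
          refine ⟨a1.add cc, a2.add cφ, ?_⟩
          rw [aux_add a1 cc, aux_add a2 cφ, aux_smul (f := fun y : ℝ => s + y - s * y ^ 2), aux_phi]
          simp only [deriv_const', deriv_const]
          nlinarith [mul_pos hε hs0]
        · intro y hy
          simp only [hul]
          nlinarith [hy.1, hy.2, mul_nonneg hy.1 (sub_nonneg.2 hs1.le),
            mul_nonneg hs0.le (mul_nonneg hy.1 (sub_nonneg.2 hy.2)),
            mul_nonneg hε.le (add_nonneg (add_nonneg hs0.le (mul_nonneg hy.1 (sub_nonneg.2 hs1.le)))
              (mul_nonneg hs0.le (mul_nonneg hy.1 (sub_nonneg.2 hy.2))))]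
        · intro y hy
          have hy' : y ∈ Icc (-1:ℝ) 1 := ⟨by linarith [hy.1], hy.2⟩
          have r1 := hR (b, y) ⟨trivial, hy'⟩ hR1
          have r2 := hR (2 * l - b, y) ⟨trivial, hy'⟩ hR2
          have q1 : u b y ≤ ε * s := by
            simp only [hu]
            linarith [le_abs_self (w (b, y)), neg_le_abs (w (2 * l - b, y)),
              abs_nonneg (wx (b, y)), abs_nonneg (wy (b, y)),
              abs_nonneg (wx (2 * l - b, y)), abs_nonneg (wy (2 * l - b, y))]
          have q2 : s ≤ s + y - s * y ^ 2 := by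
            nlinarith [hy.1, hy.2, mul_nonneg hy.1 (sub_nonneg.2 hs1.le),
              mul_nonneg hs0.le (mul_nonneg hy.1 (sub_nonneg.2 hy.2))]
          have := mul_le_mul_of_nonneg_left q2 hε.le
          linarith
        · intro x _
          simp only [hu0]
          nlinarith [mul_pos hε hs0]
        · intro x hx
          refine ⟨_, (hut x).add ((aux_phi' s 1).const_mul (-ε)).hasDerivWithinAt, ?_⟩
          have := hgt (x - l) (by linarith [hx.1])
          rw [show l + (x - l) = x by ring, show l - (x - l) = 2 * l - x by ring] at this
          nlinarith [mul_pos hε (sub_pos.2 hsκ)]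
      have hlim : Filter.Tendsto (fun ε : ℝ => ε * (s + y - s * y ^ 2)) (nhdsWithin 0 (Ioi 0)) (nhds 0) := by
        have : Continuous (fun ε : ℝ => ε * (s + y - s * y ^ 2)) := by fun_prop
        have := this.tendsto 0
        rw [zero_mul] at this
        exact this.mono_left nhdsWithin_le_nhds
      exact ge_of_tendsto hlim (by filter_upwards [self_mem_nhdsWithin] with ε h using hε ε h)
    -- step 2
    set c := Real.pi ^ 2 * Real.sinh (Real.pi * l)
      / Real.cosh (Real.pi * (l + Real.pi) / 2) ^ 4 / Real.cosh 1 with hc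
    have hc0 : 0 < c := by
      have h1 : 0 < Real.sinh (Real.pi * l) := Real.sinh_pos_iff.2 (mul_pos Real.pi_pos hl)
      have h2 := Real.cosh_pos (Real.pi * (l + Real.pi) / 2)
      have h3 := Real.cosh_pos 1
      have := Real.pi_pos
      positivity
    have hh1 : ∀ x, deriv (deriv (fun x => Real.sin (x - l))) x = - Real.sin (x - l) := by
      intro x
      have : deriv (fun x => Real.sin (x - l)) = fun x => Real.cos (x - l) := by
        funext z
        rw [deriv_comp_sub_const]; simp
      rw [this, deriv_comp_sub_const]; simp
    have hh2 : ∀ y, deriv (deriv Real.sinh) y = Real.sinh y := by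
      intro y; simp
    have step2 : ∀ x ∈ Icc l (l + Real.pi), ∀ y ∈ Icc (0:ℝ) 1,
        u x y + c * (Real.sin (x - l) * Real.sinh y) ≤ 0 := by
      refine aux_max κ s l (l + Real.pi) hs0 hs1 hsκ
        (fun x y => u x y + c * (Real.sin (x - l) * Real.sinh y)) ?_ ?_ ?_ ?_ ?_ ?_
      · refine (huc.mono (prod_mono (subset_univ _) le_rfl)).add (Continuous.continuousOn ?_)
        have := Real.continuous_sinh
        fun_prop
      · intro x _ y hy
        obtain ⟨a1, a2, a3⟩ := hux x y hy
        have c1 : ContDiffAt ℝ 2 (fun x => c * (Real.sin (x - l) * Real.sinh y)) x := by fun_prop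
        have c2 : ContDiffAt ℝ 2 (fun y => c * (Real.sin (x - l) * Real.sinh y)) y := by
          have := Real.contDiff_sinh (n := 2)
          fun_prop
        refine ⟨a1.add c1, a2.add c2, ?_⟩
        rw [aux_add a1 c1, aux_add a2 c2, aux_smul, aux_smul, aux_smul, hh2]
        have : (fun x => Real.sin (x - l) * Real.sinh y)
            = fun x => Real.sinh y * Real.sin (x - l) := by funext x; ring
        rw [this, aux_smul, hh1]
        linarith
      · intro y _; simp [hul]
      · intro y hy; simpa using step1 (l + Real.pi) (by linarith [Real.pi_pos]) y hy
      · intro x _; simp [hu0]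
      · intro x hx
        refine ⟨_, (hut x).add (((Real.hasDerivAt_sinh 1).const_mul
          (Real.sin (x - l))).const_mul c).hasDerivWithinAt, ?_⟩
        have h1 := aux_g l (x - l) hl (by linarith [hx.1]) (by linarith [hx.2])
        rw [show l + (x - l) = x by ring, show l - (x - l) = 2 * l - x by ring] at h1
        have h2 : c * (Real.sin (x - l) * Real.cosh 1) = Real.pi ^ 2 * Real.sinh (Real.pi * l)
            * Real.sin (x - l) / Real.cosh (Real.pi * (l + Real.pi) / 2) ^ 4 := by
          have := (Real.cosh_pos 1).ne'
          rw [hc]; field_simp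
        have h3 : 0 ≤ κ * (c * (Real.sin (x - l) * Real.sinh 1)) := by
          have := Real.sin_nonneg_of_nonneg_of_le_pi (x := x - l)
            (by linarith [hx.1]) (by linarith [hx.2])
          have : 0 ≤ Real.sinh 1 := Real.sinh_nonneg_iff.2 zero_le_one
          positivity
        rw [h2]
        simp only [hg]
        linarith
    refine ⟨c / 2, by positivity, ?_⟩
    intro y hy
    have hy' : y ∈ Ioo (-1:ℝ) 1 := ⟨by linarith [hy.1], hy.2⟩
    have d0 : HasDerivAt (fun x => w (x, y)) (wx (l, y)) l := by
      rw [(hext (l, y) ⟨trivial, hy'⟩).1]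
      exact ((hcx l y hy').differentiableAt (by norm_num)).hasDerivAt
    have d1 : HasDerivAt (fun x => w (2 * l - x, y)) (-wx (l, y)) l := by
      have d0' : HasDerivAt (fun x => w (x, y)) (wx (l, y)) (2 * l - l) := by
        rw [show 2 * l - l = l by ring]; exact d0
      exact d0'.comp_const_sub (2 * l) l
    have d2 : HasDerivAt (fun x => Real.sin (x - l)) 1 l := by
      have := (Real.hasDerivAt_sin (l - l)).comp_sub_const l l
      simpa using this
    have d3 := (d0.add (d1.const_mul (-1))).add ((d2.mul_const (Real.sinh y)).const_mul c)
    have := aux_right (b := l + Real.pi) (by linarith [Real.pi_pos]) d3 (by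
      intro x hx
      have h1 := step2 x hx y ⟨hy.1.le, hy.2.le⟩
      have h2 := hul y
      simp only [hu] at h1 h2
      simp only [Pi.add_apply, sub_self, Real.sin_zero, zero_mul, mul_zero, add_zero]
      linarith)
    linarith
  rintro ⟨l, y⟩ hl hy0 hy1
  simp only at hl hy0 hy1
  obtain ⟨c, hc, hm⟩ := main l hl
  have hsy : 0 < Real.sinh y := Real.sinh_pos_iff.2 hy0
  suffices h : wx (l, y) ≤ - (c * Real.sinh y) by
    have := mul_pos hc hsy
    linarith
  rcases hy1.lt_or_eq with h | h
  · exact hm y ⟨hy0, h⟩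
  · subst h
    have hsub : Filter.Tendsto (fun y : ℝ => (l, y)) (nhdsWithin 1 (Ioo 0 1))
        (nhdsWithin (l, 1) clDset) := by
      refine tendsto_nhdsWithin_iff.2 ⟨?_, ?_⟩
      · exact ((Continuous.prodMk_right l).tendsto 1).mono_left nhdsWithin_le_nhds
      · filter_upwards [self_mem_nhdsWithin] with y hy
        exact ⟨trivial, by linarith [hy.1], hy.2.le⟩
    have h1 := (hwx (l, 1) ⟨trivial, by norm_num, le_rfl⟩).tendsto.comp hsub
    have h2 : Filter.Tendsto (fun y => - (c * Real.sinh y)) (nhdsWithin 1 (Ioo 0 1))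
        (nhds (- (c * Real.sinh 1))) := by
      have := Real.continuous_sinh
      have h3 : Continuous (fun y => - (c * Real.sinh y)) := by fun_prop
      exact (h3.tendsto 1).mono_left nhdsWithin_le_nhds
    rw [nhdsWithin_Ioo_eq_nhdsLT (by norm_num)] at h1 h2
    refine le_of_tendsto_of_tendsto h1 h2 ?_
    filter_upwards [Ioo_mem_nhdsLT (show (0:ℝ) < 1 by norm_num)] with y hy
    exact hm y hy
end

section
/- Fix F > 0 with F² > 1. For (ξ,η) ∈ ℝ × [−1,1] define ẅ(ξ,η) := 8·∫₀^∞ [F²t/(F²t − tanh t)] · [sinh(ηt)/sinh(2t)] · cos(ξt) dt. Then: (i) the integral converges for every such (ξ,η), ẅ is harmonic on the strip D = ℝ × (−1,1), ẅ(ξ,0) = 0, ẅ is even in ξ and odd in η, ẅ(ξ,η) → 0 as |ξ| → ∞, and ∂_η ẅ(ξ,1) − ẅ(ξ,1)/F² = π²·sech²(πξ/2) for all ξ ∈ ℝ; (ii) for all (ξ,η) ∈ ℝ × [−1,1], ẅ(ξ,η) = 2π·sin(ηπ/2)/(cosh(πξ/2) + cos(ηπ/2)) + 8·∫₀^∞ [1/(F²t·coth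 t − 1)] · [sinh(ηt)/sinh(2t)] · cos(ξt) dt. -/
open Set MeasureTheory

/-- The leading-order profile `ẅ`, defined by a Fourier integral. -/
noncomputable def wdd (F : ℝ) (p : ℝ × ℝ) : ℝ :=
  8 * ∫ t in Ioi (0 : ℝ),
    (F ^ 2 * t / (F ^ 2 * t - Real.tanh t)) * (Real.sinh (p.2 * t) / Real.sinh (2 * t)) *
      Real.cos (p.1 * t)

open Filter Topology

namespace Wave

lemma sinh_le_mul_cosh {t : ℝ} (ht : 0 < t) : Real.sinh t ≤ t * Real.cosh t := by
  obtain ⟨c, hc, h⟩ := exists_deriv_eq_slope Real.sinh ht Real.continuous_sinh.continuousOn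
    Real.differentiable_sinh.differentiableOn
  rw [Real.deriv_sinh] at h
  simp only [Real.sinh_zero, sub_zero] at h
  have h2 : Real.cosh c ≤ Real.cosh t := by
    rw [Real.cosh_le_cosh, abs_of_pos hc.1, abs_of_pos ht]; exact hc.2.le
  rw [h, div_le_iff₀ ht] at h2
  linarith

lemma tanh_le {t : ℝ} (ht : 0 < t) : Real.tanh t ≤ t := by
  rw [Real.tanh_eq_sinh_div_cosh, div_le_iff₀ (Real.cosh_pos t)]
  exact sinh_le_mul_cosh ht

lemma tanh_pos' {t : ℝ} (ht : 0 < t) : 0 < Real.tanh t := by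
  rw [Real.tanh_eq_sinh_div_cosh]
  exact div_pos (Real.sinh_pos_iff.2 ht) (Real.cosh_pos t)

lemma measurable_tanh' : Measurable Real.tanh := by
  have : Real.tanh = fun t => Real.sinh t / Real.cosh t := by
    funext t; exact Real.tanh_eq_sinh_div_cosh t
  rw [this]
  exact Real.measurable_sinh.div Real.measurable_cosh

lemma norm_cosh_le (w : ℂ) : ‖Complex.cosh w‖ ≤ Real.exp |w.re| := by
  rw [Complex.cosh, norm_div]
  have h1 := norm_add_le (Complex.exp w) (Complex.exp (-w))
  rw [Complex.norm_exp, Complex.norm_exp] at h1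
  have h2 : Real.exp w.re ≤ Real.exp |w.re| := Real.exp_le_exp.2 (le_abs_self _)
  have h3 : Real.exp (-w).re ≤ Real.exp |w.re| :=
    Real.exp_le_exp.2 (by simpa using neg_le_abs w.re)
  rw [div_le_iff₀ (by simp)]
  simp only [Complex.norm_ofNat]
  linarith

lemma norm_sinh_le (w : ℂ) : ‖Complex.sinh w‖ ≤ Real.exp |w.re| * ‖w‖ := by
  have hconv : Convex ℝ {v : ℂ | |v.re| ≤ |w.re|} := by
    have : {v : ℂ | |v.re| ≤ |w.re|} = Complex.reLm ⁻¹' (Icc (-|w.re|) |w.re|) := by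
      ext v; simp [abs_le]
    rw [this]
    exact (convex_Icc _ _).is_linear_preimage Complex.reLm.isLinear
  have := hconv.norm_image_sub_le_of_norm_deriv_le (𝕜 := ℂ) (f := Complex.sinh)
    (C := Real.exp |w.re|) (x := 0) (y := w)
    (fun v _ => Complex.differentiable_sinh v)
    (fun v hv => by
      rw [Complex.deriv_sinh]
      exact (norm_cosh_le v).trans (Real.exp_le_exp.2 hv)) (by simp) (by simp)
  simpa using this

/-- admissible kernels -/
def KB (C : ℝ) (k : ℝ → ℝ) : Prop :=
  Measurable k ∧ ∀ t > 0, t * |k t| ≤ C * (1 + t) * Real.exp (-(2 * t))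

lemma KB.nonneg {C : ℝ} {k : ℝ → ℝ} (h : KB C k) : 0 ≤ C := by
  have := h.2 1 one_pos
  have h2 : 0 ≤ 1 * |k 1| := by positivity
  have h3 := Real.exp_pos (-(2 * 1))
  by_contra hc
  push Not at hc
  nlinarith [mul_pos (neg_pos.2 hc) h3]

lemma dom_int (C : ℝ) {b : ℝ} (hb : b < 2) :
    IntegrableOn (fun t => C * (1 + t) * Real.exp (-(2 * t)) * Real.exp (b * t)) (Ioi 0) := by
  set δ := (2 - b) / 2 with hδ
  have hδ0 : 0 < δ := by linarith
  have h1 : IntegrableOn (fun t => |C| * (1 + 1 / δ) * Real.exp (-δ * t)) (Ioi 0) :=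
    (integrableOn_exp_mul_Ioi (by linarith) 0).const_mul _
  refine Integrable.mono' h1 (Continuous.aestronglyMeasurable (by fun_prop)) ?_
  filter_upwards [ae_restrict_mem measurableSet_Ioi] with t ht
  have ht : 0 < t := ht
  have e1 : Real.exp (-(2 * t)) * Real.exp (b * t) = Real.exp (-δ * t) * Real.exp (-δ * t) := by
    rw [← Real.exp_add, ← Real.exp_add]; congr 1; rw [hδ]; ring
  have h2 : (1 + t) * Real.exp (-δ * t) ≤ 1 + 1 / δ := by
    have h3 : 1 + δ * t ≤ Real.exp (δ * t) := by linarith [Real.add_one_le_exp (δ * t)]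
    have h4 : Real.exp (δ * t) * Real.exp (-δ * t) = 1 := by
      rw [← Real.exp_add]; simp
    have h5 : 1 + t ≤ (1 + 1 / δ) * Real.exp (δ * t) := by
      have : t ≤ (1 / δ) * Real.exp (δ * t) := by
        rw [one_div, ← div_eq_inv_mul, le_div_iff₀ hδ0]; nlinarith
      have : 0 < δ * t := by positivity
      linarith
    calc (1 + t) * Real.exp (-δ * t) ≤ (1 + 1 / δ) * Real.exp (δ * t) * Real.exp (-δ * t) := by
          gcongr
      _ = 1 + 1 / δ := by rw [mul_assoc, h4, mul_one]
  rw [mul_assoc, e1, norm_mul, norm_mul, norm_mul, Real.norm_eq_abs, Real.norm_eq_abs,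
    Real.norm_eq_abs, Real.abs_exp, abs_of_pos (by linarith : 0 < 1 + t)]
  calc |C| * (1 + t) * (Real.exp (-δ * t) * Real.exp (-δ * t))
      = |C| * ((1 + t) * Real.exp (-δ * t)) * Real.exp (-δ * t) := by ring
    _ ≤ _ := by gcongr

/-- The complex transform. -/
noncomputable def G (k : ℝ → ℝ) (z : ℂ) : ℂ := ∫ t in Ioi (0 : ℝ), (k t : ℂ) * Complex.sinh (z * t)

noncomputable def G' (k : ℝ → ℝ) (z : ℂ) : ℂ :=
  ∫ t in Ioi (0 : ℝ), (k t : ℂ) * (Complex.cosh (z * t) * t)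

lemma bound_cosh {C : ℝ} {k : ℝ → ℝ} (h : KB C k) {z : ℂ} {b : ℝ} (hz : |z.re| ≤ b) {t : ℝ}
    (ht : 0 < t) : ‖(k t : ℂ) * (Complex.cosh (z * t) * t)‖ ≤
      C * (1 + t) * Real.exp (-(2 * t)) * Real.exp (b * t) := by
  have h1 := norm_cosh_le (z * t)
  have h2 : |(z * t).re| = |z.re| * t := by simp [abs_mul, abs_of_pos ht]
  rw [h2] at h1
  have h3 : Real.exp (|z.re| * t) ≤ Real.exp (b * t) := Real.exp_le_exp.2 (by gcongr)
  have h4 : ‖(k t : ℂ) * (Complex.cosh (z * t) * t)‖ = t * |k t| * ‖Complex.cosh (z * t)‖ := by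
    rw [norm_mul, norm_mul, Complex.norm_real, Complex.norm_real, Real.norm_eq_abs,
      Real.norm_eq_abs, abs_of_pos ht]; ring
  rw [h4]
  have := h.nonneg
  exact mul_le_mul (h.2 t ht) (h1.trans h3) (norm_nonneg _) (by positivity)

lemma bound_sinh {C : ℝ} {k : ℝ → ℝ} (h : KB C k) {z : ℂ} {b : ℝ} (hz : |z.re| ≤ b) {t : ℝ}
    (ht : 0 < t) : ‖(k t : ℂ) * Complex.sinh (z * t)‖ ≤
      ‖z‖ * (C * (1 + t) * Real.exp (-(2 * t)) * Real.exp (b * t)) := by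
  have h1 := norm_sinh_le (z * t)
  have h2 : |(z * t).re| = |z.re| * t := by simp [abs_mul, abs_of_pos ht]
  have h2' : ‖z * t‖ = ‖z‖ * t := by
    rw [norm_mul, Complex.norm_real, Real.norm_eq_abs, abs_of_pos ht]
  rw [h2, h2'] at h1
  have h3 : Real.exp (|z.re| * t) ≤ Real.exp (b * t) := Real.exp_le_exp.2 (by gcongr)
  rw [norm_mul, Complex.norm_real, Real.norm_eq_abs]
  have hC := h.nonneg
  calc |k t| * ‖Complex.sinh (z * t)‖ ≤ |k t| * (Real.exp (b * t) * (‖z‖ * t)) := by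
        gcongr; exact h1.trans (by gcongr)
    _ = ‖z‖ * ((t * |k t|) * Real.exp (b * t)) := by ring
    _ ≤ _ := mul_le_mul_of_nonneg_left
        (mul_le_mul_of_nonneg_right (h.2 t ht) (Real.exp_pos _).le) (norm_nonneg _)

lemma meas_sinh {k : ℝ → ℝ} (h : Measurable k) (z : ℂ) (μ : Measure ℝ) :
    AEStronglyMeasurable (fun t : ℝ => (k t : ℂ) * Complex.sinh (z * t)) μ := by
  apply Measurable.aestronglyMeasurable
  exact (Complex.measurable_ofReal.comp h).mul (Continuous.measurable (by fun_prop))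

lemma meas_cosh {k : ℝ → ℝ} (h : Measurable k) (z : ℂ) (μ : Measure ℝ) :
    AEStronglyMeasurable (fun t : ℝ => (k t : ℂ) * (Complex.cosh (z * t) * t)) μ := by
  apply Measurable.aestronglyMeasurable
  exact (Complex.measurable_ofReal.comp h).mul (Continuous.measurable (by fun_prop))

lemma int_sinh {C : ℝ} {k : ℝ → ℝ} (h : KB C k) {z : ℂ} (hz : |z.re| < 2) :
    IntegrableOn (fun t : ℝ => (k t : ℂ) * Complex.sinh (z * t)) (Ioi 0) := by
  refine Integrable.mono' ((dom_int C hz).const_mul ‖z‖) (meas_sinh h.1 z _) ?_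
  filter_upwards [ae_restrict_mem measurableSet_Ioi] with t ht
  exact bound_sinh h le_rfl ht

lemma int_cosh {C : ℝ} {k : ℝ → ℝ} (h : KB C k) {z : ℂ} (hz : |z.re| < 2) :
    IntegrableOn (fun t : ℝ => (k t : ℂ) * (Complex.cosh (z * t) * t)) (Ioi 0) := by
  refine Integrable.mono' (dom_int C hz) (meas_cosh h.1 z _) ?_
  filter_upwards [ae_restrict_mem measurableSet_Ioi] with t ht
  exact bound_cosh h le_rfl ht

def U : Set ℂ := {z | |z.re| < 2}

lemma isOpen_U : IsOpen U := isOpen_lt (by fun_prop) (by fun_prop)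

lemma hasDerivAt_G {C : ℝ} {k : ℝ → ℝ} (h : KB C k) {z : ℂ} (hz : |z.re| < 2) :
    HasDerivAt (G k) (G' k z) z := by
  obtain ⟨b, hb1, hb2⟩ := exists_between hz
  have hs : {v : ℂ | |v.re| < b} ∈ 𝓝 z :=
    (isOpen_lt (by fun_prop) (by fun_prop)).mem_nhds hb1
  refine (hasDerivAt_integral_of_dominated_loc_of_deriv_le hs
    (F := fun z (t : ℝ) => (k t : ℂ) * Complex.sinh (z * t))
    (F' := fun z (t : ℝ) => (k t : ℂ) * (Complex.cosh (z * t) * t))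
    (Eventually.of_forall fun v => meas_sinh h.1 v _) (int_sinh h hz) (meas_cosh h.1 z _)
    (bound := fun t => C * (1 + t) * Real.exp (-(2 * t)) * Real.exp (b * t))
    ?_ (dom_int C hb2) ?_).2
  · filter_upwards [ae_restrict_mem measurableSet_Ioi] with t ht v hv
    exact bound_cosh h (le_of_lt hv) ht
  · filter_upwards with t v hv
    have : HasDerivAt (fun v : ℂ => v * t) t v := by simpa using (hasDerivAt_id v).mul_const (t : ℂ)
    exact (this.csinh).const_mul _

end Wave
namespace Wave

lemma t_div_sinh_le {t : ℝ} (ht : 0 < t) :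
    t / Real.sinh (2 * t) ≤ 2 * (1 + t) * Real.exp (-(2 * t)) := by
  rw [div_le_iff₀ (Real.sinh_pos_iff.2 (by linarith)), Real.sinh_eq]
  have h1 : 1 + t ≤ Real.exp (4 * t) := by
    have := Real.add_one_le_exp (4 * t); linarith
  have h2 : Real.exp (-(2 * t)) * Real.exp (2 * t) = 1 := by rw [← Real.exp_add]; simp
  have h3 : Real.exp (-(2 * t)) * Real.exp (-(2 * t)) * Real.exp (4 * t) = 1 := by
    rw [← Real.exp_add, ← Real.exp_add]; ring_nf; simp
  have h4 : (1 + t) * (Real.exp (-(2 * t)) * Real.exp (-(2 * t))) ≤ 1 := by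
    calc _ ≤ Real.exp (4 * t) * (Real.exp (-(2 * t)) * Real.exp (-(2 * t))) := by gcongr
      _ = 1 := by rw [mul_comm, h3]
  nlinarith

lemma KB_of_bdd {m : ℝ → ℝ} (hm : Measurable m) {M : ℝ} (hM : ∀ t > 0, |m t| ≤ M) :
    KB (2 * M) (fun t => m t / Real.sinh (2 * t)) := by
  refine ⟨hm.div (Real.measurable_sinh.comp (measurable_const_mul 2)), fun t ht => ?_⟩
  have h1 := t_div_sinh_le ht
  have hs : 0 < Real.sinh (2 * t) := Real.sinh_pos_iff.2 (by linarith)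
  have h2 := hM t ht
  have hM0 : 0 ≤ M := (abs_nonneg _).trans h2
  rw [abs_div, abs_of_pos hs]
  calc t * (|m t| / Real.sinh (2 * t)) = |m t| * (t / Real.sinh (2 * t)) := by ring
    _ ≤ M * (2 * (1 + t) * Real.exp (-(2 * t))) := by
      apply mul_le_mul h2 h1 (by positivity) hM0
    _ = _ := by ring

noncomputable def k1 (t : ℝ) : ℝ := 1 / Real.sinh (2 * t)

lemma KB_k1 : KB 2 k1 := by
  have := KB_of_bdd (m := fun _ => 1) measurable_const (M := 1) (by simp)
  rw [mul_one] at this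
  exact this

noncomputable def S (z : ℂ) (N : ℕ) : ℂ :=
  ∑ j ∈ Finset.range N, (1 / (4 * j + 2 - z) - 1 / (4 * j + 2 + z))

noncomputable def e1 (z : ℂ) (j : ℕ) (t : ℝ) : ℂ :=
  Complex.exp ((z - (4 * j + 2)) * t) - Complex.exp ((-z - (4 * j + 2)) * t)

lemma e1_int {z : ℂ} (hz : |z.re| < 2) (j : ℕ) : IntegrableOn (e1 z j) (Ioi 0) := by
  rw [abs_lt] at hz
  have hj : (0 : ℝ) ≤ j := by positivity
  apply Integrable.sub
  · exact integrableOn_exp_mul_complex_Ioi (by simp; linarith) 0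
  · exact integrableOn_exp_mul_complex_Ioi (by simp; linarith) 0

lemma e1_integral {z : ℂ} (hz : |z.re| < 2) (j : ℕ) : ∫ t in Ioi (0 : ℝ), e1 z j t =
    1 / (4 * j + 2 - z) - 1 / (4 * j + 2 + z) := by
  rw [abs_lt] at hz
  have hj : (0 : ℝ) ≤ j := by positivity
  have h1 : (z - (4 * j + 2)).re < 0 := by simp; linarith
  have h2 : (-z - (4 * j + 2)).re < 0 := by simp; linarith
  unfold e1
  rw [integral_sub (integrableOn_exp_mul_complex_Ioi h1 0) (integrableOn_exp_mul_complex_Ioi h2 0),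
    integral_exp_mul_complex_Ioi h1, integral_exp_mul_complex_Ioi h2]
  simp only [Complex.ofReal_zero, mul_zero, Complex.exp_zero]
  rw [show (4 * j + 2 - z : ℂ) = -(z - (4 * j + 2)) by ring,
    show (4 * j + 2 + z : ℂ) = -(-z - (4 * j + 2)) by ring]
  rw [div_neg, div_neg, neg_div, neg_div]

lemma sum_e1 (z : ℂ) (N : ℕ) {t : ℝ} (ht : 0 < t) :
    ∑ j ∈ Finset.range N, e1 z j t =
      (k1 t : ℂ) * Complex.sinh (z * t) * (1 - Complex.exp (-(4 * N * t))) := by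
  have hs : Complex.sinh (2 * t) ≠ 0 := by
    have : Real.sinh (2 * t) ≠ 0 := (Real.sinh_pos_iff.2 (by linarith)).ne'
    exact_mod_cast this
  induction N with
  | zero => simp
  | succ N ih =>
    rw [Finset.sum_range_succ, ih]
    have h1 : e1 z N t = 2 * Complex.sinh (z * t) * Complex.exp (-((4 * N + 2) * t)) := by
      rw [Complex.sinh, e1]
      rw [show (z - (4 * N + 2)) * (t : ℂ) = z * t + -((4 * N + 2) * t) by ring,
        show (-z - (4 * N + 2)) * (t : ℂ) = -(z * t) + -((4 * N + 2) * t) by ring,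
        Complex.exp_add, Complex.exp_add]
      ring
    have h2 : Complex.exp (-(4 * N * t)) - Complex.exp (-(4 * (N + 1 : ℕ) * t)) =
        2 * Complex.sinh (2 * t) * Complex.exp (-((4 * N + 2) * t)) := by
      rw [Complex.sinh]
      push_cast
      rw [show -(4 * N * (t : ℂ)) = 2 * t + -((4 * N + 2) * t) by ring,
        show -(4 * (N + 1) * (t : ℂ)) = -(2 * t) + -((4 * N + 2) * t) by ring,
        Complex.exp_add, Complex.exp_add]
      ring
    have h3 : (k1 t : ℂ) * Complex.sinh (2 * t) = 1 := by
      rw [k1]; push_cast; field_simp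
    linear_combination h1 - (k1 t : ℂ) * Complex.sinh (z * t) * h2
      - 2 * Complex.sinh (z * t) * Complex.exp (-((4 * N + 2) * t)) * h3

lemma tendsto_S {z : ℂ} (hz : |z.re| < 2) : Tendsto (S z) atTop (𝓝 (G k1 z)) := by
  have hS : S z = fun N : ℕ => ∫ t in Ioi (0 : ℝ),
      (k1 t : ℂ) * Complex.sinh (z * t) * (1 - Complex.exp (-(4 * N * t))) := by
    funext N
    rw [S, ← Finset.sum_congr rfl (fun j _ => e1_integral hz j),
      ← integral_finsetSum _ (fun j _ => e1_int hz j)]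
    exact setIntegral_congr_fun measurableSet_Ioi (fun t ht => sum_e1 z N ht)
  rw [hS, G]
  have key : ∀ t : ℝ, ∀ N : ℕ, Complex.exp (-(4 * N * t)) = (Real.exp (-(4 * t)) : ℂ) ^ N := by
    intro t N
    push_cast
    rw [← Complex.exp_nat_mul]; congr 1; ring
  refine tendsto_integral_of_dominated_convergence
    (fun t => ‖(k1 t : ℂ) * Complex.sinh (z * t)‖) (fun N => ?_) (int_sinh KB_k1 hz).norm
    (fun N => ?_) ?_
  · exact (meas_sinh KB_k1.1 z _).mul (Continuous.aestronglyMeasurable (by fun_prop))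
  · filter_upwards [ae_restrict_mem measurableSet_Ioi] with t ht
    have ht : 0 < t := ht
    rw [norm_mul]
    apply mul_le_of_le_one_right (norm_nonneg _)
    rw [key]
    have hx0 := Real.exp_pos (-(4 * t))
    have hx1 : Real.exp (-(4 * t)) ≤ 1 := Real.exp_le_one_iff.2 (by linarith)
    have : (1 - (Real.exp (-(4 * t)) : ℂ) ^ N) = ((1 - Real.exp (-(4 * t)) ^ N : ℝ) : ℂ) := by
      push_cast; rfl
    rw [this, Complex.norm_real, Real.norm_eq_abs, abs_le]
    have h1 := pow_le_one₀ hx0.le hx1 (n := N)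
    have h2 := pow_nonneg hx0.le N
    constructor <;> linarith
  · filter_upwards [ae_restrict_mem measurableSet_Ioi] with t ht
    have ht : 0 < t := ht
    have hx0 := Real.exp_pos (-(4 * t))
    have hx1 : Real.exp (-(4 * t)) < 1 := Real.exp_lt_one_iff.2 (by linarith)
    have h1 : Tendsto (fun N : ℕ => (Real.exp (-(4 * t)) : ℂ) ^ N) atTop (𝓝 0) := by
      apply tendsto_pow_atTop_nhds_zero_of_norm_lt_one
      rw [Complex.norm_real, Real.norm_eq_abs, abs_of_pos hx0]; exact hx1
    simp only [key]
    simpa using (h1.const_sub 1).const_mul ((k1 t : ℂ) * Complex.sinh (z * t))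

lemma tendsto_S' {z : ℂ} (hz : |z.re| < 2) :
    Tendsto (S z) atTop (𝓝 (Real.pi / 4 * Complex.tan (Real.pi * z / 4))) := by
  rw [abs_lt] at hz
  set y : ℂ := (2 - z) / 4 with hy
  have hyre : y.re = (2 - z.re) / 4 := by simp [hy]
  have hyC : y ∈ Complex.integerComplement := by
    rintro ⟨n, hn⟩
    have : (n : ℝ) = (2 - z.re) / 4 := by rw [← hyre, ← hn]; simp
    have h1 : (0 : ℝ) < n := by rw [this]; linarith
    have h2 : (n : ℝ) < 1 := by rw [this]; linarith
    have h1' : 0 < n := by exact_mod_cast h1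
    have h2' : n < 1 := by exact_mod_cast h2
    omega
  have hcot := tendsto_logDeriv_euler_cot_sub hyC
  have hne : ∀ j : ℕ, (4 * j + 2 - z : ℂ) ≠ 0 := by
    intro j h
    have := congrArg Complex.re h
    have hj : (0 : ℝ) ≤ j := by positivity
    simp at this; linarith
  have hne' : ∀ j : ℕ, (4 * j + 2 + z : ℂ) ≠ 0 := by
    intro j h
    have := congrArg Complex.re h
    have hj : (0 : ℝ) ≤ j := by positivity
    simp at this; linarith
  have hS : ∀ N : ℕ, S z N = 1 / 4 * (1 / y + ∑ j ∈ Finset.range N, cotTerm y j)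
      - 1 / (4 * N + 2 - z) := by
    intro N
    induction N with
    | zero =>
      have := hne 0
      simp only [S, Finset.range_zero, Finset.sum_empty, hy]
      push_cast at *
      simp only [mul_zero, zero_add] at *
      field_simp; ring
    | succ N ih =>
      have h1 : S z (N + 1) = S z N + (1 / (4 * N + 2 - z) - 1 / (4 * N + 2 + z)) := by
        rw [S, Finset.sum_range_succ]; rfl
      have a1 : 1 / (y - (N + 1)) = - 4 / (4 * N + 2 + z) := by
        rw [show y - (N + 1) = (4 * N + 2 + z) / (- 4) by rw [hy]; ring, one_div_div]
      have a2 : 1 / (y + (N + 1)) = 4 / (4 * (N + 1 : ℕ) + 2 - z) := by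
        rw [show y + (N + 1) = (4 * (N + 1 : ℕ) + 2 - z) / 4 by rw [hy]; push_cast; ring, one_div_div]
      rw [h1, ih, Finset.sum_range_succ, cotTerm, a1, a2]
      ring
  have hlim : Tendsto (fun N : ℕ => 1 / (4 * N + 2 - z : ℂ)) atTop (𝓝 0) := by
    simp only [one_div]
    apply tendsto_inv₀_cobounded.comp
    rw [← tendsto_norm_atTop_iff_cobounded]
    apply tendsto_atTop_mono (f := fun N : ℕ => (N : ℝ)) _ tendsto_natCast_atTop_atTop
    intro N
    refine le_trans ?_ (Complex.re_le_norm _)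
    have hj : (0 : ℝ) ≤ N := by positivity
    simp; linarith
  have hcs : Real.pi * Complex.cot (Real.pi * y) = Real.pi * Complex.tan (Real.pi * z / 4) := by
    rw [Complex.cot, Complex.tan, show (Real.pi * y : ℂ) = Real.pi / 2 - Real.pi * z / 4 by
      rw [hy]; ring, Complex.cos_pi_div_two_sub, Complex.sin_pi_div_two_sub]
  have := ((hcot.const_add (1 / y)).const_mul (1 / 4)).sub hlim
  refine (this.congr fun N => (hS N).symm).trans (le_of_eq ?_)
  congr 1
  linear_combination (1 / 4) * hcs

lemma G_k1 {z : ℂ} (hz : |z.re| < 2) :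
    G k1 z = Real.pi / 4 * Complex.tan (Real.pi * z / 4) :=
  tendsto_nhds_unique (tendsto_S hz) (tendsto_S' hz)

end Wave
namespace Wave

noncomputable def zz (p : ℝ × ℝ) : ℂ := (p.2 : ℂ) + p.1 * Complex.I

@[simp] lemma zz_re (p : ℝ × ℝ) : (zz p).re = p.2 := by simp [zz]

@[simp] lemma zz_im (p : ℝ × ℝ) : (zz p).im = p.1 := by simp [zz]

lemma re_sinh (p : ℝ × ℝ) (t : ℝ) :
    (Complex.sinh (zz p * t)).re = Real.sinh (p.2 * t) * Real.cos (p.1 * t) := by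
  have : zz p * t = ((p.2 * t : ℝ) : ℂ) + ((p.1 * t : ℝ) : ℂ) * Complex.I := by
    rw [zz]; push_cast; ring
  rw [this, Complex.sinh_add, Complex.cosh_mul_I, Complex.sinh_mul_I, ← Complex.ofReal_sinh,
    ← Complex.ofReal_cosh, ← Complex.ofReal_cos, ← Complex.ofReal_sin]
  simp only [Complex.add_re, Complex.mul_re, Complex.mul_im, Complex.ofReal_re, Complex.ofReal_im,
    Complex.I_re, Complex.I_im]
  ring

lemma re_cosh (p : ℝ × ℝ) (t : ℝ) :
    (Complex.cosh (zz p * t)).re = Real.cosh (p.2 * t) * Real.cos (p.1 * t) := by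
  have : zz p * t = ((p.2 * t : ℝ) : ℂ) + ((p.1 * t : ℝ) : ℂ) * Complex.I := by
    rw [zz]; push_cast; ring
  rw [this, Complex.cosh_add, Complex.cosh_mul_I, Complex.sinh_mul_I, ← Complex.ofReal_sinh,
    ← Complex.ofReal_cosh, ← Complex.ofReal_cos, ← Complex.ofReal_sin]
  simp only [Complex.add_re, Complex.mul_re, Complex.mul_im, Complex.ofReal_re, Complex.ofReal_im,
    Complex.I_re, Complex.I_im]
  ring

lemma re_G {C : ℝ} {k : ℝ → ℝ} (h : KB C k) {p : ℝ × ℝ} (hp : |p.2| < 2) :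
    (G k (zz p)).re = ∫ t in Ioi (0 : ℝ), k t * (Real.sinh (p.2 * t) * Real.cos (p.1 * t)) := by
  have hi := int_sinh h (z := zz p) (by simpa using hp)
  have := integral_re (𝕜 := ℂ) hi
  simp only [RCLike.re_to_complex, Complex.re_ofReal_mul, re_sinh] at this
  rw [G, this]

lemma re_G' {C : ℝ} {k : ℝ → ℝ} (h : KB C k) {p : ℝ × ℝ} (hp : |p.2| < 2) :
    (G' k (zz p)).re =
      ∫ t in Ioi (0 : ℝ), k t * (Real.cosh (p.2 * t) * Real.cos (p.1 * t) * t) := by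
  have hi := int_cosh h (z := zz p) (by simpa using hp)
  have := integral_re (𝕜 := ℂ) hi
  simp only [RCLike.re_to_complex, Complex.re_ofReal_mul, Complex.re_mul_ofReal, re_cosh] at this
  rw [G', this]

lemma int_re {C : ℝ} {k : ℝ → ℝ} (h : KB C k) {p : ℝ × ℝ} (hp : |p.2| < 2) :
    IntegrableOn (fun t => k t * (Real.sinh (p.2 * t) * Real.cos (p.1 * t))) (Ioi 0) := by
  have hi := (int_sinh h (z := zz p) (by simpa using hp)).re
  simp only [RCLike.re_to_complex, Complex.re_ofReal_mul, re_sinh] at hi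
  exact hi

lemma int_re' {C : ℝ} {k : ℝ → ℝ} (h : KB C k) {p : ℝ × ℝ} (hp : |p.2| < 2) :
    IntegrableOn (fun t => k t * (Real.cosh (p.2 * t) * Real.cos (p.1 * t) * t)) (Ioi 0) := by
  have hi := (int_cosh h (z := zz p) (by simpa using hp)).re
  simp only [RCLike.re_to_complex, Complex.re_ofReal_mul, Complex.re_mul_ofReal, re_cosh] at hi
  exact hi

lemma hasDerivAt_x {f : ℂ → ℂ} {f' : ℂ} {x y : ℝ} (h : HasDerivAt f f' (zz (x, y))) :
    HasDerivAt (fun x : ℝ => 8 * (f (zz (x, y))).re) (8 * (f' * Complex.I).re) x := by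
  have h1 : HasDerivAt (fun x : ℝ => zz (x, y)) Complex.I x := by
    have := ((Complex.ofRealCLM.hasDerivAt (x := x)).mul_const Complex.I).const_add (y : ℂ)
    simpa [zz] using this
  have h2 := HasDerivAt.comp x h h1
  exact (Complex.reCLM.hasFDerivAt.comp_hasDerivAt x h2).const_mul 8

lemma hasDerivAt_y {f : ℂ → ℂ} {f' : ℂ} {x y : ℝ} (h : HasDerivAt f f' (zz (x, y))) :
    HasDerivAt (fun y : ℝ => 8 * (f (zz (x, y))).re) (8 * f'.re) y := by
  have h1 : HasDerivAt (fun y : ℝ => zz (x, y)) 1 y := by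
    have := (Complex.ofRealCLM.hasDerivAt (x := y)).add_const ((x : ℂ) * Complex.I)
    simpa [zz] using this
  have h2 := HasDerivAt.comp y h h1
  rw [mul_one] at h2
  exact (Complex.reCLM.hasFDerivAt.comp_hasDerivAt y h2).const_mul 8

lemma contDiff_zz : ContDiff ℝ 2 zz := by
  unfold zz
  exact (Complex.ofRealCLM.contDiff.comp contDiff_snd).add
    ((Complex.ofRealCLM.contDiff.comp contDiff_fst).mul contDiff_const)

lemma harmonic_of {w : ℝ × ℝ → ℝ} {f : ℂ → ℂ} (hf : DifferentiableOn ℂ f U)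
    (hw : ∀ p : ℝ × ℝ, |p.2| < 2 → w p = 8 * (f (zz p)).re) : HarmonicOnR2 w Dset := by
  have hD : ∀ p ∈ Dset, |p.2| < 2 := by
    intro p hp
    have := hp.2
    rw [abs_lt]; constructor <;> linarith [this.1, this.2]
  have hfd : DifferentiableOn ℂ (deriv f) U := hf.deriv isOpen_U
  have hd1 : ∀ z ∈ U, HasDerivAt f (deriv f z) z := fun z hz =>
    ((hf z hz).differentiableAt (isOpen_U.mem_nhds hz)).hasDerivAt
  have hd2 : ∀ z ∈ U, HasDerivAt (deriv f) (deriv (deriv f) z) z := fun z hz =>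
    ((hfd z hz).differentiableAt (isOpen_U.mem_nhds hz)).hasDerivAt
  have hU : ∀ p : ℝ × ℝ, |p.2| < 2 → zz p ∈ U := fun p hp => by simpa [U] using hp
  have hx : ∀ p : ℝ × ℝ, |p.2| < 2 → pdx w p = 8 * ((fun z => deriv f z * Complex.I) (zz p)).re := by
    rintro ⟨x, y⟩ hp
    have : (fun x => w (x, y)) = fun x => 8 * (f (zz (x, y))).re := by
      funext x; exact hw (x, y) hp
    simp only [pdx, this]
    exact (hasDerivAt_x (hd1 _ (hU _ hp))).deriv
  have hev : ∀ (x y : ℝ), |y| < 2 → ∀ᶠ y' in 𝓝 y, |y'| < 2 := fun x y hy =>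
    (isOpen_lt continuous_abs continuous_const).mem_nhds hy
  have hy : ∀ p : ℝ × ℝ, |p.2| < 2 → pdy w p = 8 * ((deriv f) (zz p)).re := by
    rintro ⟨x, y⟩ hp
    have : (fun y => w (x, y)) =ᶠ[𝓝 y] fun y => 8 * (f (zz (x, y))).re := by
      filter_upwards [hev x y hp] with y' hy'
      exact hw (x, y') hy'
    simp only [pdy]
    rw [this.deriv_eq]
    exact (hasDerivAt_y (hd1 _ (hU _ hp))).deriv
  refine ⟨?_, ?_⟩
  · have h1 : ContDiffOn ℝ 2 f U := (hf.contDiffOn isOpen_U (n := 2)).restrict_scalars ℝ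
    have h2 : ContDiffOn ℝ 2 (fun p => f (zz p)) Dset :=
      h1.comp contDiff_zz.contDiffOn (fun p hp => hU p (hD p hp))
    have h3 : ContDiffOn ℝ 2 (fun p => 8 * (f (zz p)).re) Dset :=
      contDiffOn_const.mul (Complex.reCLM.contDiff.comp_contDiffOn h2)
    exact h3.congr fun p hp => hw p (hD p hp)
  · rintro ⟨x, y⟩ hp
    have hp' := hD _ hp
    have e1 : pdx (pdx w) (x, y) = 8 * (deriv (deriv f) (zz (x, y)) * Complex.I * Complex.I).re := by
      have : (fun x => pdx w (x, y)) =
          fun x => 8 * ((fun z => deriv f z * Complex.I) (zz (x, y))).re := by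
        funext x; exact hx (x, y) hp'
      rw [pdx]
      simp only [this]
      exact (hasDerivAt_x (f := fun z => deriv f z * Complex.I)
        ((hd2 _ (hU _ hp')).mul_const Complex.I)).deriv
    have e2 : pdy (pdy w) (x, y) = 8 * (deriv (deriv f) (zz (x, y))).re := by
      have : (fun y => pdy w (x, y)) =ᶠ[𝓝 y] fun y => 8 * (deriv f (zz (x, y))).re := by
        filter_upwards [hev x y hp'] with y' hy'
        exact hy (x, y') hy'
      rw [pdy]
      simp only
      rw [this.deriv_eq]
      exact (hasDerivAt_y (hd2 _ (hU _ hp'))).deriv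
    rw [e1, e2, mul_assoc, Complex.I_mul_I]
    simp

/-- decay along each horizontal line -/
lemma decay_pt {C : ℝ} {k : ℝ → ℝ} (h : KB C k) {y : ℝ} (hy : |y| < 2) :
    Tendsto (fun x : ℝ => (G k (zz (x, y))).re) (cocompact ℝ) (𝓝 0) := by
  have h1 := Real.tendsto_integral_exp_smul_cocompact
    (fun t : ℝ => (Ioi (0 : ℝ)).indicator (fun t => ((k t * Real.sinh (y * t) : ℝ) : ℂ)) t)
  have hk : IntegrableOn (fun t => k t * Real.sinh (y * t)) (Ioi 0) := by
    simpa using int_re h (p := (0, y)) hy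
  have h2 : Tendsto (fun x : ℝ => x / (2 * Real.pi)) (cocompact ℝ) (cocompact ℝ) := by
    have := (Homeomorph.mulRight₀ (2 * Real.pi)⁻¹ (by positivity)).isClosedEmbedding.tendsto_cocompact
    simpa [div_eq_mul_inv] using this
  have h3 := (Complex.continuous_re.tendsto 0).comp (h1.comp h2)
  refine h3.congr fun x => ?_
  rw [re_G h hy]
  simp only [Function.comp]
  have e1 : (∫ v : ℝ, Real.fourierChar (-(v * (x / (2 * Real.pi)))) •
      (Ioi (0 : ℝ)).indicator (fun t => ((k t * Real.sinh (y * t) : ℝ) : ℂ)) v) =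
      ∫ v in Ioi (0 : ℝ), Real.fourierChar (-(v * (x / (2 * Real.pi)))) •
        ((k v * Real.sinh (y * v) : ℝ) : ℂ) := by
    rw [← integral_indicator measurableSet_Ioi]
    congr 1
    funext v
    by_cases hv : v ∈ Ioi (0 : ℝ)
    · simp only [indicator_of_mem hv]
    · simp only [indicator_of_notMem hv, smul_zero]
  rw [e1]
  have hint : IntegrableOn (fun v : ℝ => Real.fourierChar (-(v * (x / (2 * Real.pi)))) •
        ((k v * Real.sinh (y * v) : ℝ) : ℂ)) (Ioi 0) := by
    have hk' := hk.ofReal (𝕜 := ℂ)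
    refine Integrable.mono hk' ?_ ?_
    · refine AEStronglyMeasurable.smul (Continuous.aestronglyMeasurable (by fun_prop)) hk'.1
    · filter_upwards with v
      simp
  have := integral_re (𝕜 := ℂ) hint
  simp only [RCLike.re_to_complex] at this
  rw [← this]
  congr 1
  funext v
  rw [Circle.smul_def, Real.fourierChar_apply, smul_eq_mul, mul_comm, Complex.re_ofReal_mul]
  have : (2 * Real.pi * (-(v * (x / (2 * Real.pi)))) : ℝ) = -(x * v) := by
    field_simp
  rw [this, Complex.exp_ofReal_mul_I_re, Real.cos_neg]
  ring

lemma lip {C : ℝ} {k : ℝ → ℝ} (h : KB C k) : ∃ L : ℝ, ∀ x y y' : ℝ, y ∈ Icc (-1 : ℝ) 1 →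
    y' ∈ Icc (-1 : ℝ) 1 → |(G k (zz (x, y))).re - (G k (zz (x, y'))).re| ≤ L * |y - y'| := by
  refine ⟨∫ t in Ioi (0 : ℝ), C * (1 + t) * Real.exp (-(2 * t)) * Real.exp (1 * t), ?_⟩
  intro x y y' hy hy'
  have hconv : Convex ℝ {v : ℂ | |v.re| ≤ 1} := by
    have : {v : ℂ | |v.re| ≤ 1} = Complex.reLm ⁻¹' (Icc (-1) 1) := by
      ext v; simp [abs_le]
    rw [this]
    exact (convex_Icc _ _).is_linear_preimage Complex.reLm.isLinear
  have := hconv.norm_image_sub_le_of_norm_hasDerivWithin_le (𝕜 := ℂ) (f := G k) (f' := G' k)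
    (C := ∫ t in Ioi (0 : ℝ), C * (1 + t) * Real.exp (-(2 * t)) * Real.exp (1 * t))
    (x := zz (x, y')) (y := zz (x, y))
    (fun v hv => (hasDerivAt_G h (lt_of_le_of_lt hv one_lt_two)).hasDerivWithinAt)
    (fun v hv => by
      refine norm_integral_le_of_norm_le (dom_int C one_lt_two) ?_
      filter_upwards [ae_restrict_mem measurableSet_Ioi] with t ht
      exact bound_cosh h hv ht) (show |(zz (x, y')).re| ≤ 1 by rw [zz_re]; exact abs_le.2 hy')
    (show |(zz (x, y)).re| ≤ 1 by rw [zz_re]; exact abs_le.2 hy)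
  have e : zz (x, y) - zz (x, y') = ((y - y' : ℝ) : ℂ) := by simp [zz]
  rw [e, Complex.norm_real, Real.norm_eq_abs] at this
  refine le_trans ?_ this
  rw [← Complex.sub_re]
  exact Complex.abs_re_le_norm _

lemma decay {C : ℝ} {k : ℝ → ℝ} (h : KB C k) {ε : ℝ} (hε : 0 < ε) :
    ∃ R : ℝ, ∀ x y : ℝ, R ≤ |x| → y ∈ Icc (-1 : ℝ) 1 → |(G k (zz (x, y))).re| < ε := by
  obtain ⟨L, hL⟩ := lip h
  have key : ∃ R : ℝ, ∀ x y : ℝ, R ≤ |x| → y ∈ Icc (-1 : ℝ) 1 → y ∈ Icc (-1 : ℝ) 1 →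
      |(G k (zz (x, y))).re| < ε := by
    refine (isCompact_Icc (a := (-1 : ℝ)) (b := 1)).induction_on
      (p := fun s => ∃ R : ℝ, ∀ x y : ℝ, R ≤ |x| → y ∈ s → y ∈ Icc (-1 : ℝ) 1 →
        |(G k (zz (x, y))).re| < ε) ?_ ?_ ?_ ?_
    · exact ⟨0, fun x y _ hy => absurd hy (by simp)⟩
    · rintro s t hst ⟨R, hR⟩
      exact ⟨R, fun x y hx hy => hR x y hx (hst hy)⟩
    · rintro s t ⟨R, hR⟩ ⟨R', hR'⟩
      refine ⟨max R R', fun x y hx hy hyI => ?_⟩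
      rcases hy with hy | hy
      · exact hR x y ((le_max_left _ _).trans hx) hy hyI
      · exact hR' x y ((le_max_right _ _).trans hx) hy hyI
    · intro y0 hy0
      have hy0' : |y0| < 2 := by rw [abs_lt]; constructor <;> linarith [hy0.1, hy0.2]
      have h1 := decay_pt h hy0'
      have h2 : ∀ᶠ x in cocompact ℝ, |(G k (zz (x, y0))).re| < ε / 2 := by
        have := h1.eventually (Metric.ball_mem_nhds 0 (half_pos hε))
        simpa [Real.dist_eq] using this
      obtain ⟨R, hR⟩ : ∃ R : ℝ, ∀ x : ℝ, R ≤ |x| → |(G k (zz (x, y0))).re| < ε / 2 := by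
        rw [← Metric.cobounded_eq_cocompact, ← comap_norm_atTop, eventually_comap] at h2
        obtain ⟨R, hR⟩ := eventually_atTop.1 h2
        exact ⟨R, fun x hx => hR |x| hx x rfl⟩
      refine ⟨Metric.ball y0 (ε / (2 * (|L| + 1))),
        mem_nhdsWithin_of_mem_nhds (Metric.ball_mem_nhds _ (by positivity)), R, ?_⟩
      intro x y hx hy hyI
      have h3 := hL x y y0 hyI hy0
      have h4 := hR x hx
      rw [Metric.mem_ball, Real.dist_eq, lt_div_iff₀ (by positivity)] at hy
      have h5 : L * |y - y0| ≤ |L| * |y - y0| := by gcongr; exact le_abs_self L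
      have h6 := abs_nonneg (y - y0)
      have h7 := abs_sub_abs_le_abs_sub (G k (zz (x, y))).re (G k (zz (x, y0))).re
      nlinarith
  obtain ⟨R, hR⟩ := key
  exact ⟨R, fun x y hx hy => hR x y hx hy hy⟩

end Wave
namespace Wave

lemma cos_zz (p : ℝ × ℝ) :
    Complex.cos (Real.pi * zz p / 4) =
      ((Real.cos (Real.pi * p.2 / 4) * Real.cosh (Real.pi * p.1 / 4) : ℝ) : ℂ) -
      ((Real.sin (Real.pi * p.2 / 4) * Real.sinh (Real.pi * p.1 / 4) : ℝ) : ℂ) * Complex.I := by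
  have : Real.pi * zz p / 4 =
      ((Real.pi * p.2 / 4 : ℝ) : ℂ) + ((Real.pi * p.1 / 4 : ℝ) : ℂ) * Complex.I := by
    rw [zz]; push_cast; ring
  rw [this, Complex.cos_add, Complex.cos_mul_I, Complex.sin_mul_I]
  push_cast
  ring

lemma sin_zz (p : ℝ × ℝ) :
    Complex.sin (Real.pi * zz p / 4) =
      ((Real.sin (Real.pi * p.2 / 4) * Real.cosh (Real.pi * p.1 / 4) : ℝ) : ℂ) +
      ((Real.cos (Real.pi * p.2 / 4) * Real.sinh (Real.pi * p.1 / 4) : ℝ) : ℂ) * Complex.I := by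
  have : Real.pi * zz p / 4 =
      ((Real.pi * p.2 / 4 : ℝ) : ℂ) + ((Real.pi * p.1 / 4 : ℝ) : ℂ) * Complex.I := by
    rw [zz]; push_cast; ring
  rw [this, Complex.sin_add, Complex.cos_mul_I, Complex.sin_mul_I]
  push_cast
  ring

lemma re_tan {p : ℝ × ℝ} (hp : |p.2| < 2) :
    (Real.pi / 4 * Complex.tan (Real.pi * zz p / 4)).re =
      Real.pi / 4 * (Real.sin (p.2 * Real.pi / 2) /
        (Real.cosh (Real.pi * p.1 / 2) + Real.cos (p.2 * Real.pi / 2))) := by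
  rw [abs_lt] at hp
  have hpi := Real.pi_pos
  set a := Real.pi * p.2 / 4 with ha
  set b := Real.pi * p.1 / 4 with hb
  have e1 : p.2 * Real.pi / 2 = 2 * a := by rw [ha]; ring
  have e2 : Real.pi * p.1 / 2 = 2 * b := by rw [hb]; ring
  have hca : 0 < Real.cos a := by
    apply Real.cos_pos_of_mem_Ioo
    constructor <;> rw [ha] <;> nlinarith
  have h1 := Real.cosh_sq b
  have h2 := Real.sin_sq_add_cos_sq a
  rw [e1, e2, Real.sin_two_mul, Real.cos_two_mul, Real.cosh_two_mul]
  have e3 : (Real.pi / 4 * Complex.tan (Real.pi * zz p / 4)) =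
      ((Real.pi / 4 : ℝ) : ℂ) * Complex.tan (Real.pi * zz p / 4) := by push_cast; rfl
  rw [e3, Complex.re_ofReal_mul, Complex.tan, sin_zz, cos_zz, Complex.div_re]
  simp only [← ha, ← hb]
  congr 1
  have hn : Complex.normSq (((Real.cos a * Real.cosh b : ℝ) : ℂ) -
      ((Real.sin a * Real.sinh b : ℝ) : ℂ) * Complex.I) = Real.cos a ^ 2 + Real.sinh b ^ 2 := by
    rw [Complex.normSq_apply]
    simp only [Complex.sub_re, Complex.sub_im, Complex.mul_re, Complex.mul_im, Complex.ofReal_re,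
      Complex.ofReal_im, Complex.I_re, Complex.I_im]
    linear_combination Real.cos a ^ 2 * h1 + Real.sinh b ^ 2 * h2
  rw [hn]
  simp only [Complex.sub_re, Complex.sub_im, Complex.add_re, Complex.add_im, Complex.mul_re,
    Complex.mul_im, Complex.ofReal_re, Complex.ofReal_im, Complex.I_re, Complex.I_im]
  have hpos : 0 < Real.cos a ^ 2 + Real.sinh b ^ 2 := by positivity
  rw [← add_div, h1, show Real.sinh b ^ 2 + 1 + Real.sinh b ^ 2 + (2 * Real.cos a ^ 2 - 1) =
    2 * (Real.cos a ^ 2 + Real.sinh b ^ 2) by ring, div_eq_div_iff hpos.ne' (by positivity)]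
  linear_combination 2 * Real.sin a * Real.cos a * (Real.cos a ^ 2 + Real.sinh b ^ 2) * h1

lemma re_G'_k1 (x : ℝ) :
    (G' k1 (zz (x, 1))).re = Real.pi ^ 2 / 8 / Real.cosh (Real.pi * x / 2) ^ 2 := by
  have h1 : HasDerivAt (fun y : ℝ => 8 * (G k1 (zz (x, y))).re) (8 * (G' k1 (zz (x, 1))).re) 1 :=
    hasDerivAt_y (hasDerivAt_G KB_k1 (by simp))
  set c := Real.cosh (Real.pi * x / 2) with hc
  have hcpos : 0 < c := Real.cosh_pos _
  have h2 : HasDerivAt (fun y : ℝ => 8 * (Real.pi / 4 * (Real.sin (y * Real.pi / 2) /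
        (c + Real.cos (y * Real.pi / 2))))) (Real.pi ^ 2 / c ^ 2) 1 := by
    have hl : HasDerivAt (fun y : ℝ => y * Real.pi / 2) (Real.pi / 2) 1 := by
      simpa using ((hasDerivAt_id (1 : ℝ)).mul_const Real.pi).div_const 2
    have hd := ((hl.sin.div (hl.cos.const_add c) (by simp [hcpos.ne'])).const_mul
      (Real.pi / 4)).const_mul 8
    refine hd.congr_deriv ?_
    simp only [one_mul, Real.sin_pi_div_two, Real.cos_pi_div_two]
    field_simp
    ring
  have h3 : (fun y : ℝ => 8 * (G k1 (zz (x, y))).re) =ᶠ[𝓝 1]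
      (fun y : ℝ => 8 * (Real.pi / 4 * (Real.sin (y * Real.pi / 2) /
        (c + Real.cos (y * Real.pi / 2))))) := by
    have : ∀ᶠ y : ℝ in 𝓝 1, |y| < 2 :=
      (isOpen_lt continuous_abs continuous_const).mem_nhds (by simp)
    filter_upwards [this] with y hy
    rw [G_k1 (by simpa using hy), re_tan (p := (x, y)) hy]
  have := h1.unique (h2.congr_of_eventuallyEq h3)
  rw [div_right_comm]
  linarith

noncomputable def mF (F : ℝ) (t : ℝ) : ℝ := F ^ 2 * t / (F ^ 2 * t - Real.tanh t)

noncomputable def m2 (F : ℝ) (t : ℝ) : ℝ := 1 / (F ^ 2 * t * (Real.cosh t / Real.sinh t) - 1)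

noncomputable def kF (F : ℝ) (t : ℝ) : ℝ := mF F t / Real.sinh (2 * t)

noncomputable def k2 (F : ℝ) (t : ℝ) : ℝ := m2 F t / Real.sinh (2 * t)

lemma den_ge {F : ℝ} {t : ℝ} (ht : 0 < t) :
    (F ^ 2 - 1) * t ≤ F ^ 2 * t - Real.tanh t := by
  have := tanh_le ht; linarith

lemma KB_kF {F : ℝ} (hF : 1 < F ^ 2) : KB (2 * (F ^ 2 / (F ^ 2 - 1))) (kF F) := by
  refine KB_of_bdd (m := mF F) ?_ (fun t ht => ?_)
  · exact (measurable_const_mul _).div ((measurable_const_mul _).sub measurable_tanh')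
  · have h1 := den_ge (F := F) ht
    have h2 : 0 < (F ^ 2 - 1) * t := mul_pos (by linarith) ht
    rw [mF, abs_of_nonneg (div_nonneg (by positivity) (by linarith)),
      div_le_div_iff₀ (by linarith) (by linarith)]
    nlinarith [mul_le_mul_of_nonneg_left h1 (by positivity : 0 ≤ F ^ 2)]

lemma KB_k2 {F : ℝ} (hF : 1 < F ^ 2) : KB (2 * (1 / (F ^ 2 - 1))) (k2 F) := by
  refine KB_of_bdd (m := m2 F) ?_ (fun t ht => ?_)
  · exact measurable_const.div (((measurable_const_mul _).mul
      (Real.measurable_cosh.div Real.measurable_sinh)).sub_const 1)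
  · have hs : 0 < Real.sinh t := Real.sinh_pos_iff.2 ht
    have h1 : 1 ≤ t * (Real.cosh t / Real.sinh t) := by
      rw [← mul_div_assoc, le_div_iff₀ hs, one_mul]; exact sinh_le_mul_cosh ht
    have h2 : F ^ 2 - 1 ≤ F ^ 2 * t * (Real.cosh t / Real.sinh t) - 1 := by
      have := mul_le_mul_of_nonneg_left h1 (by positivity : 0 ≤ F ^ 2)
      linarith
    have h3 : 0 < F ^ 2 - 1 := by linarith
    rw [m2, abs_of_nonneg (one_div_nonneg.2 (by linarith))]
    exact one_div_le_one_div_of_le h3 h2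

lemma kF_eq {F : ℝ} (hF : 1 < F ^ 2) {t : ℝ} (ht : 0 < t) : kF F t = k1 t + k2 F t := by
  have hs : 0 < Real.sinh t := Real.sinh_pos_iff.2 ht
  have hc := Real.cosh_pos t
  have h1 := den_ge (F := F) ht
  have h2 : 0 < (F ^ 2 - 1) * t := mul_pos (by linarith) ht
  have h3 : 0 < F ^ 2 * t - Real.tanh t := by linarith
  rw [kF, k1, k2, ← add_div]
  congr 1
  have e1 : F ^ 2 * t * (Real.cosh t / Real.sinh t) - 1 =
      (F ^ 2 * t - Real.tanh t) / Real.tanh t := by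
    have := (tanh_pos' ht).ne'
    rw [sub_div, div_self this, Real.tanh_eq_sinh_div_cosh]
    field_simp
  rw [mF, m2, e1, one_div_div]
  field_simp
  ring

lemma integrand_eq (F : ℝ) (ξ η t : ℝ) :
    (F ^ 2 * t / (F ^ 2 * t - Real.tanh t)) * (Real.sinh (η * t) / Real.sinh (2 * t)) *
      Real.cos (ξ * t) = kF F t * (Real.sinh (η * t) * Real.cos (ξ * t)) := by
  rw [kF, mF]; ring

lemma integrand_eq2 (F : ℝ) (ξ η t : ℝ) :
    (1 / (F ^ 2 * t * (Real.cosh t / Real.sinh t) - 1)) *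
              (Real.sinh (η * t) / Real.sinh (2 * t)) * Real.cos (ξ * t)
      = k2 F t * (Real.sinh (η * t) * Real.cos (ξ * t)) := by
  rw [k2, m2]; ring

lemma wdd_eq {F : ℝ} (hF : 1 < F ^ 2) (p : ℝ × ℝ) (hp : |p.2| < 2) :
    wdd F p = 8 * (G (kF F) (zz p)).re := by
  rw [re_G (KB_kF hF) hp, wdd]
  simp only [integrand_eq]

lemma bc_integrand {F : ℝ} (hF : 1 < F ^ 2) (x : ℝ) {t : ℝ} (ht : 0 < t) :
    kF F t * (Real.cosh (1 * t) * Real.cos (x * t) * t) -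
      kF F t * (Real.sinh (1 * t) * Real.cos (x * t)) / F ^ 2 =
    k1 t * (Real.cosh (1 * t) * Real.cos (x * t) * t) := by
  have hc := Real.cosh_pos t
  have h1 := den_ge (F := F) ht
  have h2 : 0 < (F ^ 2 - 1) * t := mul_pos (by linarith) ht
  have h3 : F ^ 2 * t - Real.tanh t ≠ 0 := by linarith
  have hF2 : F ^ 2 ≠ 0 := by linarith
  have hm : mF F t * (F ^ 2 * t - Real.tanh t) = F ^ 2 * t := by
    rw [mF, div_mul_cancel₀ _ h3]
  have hsc : Real.sinh t = Real.tanh t * Real.cosh t := by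
    rw [Real.tanh_eq_sinh_div_cosh, div_mul_cancel₀ _ hc.ne']
  rw [one_mul, kF, k1, hsc]
  have : mF F t * t - mF F t * Real.tanh t / F ^ 2 = t := by
    have hF0 : F ≠ 0 := fun h => hF2 (by rw [h]; simp)
    field_simp
    linear_combination hm
  linear_combination (Real.cosh t * Real.cos (x * t) / Real.sinh (2 * t)) * this

lemma bc {F : ℝ} (hF : 1 < F ^ 2) (x : ℝ) : pdy (wdd F) (x, 1) - wdd F (x, 1) / F ^ 2 =
        Real.pi ^ 2 / Real.cosh (Real.pi * x / 2) ^ 2 := by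
  have h12 : |(1 : ℝ)| < 2 := by simp
  have h1 : HasDerivAt (fun y : ℝ => 8 * (G (kF F) (zz (x, y))).re)
      (8 * (G' (kF F) (zz (x, 1))).re) 1 :=
    hasDerivAt_y (hasDerivAt_G (KB_kF hF) (by simp))
  have h3 : (fun y : ℝ => wdd F (x, y)) =ᶠ[𝓝 1] (fun y : ℝ => 8 * (G (kF F) (zz (x, y))).re) := by
    have : ∀ᶠ y : ℝ in 𝓝 1, |y| < 2 :=
      (isOpen_lt continuous_abs continuous_const).mem_nhds (by simp)
    filter_upwards [this] with y hy
    exact wdd_eq hF (x, y) hy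
  have h4 : pdy (wdd F) (x, 1) = 8 * (G' (kF F) (zz (x, 1))).re := by
    simp only [pdy]
    rw [h3.deriv_eq, h1.deriv]
  have h5 : (G' (kF F) (zz (x, 1))).re - (G (kF F) (zz (x, 1))).re / F ^ 2 =
      (G' k1 (zz (x, 1))).re := by
    rw [re_G' (KB_kF hF) h12, re_G (KB_kF hF) h12, re_G' KB_k1 h12, ← integral_div,
      ← integral_sub (int_re' (KB_kF hF) (p := (x, 1)) h12)
        ((int_re (KB_kF hF) (p := (x, 1)) h12).div_const _)]
    exact setIntegral_congr_fun measurableSet_Ioi fun t ht => bc_integrand hF x ht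
  rw [h4, wdd_eq hF (x, 1) h12, mul_div_assoc, ← mul_sub, h5, re_G'_k1]
  ring

end Wave

theorem statement7 (F : ℝ) (hF0 : 0 < F) (hF : 1 < F ^ 2) :
    -- (i) convergence of the integral
    (∀ ξ : ℝ, ∀ η ∈ Icc (-1 : ℝ) 1,
      IntegrableOn
        (fun t => (F ^ 2 * t / (F ^ 2 * t - Real.tanh t)) *
          (Real.sinh (η * t) / Real.sinh (2 * t)) * Real.cos (ξ * t)) (Ioi (0 : ℝ)))
    -- harmonicity on the strip
    ∧ HarmonicOnR2 (wdd F) Dset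
    -- vanishing on the bed
    ∧ (∀ ξ : ℝ, wdd F (ξ, 0) = 0)
    -- even in `ξ`, odd in `η`
    ∧ (∀ ξ η : ℝ, wdd F (-ξ, η) = wdd F (ξ, η) ∧ wdd F (ξ, -η) = -wdd F (ξ, η))
    -- decay as `|ξ| → ∞`
    ∧ (∀ ε > 0, ∃ R : ℝ, ∀ ξ η : ℝ, R ≤ |ξ| → η ∈ Icc (-1 : ℝ) 1 → |wdd F (ξ, η)| < ε)
    -- the boundary condition `ẅ_η - ẅ/F² = π² sech²(πξ/2)` on `{η = 1}`
    ∧ (∀ ξ : ℝ, pdy (wdd F) (ξ, 1) - wdd F (ξ, 1) / F ^ 2 =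
        Real.pi ^ 2 / Real.cosh (Real.pi * ξ / 2) ^ 2)
    -- (ii) the alternative representation
    ∧ (∀ ξ : ℝ, ∀ η ∈ Icc (-1 : ℝ) 1,
        wdd F (ξ, η) =
          2 * Real.pi * Real.sin (η * Real.pi / 2) /
            (Real.cosh (Real.pi * ξ / 2) + Real.cos (η * Real.pi / 2)) +
          8 * ∫ t in Ioi (0 : ℝ),
            (1 / (F ^ 2 * t * (Real.cosh t / Real.sinh t) - 1)) *
              (Real.sinh (η * t) / Real.sinh (2 * t)) * Real.cos (ξ * t)) := by
  have hI : ∀ η ∈ Icc (-1 : ℝ) 1, |η| < 2 := fun η hη => by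
    rw [abs_lt]; constructor <;> linarith [hη.1, hη.2]
  refine ⟨?_, ?_, ?_, ?_, ?_, ?_, ?_⟩
  · intro ξ η hη
    simp only [Wave.integrand_eq]
    exact Wave.int_re (Wave.KB_kF hF) (p := (ξ, η)) (hI η hη)
  · exact Wave.harmonic_of (f := Wave.G (Wave.kF F))
      (fun z hz => (Wave.hasDerivAt_G (Wave.KB_kF hF) hz).differentiableAt.differentiableWithinAt)
      (Wave.wdd_eq hF)
  · intro ξ
    simp [wdd]
  · intro ξ η
    constructor
    · simp [wdd]
    · simp only [wdd, neg_mul, Real.sinh_neg, neg_div, mul_neg, integral_neg]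
  · intro ε hε
    obtain ⟨R, hR⟩ := Wave.decay (Wave.KB_kF hF) (ε := ε / 8) (by positivity)
    refine ⟨R, fun ξ η hξ hη => ?_⟩
    rw [Wave.wdd_eq hF (ξ, η) (hI η hη), abs_mul, abs_of_pos (by norm_num : (0 : ℝ) < 8)]
    have := hR ξ η hξ hη
    linarith
  · exact Wave.bc hF
  · intro ξ η hη
    have hp := hI η hη
    simp only [Wave.integrand_eq2]
    have h1 : (Wave.G (Wave.kF F) (Wave.zz (ξ, η))).re =
        (Wave.G Wave.k1 (Wave.zz (ξ, η))).re + (Wave.G (Wave.k2 F) (Wave.zz (ξ, η))).re := by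
      rw [Wave.re_G (Wave.KB_kF hF) hp, Wave.re_G Wave.KB_k1 hp, Wave.re_G (Wave.KB_k2 hF) hp,
        ← integral_add (Wave.int_re Wave.KB_k1 (p := (ξ, η)) hp)
          (Wave.int_re (Wave.KB_k2 hF) (p := (ξ, η)) hp)]
      refine setIntegral_congr_fun measurableSet_Ioi fun t ht => ?_
      simp only [Wave.kF_eq hF ht]
      ring
    rw [Wave.wdd_eq hF (ξ, η) hp, h1, Wave.G_k1 (by simpa using hp), Wave.re_tan (p := (ξ, η)) hp,
      Wave.re_G (Wave.KB_k2 hF) hp]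
    ring
end

section
/- Let β ∈ (0,1) and κ ∈ ℝ satisfy cos(πβ) > κ sin(πβ), set γ := −4 sin(πβ)/(cos(πβ) − κ sin(πβ)), and let W_ζ(ζ) := 1 + (γ/(4i))·[coth(π(ζ−iβ)/2) − coth(π(ζ+iβ)/2)]. Let f be holomorphic on the strip D = {−1 < Im ζ < 1} with f(−ζ) = −f(ζ) and f(conj ζ) = conj(f(ζ)), such that f' extends continuously to cl(D), is nonvanishing on cl(D), and f'(ζ) → 1 as |Re ζ| → ∞ uniformly in Im ζ; write w := Im f − Im ζ and assume w and its gradient extend continuously to cl(D) and tend to 0 as |Re ζ| → ∞ uniformly. Assume the Helmholtz–Kirchhoff condition f''(iβ)/f'(iβ) = πiκ. Define V := −Im(W_ζ/f') on D \ {iβ, −iβ}. Then the following are equivalent: (i) w_ξ < 0 on {(ξ,η) : ξ > 0, 0 < η ≤ 1}; (ii) V < 0 on {(ξ,η) : ξ > 0, 0 < η ≤ 1} \ {iβ}. -/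
open Set

/-- The open strip `D = {ζ : -1 < Im ζ < 1}`. -/
def Dstrip : Set ℂ := {z : ℂ | z.im ∈ Ioo (-1 : ℝ) 1}

/-- The closed strip `cl(D) = {ζ : -1 ≤ Im ζ ≤ 1}`. -/
def clDstrip : Set ℂ := {z : ℂ | z.im ∈ Icc (-1 : ℝ) 1}

/-- Partial derivative of a function on `ℂ` in the horizontal direction. -/
noncomputable def pdxC (u : ℂ → ℝ) (z : ℂ) : ℝ :=
  deriv (fun x : ℝ => u ((x : ℂ) + (z.im : ℂ) * Complex.I)) z.re

/-- Partial derivative of a function on `ℂ` in the vertical direction. -/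
noncomputable def pdyC (u : ℂ → ℝ) (z : ℂ) : ℝ :=
  deriv (fun y : ℝ => u ((z.re : ℂ) + (y : ℂ) * Complex.I)) z.im

open Filter Topology

/-- open quarter strip -/
def Qs : Set ℂ := {z : ℂ | 0 < z.re ∧ 0 < z.im ∧ z.im < 1}

/-- closed quarter strip -/
def clQ : Set ℂ := {z : ℂ | 0 ≤ z.re ∧ 0 ≤ z.im ∧ z.im ≤ 1}

lemma Qs_eq : Qs = Ioi (0:ℝ) ×ℂ Ioo (0:ℝ) 1 := by
  ext z; simp [Qs, Complex.mem_reProdIm]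

lemma isOpen_Qs : IsOpen Qs := by
  rw [Qs_eq]; exact isOpen_Ioi.reProdIm isOpen_Ioo

lemma closure_Qs : closure Qs = clQ := by
  rw [Qs_eq, Complex.closure_reProdIm, closure_Ioi, closure_Ioo (by norm_num)]
  ext z; simp [clQ, Complex.mem_reProdIm]

lemma preconn_Qs : IsPreconnected Qs := by
  rw [Qs_eq]
  have h1 : Convex ℝ (Ioi (0:ℝ)) := convex_Ioi 0
  have h2 : Convex ℝ (Ioo (0:ℝ) 1) := convex_Ioo 0 1
  exact ((h1.linear_preimage Complex.reLm).inter (h2.linear_preimage Complex.imLm)).isPreconnected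

lemma norm_exp_aux (h : ℂ) : ‖Complex.exp (Complex.I * h)‖ = Real.exp (-h.im) := by
  rw [Complex.norm_exp]; simp

lemma strongMax (h : ℂ → ℂ) (hh : DifferentiableOn ℂ h Qs) (z0 : ℂ) (hz0 : z0 ∈ Qs)
    (hmax : ∀ z ∈ Qs, -(h z).im ≤ -(h z0).im) : ∀ z ∈ Qs, -(h z).im = -(h z0).im := by
  intro z hz
  have hd : DifferentiableOn ℂ (fun z => Complex.exp (Complex.I * h z)) Qs :=
    (hh.const_mul _).cexp
  have := Complex.norm_eqOn_of_isPreconnected_of_isMaxOn preconn_Qs isOpen_Qs hd hz0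
    (by
      intro z hz
      simp only [Function.comp, mem_ofPred_eq, norm_exp_aux]
      exact Real.exp_le_exp.2 (hmax z hz)) hz
  simp only [Function.comp, Function.const, norm_exp_aux] at this
  exact Real.exp_injective this

lemma maxPrinciple (h : ℂ → ℂ) (hh : DifferentiableOn ℂ h Qs)
    (hb : ∀ p ∈ clQ, p ∉ Qs → ∀ ε > 0, ∀ᶠ z in 𝓝[Qs] p, -(h z).im < ε)
    (hinf : ∀ ε > 0, ∀ᶠ z in comap Complex.re atTop ⊓ 𝓟 Qs, -(h z).im < ε)
    (hneg : ∃ z ∈ Qs, -(h z).im < 0) : ∀ z ∈ Qs, -(h z).im < 0 := by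
  obtain ⟨z2, hz2, hz2n⟩ := hneg
  have hc : ContinuousOn (fun z => -(h z).im) Qs :=
    (Complex.continuous_im.comp_continuousOn hh.continuousOn).neg
  have hle : ∀ z ∈ Qs, -(h z).im ≤ 0 := by
    intro z0 hz0
    by_contra hcon
    push Not at hcon
    set ε := -(h z0).im with hε
    set S : Set ℂ := {z | z ∈ Qs ∧ ε ≤ -(h z).im} with hS
    have hclosed : IsClosed S := by
      rw [← closure_subset_iff_isClosed]
      intro p hp
      have hpQ : p ∈ clQ := by
        rw [← closure_Qs]; exact closure_mono (fun z hz => hz.1) hp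
      have hfr : ∃ᶠ z in 𝓝 p, z ∈ S := mem_closure_iff_frequently.1 hp
      by_cases hq : p ∈ Qs
      · refine ⟨hq, ?_⟩
        by_contra hlt
        push Not at hlt
        have h1 := (hc.continuousAt (isOpen_Qs.mem_nhds hq)).eventually_lt
          (continuousAt_const (y := ε)) hlt
        obtain ⟨z, hz, hz'⟩ := (hfr.and_eventually h1).exists
        exact absurd hz.2 (not_le.2 hz')
      · exfalso
        have h1 := hb p hpQ hq ε hcon
        rw [eventually_nhdsWithin_iff] at h1
        obtain ⟨z, hz, hz'⟩ := (hfr.and_eventually h1).exists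
        exact absurd hz.2 (not_le.2 (hz' hz.1))
    have hbd : Bornology.IsBounded S := by
      have h1 := hinf ε hcon
      rw [eventually_inf_principal, eventually_comap] at h1
      obtain ⟨R, hR⟩ := eventually_atTop.1 h1
      refine (((isCompact_Icc (a := (0:ℝ)) (b := R)).reProdIm
        (isCompact_Icc (a := (0:ℝ)) (b := 1))).isBounded).subset ?_
      intro z hz
      rw [Complex.mem_reProdIm]
      refine ⟨⟨hz.1.1.le, ?_⟩, hz.1.2.1.le, hz.1.2.2.le⟩
      by_contra hlt
      push Not at hlt
      exact absurd hz.2 (not_le.2 (hR z.re hlt.le z rfl hz.1))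
    have hcomp : IsCompact S := Metric.isCompact_of_isClosed_isBounded hclosed hbd
    obtain ⟨z1, hz1, hm⟩ := hcomp.exists_isMaxOn ⟨z0, hz0, le_rfl⟩ (hc.mono (fun z hz => hz.1))
    have := strongMax h hh z1 hz1.1 (by
      intro z hz
      by_cases hzz : ε ≤ -(h z).im
      · exact hm ⟨hz, hzz⟩
      · push Not at hzz; exact hzz.le.trans hz1.2) z2 hz2
    linarith [hz1.2]
  intro z hz
  rcases (hle z hz).lt_or_eq with h1 | h1
  · exact h1
  · have := strongMax h hh z hz (by intro z' hz'; rw [h1]; exact hle z' hz') z2 hz2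
    linarith

/-- the denominator -/
noncomputable def Ed (β : ℝ) (z : ℂ) : ℂ := Complex.cosh (Real.pi * z) - Real.cos (Real.pi * β)

lemma Ed_sinh (β : ℝ) (z : ℂ) : Ed β z =
    2 * (Complex.sinh ((Real.pi : ℂ) / 2 * (z - Complex.I * β)) *
      Complex.sinh ((Real.pi : ℂ) / 2 * (z + Complex.I * β))) := by
  have h1 : (Real.pi : ℂ) * z = (Real.pi : ℂ) / 2 * (z - Complex.I * β) +
    (Real.pi : ℂ) / 2 * (z + Complex.I * β) := by ring
  have h2 : ((Real.cos (Real.pi * β) : ℝ) : ℂ) = Complex.cosh ((Real.pi : ℂ) / 2 * (z + Complex.I * β) -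
    (Real.pi : ℂ) / 2 * (z - Complex.I * β)) := by
    rw [show (Real.pi : ℂ) / 2 * (z + Complex.I * β) -
      (Real.pi : ℂ) / 2 * (z - Complex.I * β) = (Real.pi * β : ℂ) * Complex.I by ring,
      Complex.cosh_mul_I]
    push_cast; rfl
  rw [Ed, h2, h1, Complex.cosh_add, Complex.cosh_sub]
  ring

lemma Wzeta_eq (γ β : ℝ) (z : ℂ) (hz : Ed β z ≠ 0) :
    Wzeta γ β z = 1 + ((γ / 2 * Real.sin (Real.pi * β) : ℝ) : ℂ) / Ed β z := by
  have hE := Ed_sinh β z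
  have hs : Complex.sinh ((Real.pi : ℂ) / 2 * (z + Complex.I * β) -
      (Real.pi : ℂ) / 2 * (z - Complex.I * β)) = Real.sin (Real.pi * β) * Complex.I := by
    rw [show (Real.pi : ℂ) / 2 * (z + Complex.I * β) -
      (Real.pi : ℂ) / 2 * (z - Complex.I * β) = (Real.pi * β : ℂ) * Complex.I by ring,
      Complex.sinh_mul_I]
    push_cast; rfl
  rw [Complex.sinh_sub] at hs
  rw [hE] at hz ⊢
  unfold Wzeta cCoth
  set a := Complex.sinh ((Real.pi : ℂ) / 2 * (z - Complex.I * β))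
  set b := Complex.sinh ((Real.pi : ℂ) / 2 * (z + Complex.I * β))
  have ha : a ≠ 0 := by rintro h; simp [h] at hz
  have hb : b ≠ 0 := by rintro h; simp [h] at hz
  have hI : Complex.I ≠ 0 := Complex.I_ne_zero
  rw [div_sub_div _ _ ha hb, show Complex.cosh ((Real.pi : ℂ) / 2 * (z - Complex.I * β)) * b
    - a * Complex.cosh ((Real.pi : ℂ) / 2 * (z + Complex.I * β)) =
    Real.sin (Real.pi * β) * Complex.I by rw [← hs]; ring]
  push_cast
  field_simp
  ring

lemma Ed_re (β : ℝ) (z : ℂ) : (Ed β z).re =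
    Real.cosh (Real.pi * z.re) * Real.cos (Real.pi * z.im) - Real.cos (Real.pi * β) := by
  have : (Real.pi : ℂ) * z = ((Real.pi * z.re : ℝ) : ℂ) + ((Real.pi * z.im : ℝ) : ℂ) * Complex.I := by
    conv_lhs => rw [← Complex.re_add_im z]
    push_cast; ring
  rw [Ed, this, Complex.cosh_add, Complex.cosh_mul_I, Complex.sinh_mul_I]
  simp only [← Complex.ofReal_cosh, ← Complex.ofReal_sinh, ← Complex.ofReal_cos,
    ← Complex.ofReal_sin]
  simp only [Complex.sub_re, Complex.add_re, Complex.mul_re, Complex.sub_im, Complex.add_im,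
    Complex.mul_im, Complex.ofReal_re, Complex.ofReal_im, Complex.I_re, Complex.I_im]
  ring

lemma Ed_im (β : ℝ) (z : ℂ) : (Ed β z).im =
    Real.sinh (Real.pi * z.re) * Real.sin (Real.pi * z.im) := by
  have : (Real.pi : ℂ) * z = ((Real.pi * z.re : ℝ) : ℂ) + ((Real.pi * z.im : ℝ) : ℂ) * Complex.I := by
    conv_lhs => rw [← Complex.re_add_im z]
    push_cast; ring
  rw [Ed, this, Complex.cosh_add, Complex.cosh_mul_I, Complex.sinh_mul_I]
  simp only [← Complex.ofReal_cosh, ← Complex.ofReal_sinh, ← Complex.ofReal_cos,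
    ← Complex.ofReal_sin]
  simp only [Complex.sub_re, Complex.add_re, Complex.mul_re, Complex.sub_im, Complex.add_im,
    Complex.mul_im, Complex.ofReal_re, Complex.ofReal_im, Complex.I_re, Complex.I_im]
  ring

lemma cosb (β : ℝ) (hβ : β ∈ Ioo (0 : ℝ) 1) :
    -1 < Real.cos (Real.pi * β) ∧ Real.cos (Real.pi * β) < 1 ∧ 0 < Real.sin (Real.pi * β) := by
  have hp := Real.pi_pos
  have hs : 0 < Real.sin (Real.pi * β) :=
    Real.sin_pos_of_pos_of_lt_pi (mul_pos hp hβ.1) (by nlinarith [hβ.2])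
  have := Real.sin_sq_add_cos_sq (Real.pi * β)
  refine ⟨by nlinarith, by nlinarith, hs⟩

lemma Ed_ne (β : ℝ) (hβ : β ∈ Ioo (0 : ℝ) 1) (z : ℂ) (hz : z ∈ clQ) (hne : z ≠ Complex.I * β) :
    Ed β z ≠ 0 := by
  intro h
  obtain ⟨hc1, hc2, hs⟩ := cosb β hβ
  obtain ⟨h0, h1, h2⟩ := hz
  have hp := Real.pi_pos
  have hr := Ed_re β z
  have hi := Ed_im β z
  rw [h] at hr hi
  simp only [Complex.zero_re, Complex.zero_im] at hr hi
  rcases mul_eq_zero.1 hi.symm with h3 | h3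
  · rw [Real.sinh_eq_zero] at h3
    rw [h3, Real.cosh_zero, one_mul] at hr
    have h4 : Real.pi * z.im = Real.pi * β := Real.injOn_cos
      ⟨by positivity, by nlinarith⟩ ⟨by nlinarith [hβ.1], by nlinarith [hβ.2]⟩ (by linarith)
    apply hne
    apply Complex.ext
    · simp; exact (mul_eq_zero.1 h3).resolve_left hp.ne'
    · simp; exact mul_left_cancel₀ hp.ne' h4
  · have hch := Real.one_le_cosh (Real.pi * z.re)
    have : z.im = 0 ∨ z.im = 1 := by
      by_contra hcon
      push Not at hcon
      have h5 : 0 < z.im := lt_of_le_of_ne h1 (Ne.symm hcon.1)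
      have h6 : z.im < 1 := lt_of_le_of_ne h2 hcon.2
      exact (Real.sin_pos_of_pos_of_lt_pi (mul_pos hp h5) (by nlinarith)).ne' h3
    rcases this with h5 | h5
    · rw [h5] at hr; simp at hr; linarith
    · rw [h5] at hr; simp at hr; linarith

lemma Ed_diff (β : ℝ) : Differentiable ℂ (Ed β) := by
  unfold Ed
  fun_prop

lemma Ed_inf (β : ℝ) : Tendsto (fun z => (Ed β z)⁻¹) (comap Complex.re atTop) (𝓝 0) := by
  apply tendsto_inv₀_cobounded.comp
  rw [← tendsto_norm_atTop_iff_cobounded]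
  have hp := Real.pi_pos
  have h1 : Tendsto (fun z : ℂ => Real.pi * z.re + (-1)) (comap Complex.re atTop) atTop :=
    tendsto_atTop_add_const_right _ _ (tendsto_comap.const_mul_atTop hp)
  refine tendsto_atTop_mono' _ ?_ h1
  have h2 : ∀ᶠ z : ℂ in comap Complex.re atTop, 0 ≤ z.re :=
    tendsto_comap.eventually (eventually_ge_atTop 0)
  filter_upwards [h2] with z hz
  have h3 : Real.sinh (Real.pi * z.re) ≤ ‖Complex.cosh (Real.pi * z)‖ := by
    rw [Complex.cosh, norm_div, Real.sinh_eq]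
    have := norm_sub_norm_le (Complex.exp (Real.pi * z)) (-Complex.exp (-(Real.pi * z)))
    rw [norm_neg, sub_neg_eq_add, Complex.norm_exp, Complex.norm_exp] at this
    simp at this ⊢
    linarith
  have h4 : Real.pi * z.re ≤ Real.sinh (Real.pi * z.re) :=
    Real.self_le_sinh_iff.2 (by positivity)
  have h5 : ‖((Real.cos (Real.pi * β) : ℝ) : ℂ)‖ ≤ 1 := by
    rw [Complex.norm_real]; exact Real.abs_cos_le_one _
  have h6 := norm_sub_norm_le (Complex.cosh (Real.pi * z)) ((Real.cos (Real.pi * β) : ℝ) : ℂ)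
  unfold Ed
  linarith

/-- behaviour at the vortex -/
lemma pole_aux (β : ℝ) (F : ℂ → ℂ) (d : ℝ) (hd : 0 < d) (U : Set ℂ) (hU : U ∈ 𝓝 (Complex.I * β))
    (hF : DifferentiableOn ℂ F U) (hF0 : F (Complex.I * β) = 0)
    (hF' : deriv F (Complex.I * β) = Complex.I * d)
    (hreal : ∀ᶠ t : ℝ in 𝓝 0, (F (Complex.I * β + Complex.I * t)).im = 0) :
    ∀ ε > 0, ∀ᶠ z in 𝓝 (Complex.I * β), 0 < z.re → (1 / F z).im < ε := by
  set p := Complex.I * (β : ℂ) with hp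
  set H := dslope F p with hH
  have hHd : DifferentiableOn ℂ H U := (Complex.differentiableOn_dslope hU).2 hF
  have hHp : H p = Complex.I * d := by rw [hH, dslope_same, hF']
  have hHp0 : H p ≠ 0 := by
    rw [hHp]; simp [hd.ne']
  have hHc : ContinuousAt H p := hHd.continuousOn.continuousAt hU
  have hne : ∀ᶠ z in 𝓝 p, H z ≠ 0 := hHc.eventually_ne hHp0
  set G := fun z => (H z)⁻¹ with hG
  have hV : {z | H z ≠ 0} ∩ U ∈ 𝓝 p := inter_mem hne hU
  have hGd : DifferentiableOn ℂ G ({z | H z ≠ 0} ∩ U) :=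
    (hHd.mono inter_subset_right).inv (fun z hz => hz.1)
  set R := dslope G p with hR
  have hRc : ContinuousAt R p :=
    ((Complex.differentiableOn_dslope hV).2 hGd).continuousOn.continuousAt hV
  -- 1 / F = G p / (z-p) + R z
  have key : ∀ z, z ≠ p → 1 / F z = G p / (z - p) + R z := by
    intro z hz
    have hz' : z - p ≠ 0 := sub_ne_zero.2 hz
    have e1 : F z = (z - p) * H z := by
      have := sub_smul_dslope F p z
      rw [hF0, sub_zero, smul_eq_mul] at this
      exact this.symm
    have e2 : (z - p) * R z = G z - G p := by
      have := sub_smul_dslope G p z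
      rwa [smul_eq_mul] at this
    have e3 : R z = (G z - G p) / (z - p) := by
      rw [← e2]; field_simp
    rw [e3, e1, hG]
    simp only
    rw [one_div, mul_inv]
    field_simp
    ring
  have hGp : G p = ((-(1 / d) : ℝ) : ℂ) * Complex.I := by
    rw [hG]; simp only; rw [hHp, mul_inv, Complex.inv_I]; push_cast; rw [one_div]; ring
  -- R p is real
  have hRp : (R p).im = 0 := by
    have ht : Tendsto (fun t : ℝ => p + Complex.I * t) (𝓝[≠] 0) (𝓝 p) := by
      have : Continuous (fun t : ℝ => p + Complex.I * t) := by fun_prop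
      have := this.tendsto 0
      simp at this
      exact this.mono_left nhdsWithin_le_nhds
    have h1 : Tendsto (fun t : ℝ => (R (p + Complex.I * t)).im) (𝓝[≠] 0) (𝓝 (R p).im) :=
      (Complex.continuous_im.tendsto _).comp (hRc.tendsto.comp ht)
    refine tendsto_nhds_unique_of_eventuallyEq h1 (tendsto_const_nhds (x := (0:ℝ))) ?_
    filter_upwards [hreal.filter_mono nhdsWithin_le_nhds, self_mem_nhdsWithin] with t ht1 ht2
    have ht2 : t ≠ 0 := ht2
    have hI := Complex.I_ne_zero
    have htc : (t : ℂ) ≠ 0 := by exact_mod_cast ht2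
    have h3 := key (p + Complex.I * t) (by simp [ht2])
    have h4 : G p / (p + Complex.I * t - p) = ((-(1/d) / t : ℝ) : ℂ) := by
      rw [hGp]; push_cast; field_simp; simp
    have h5 : R (p + Complex.I * t) = 1 / F (p + Complex.I * t) - ((-(1/d) / t : ℝ) : ℂ) := by
      rw [h3, h4]; ring
    rw [h5, Complex.sub_im, Complex.ofReal_im, one_div, Complex.inv_im, ht1]
    simp
  intro ε hε
  have h1 : ∀ᶠ z in 𝓝 p, (R z).im < ε := by
    have : ContinuousAt (fun z => (R z).im) p := Complex.continuous_im.continuousAt.comp hRc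
    exact this.eventually_lt (continuousAt_const (y := ε)) (by rw [hRp]; exact hε)
  filter_upwards [h1] with z hz hre
  have hzp : z ≠ p := by
    rintro rfl; simp [hp] at hre
  rw [key z hzp, Complex.add_im]
  have : (G p / (z - p)).im ≤ 0 := by
    rw [hGp, Complex.div_im]
    have e : (z - p).re = z.re := by simp [hp]
    rw [e]
    simp only [Complex.mul_im, Complex.mul_re, Complex.ofReal_re, Complex.ofReal_im,
      Complex.I_re, Complex.I_im]
    have := Complex.normSq_nonneg (z - p)
    have h6 : 0 ≤ 1 / d * z.re / Complex.normSq (z - p) := by positivity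
    have : (-(1 / d) * 1 + 0 * 0) * z.re / Complex.normSq (z - p) = -(1 / d * z.re / Complex.normSq (z - p)) := by ring
    rw [this]
    simp only [mul_zero, sub_zero, zero_mul, zero_div]
    linarith
  linarith

theorem statement11 (β κ : ℝ) (hβ : β ∈ Ioo (0 : ℝ) 1)
    (hκ : κ * Real.sin (Real.pi * β) < Real.cos (Real.pi * β))
    (f g : ℂ → ℂ) (w wx wy : ℂ → ℝ)
    (hf : DifferentiableOn ℂ f Dstrip)
    (hodd : ∀ z ∈ Dstrip, f (-z) = -f z)
    (hconj : ∀ z ∈ Dstrip, f ((starRingEnd ℂ) z) = (starRingEnd ℂ) (f z))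
    -- `g` is the continuous extension of `f'` to the closed strip
    (hgc : ContinuousOn g clDstrip)
    (hge : ∀ z ∈ Dstrip, g z = deriv f z)
    (hgne : ∀ z ∈ clDstrip, g z ≠ 0)
    (hglim : ∀ ε > 0, ∃ R : ℝ, ∀ z ∈ clDstrip, R ≤ |z.re| → ‖g z - 1‖ < ε)
    -- `w = Im f - Im ζ` and its gradient, extended continuously to the closed strip
    (hwc : ContinuousOn w clDstrip)
    (hwxc : ContinuousOn wx clDstrip) (hwyc : ContinuousOn wy clDstrip)
    (hwe : ∀ z ∈ Dstrip, w z = (f z).im - z.im)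
    (hwde : ∀ z ∈ Dstrip, wx z = pdxC w z ∧ wy z = pdyC w z)
    (hwdecay : ∀ ε > 0, ∃ R : ℝ, ∀ z ∈ clDstrip, R ≤ |z.re| →
      |w z| + |wx z| + |wy z| < ε)
    -- the Helmholtz–Kirchhoff condition
    (hHK : deriv (deriv f) (Complex.I * β) / deriv f (Complex.I * β) =
      (Real.pi : ℂ) * Complex.I * κ) :
    -- (i) strict conformal monotonicity ↔ (ii) negativity of the conformal vertical velocity
    ((∀ z : ℂ, 0 < z.re → 0 < z.im → z.im ≤ 1 → wx z < 0) ↔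
      (∀ z : ℂ, 0 < z.re → 0 < z.im → z.im ≤ 1 → z ≠ Complex.I * β →
        -(Wzeta (gammaPV κ β) β z / g z).im < 0)) := by
  
  have hp := Real.pi_pos
  obtain ⟨hc1, hc2, hs⟩ := cosb β hβ
  have hIβ : (Complex.I * (β : ℂ)).re = 0 ∧ (Complex.I * (β : ℂ)).im = β := by simp
  -- topology of the strips
  have hDo : IsOpen Dstrip := isOpen_Ioo.preimage Complex.continuous_im
  have hDcl : Dstrip ⊆ clDstrip := fun z hz => ⟨hz.1.le, hz.2.le⟩
  have hclD : clDstrip ⊆ closure Dstrip := by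
    have e1 : Dstrip = (univ : Set ℝ) ×ℂ Ioo (-1:ℝ) 1 := by
      ext z; simp [Dstrip, Complex.mem_reProdIm]
    rw [e1, Complex.closure_reProdIm, closure_univ, closure_Ioo (by norm_num)]
    intro z hz
    exact ⟨mem_univ _, hz⟩
  have hQD : Qs ⊆ Dstrip := fun z hz => ⟨by linarith [hz.2.1], hz.2.2⟩
  have hQcl : clQ ⊆ clDstrip := fun z hz => ⟨by linarith [hz.2.1], hz.2.2⟩
  have hQQ : Qs ⊆ clQ := fun z hz => ⟨hz.1.le, hz.2.1.le, hz.2.2.le⟩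
  have hgd : DifferentiableOn ℂ g Dstrip := (hf.deriv hDo).congr hge
  -- Im g = wx
  have hgw : EqOn (fun z => (g z).im) wx clDstrip := by
    refine EqOn.of_subset_closure (s := Dstrip) ?_
      (Complex.continuous_im.comp_continuousOn hgc) hwxc hDcl hclD
    intro z hz
    simp only
    rw [(hwde z hz).1, hge z hz, pdxC]
    have hd : HasDerivAt f (deriv f z) z := (hf.differentiableAt (hDo.mem_nhds hz)).hasDerivAt
    have hzz : ((z.re : ℂ) + (z.im : ℂ) * Complex.I) = z := Complex.re_add_im z
    have h1 : HasDerivAt (fun x : ℝ => f ((x : ℂ) + (z.im : ℂ) * Complex.I)) (deriv f z) z.re := by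
      have h2 : HasDerivAt (fun x : ℂ => f (x + (z.im : ℂ) * Complex.I)) (deriv f z) (z.re : ℂ) := by
        apply HasDerivAt.comp_add_const
        rw [hzz]; exact hd
      exact h2.comp_ofReal
    have h3 : HasDerivAt (fun x : ℝ => (f ((x : ℂ) + (z.im : ℂ) * Complex.I)).im - z.im)
        (deriv f z).im z.re := by
      have := (Complex.imCLM.hasFDerivAt.comp_hasDerivAt _ h1).sub_const z.im
      exact this
    rw [← h3.deriv]
    congr 1
    funext x
    rw [hwe _ (by simpa [Dstrip] using hz)]
    simp
  -- Im g vanishes on the axes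
  have hax0 : ∀ z : ℂ, z.im = 0 → (g z).im = 0 := by
    intro z hz
    have hzD : z ∈ Dstrip := by simp [Dstrip, hz]
    have h1 : (g z).im = wx z := hgw (hDcl hzD)
    rw [h1, (hwde z hzD).1, pdxC, hz]
    have : (fun x : ℝ => w ((x : ℂ) + ((0 : ℝ) : ℂ) * Complex.I)) = fun _ => 0 := by
      funext x
      have hx : (x : ℂ) ∈ Dstrip := by simp [Dstrip]
      have h2 := hconj x hx
      rw [Complex.conj_ofReal] at h2
      have h3 : (f x).im = 0 := Complex.conj_eq_iff_im.1 h2.symm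
      simp only [Complex.ofReal_zero, zero_mul, add_zero]
      rw [hwe _ hx, h3]; simp
    rw [this]; simp
  have hay0 : ∀ z : ℂ, z.re = 0 → z ∈ Dstrip → (g z).im = 0 := by
    intro z hz hzD
    have h1 : (g z).im = wx z := hgw (hDcl hzD)
    rw [h1, (hwde z hzD).1, pdxC, hz]
    set φ : ℝ → ℝ := fun x : ℝ => w ((x : ℂ) + (z.im : ℂ) * Complex.I) with hφ
    have hev : (fun x => φ (-x)) = φ := by
      funext x
      have hx : (x : ℂ) + (z.im : ℂ) * Complex.I ∈ Dstrip := by simpa [Dstrip] using hzD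
      have hx' : ((-x : ℝ) : ℂ) + (z.im : ℂ) * Complex.I ∈ Dstrip := by simpa [Dstrip] using hzD
      have hx2 : (starRingEnd ℂ) ((x : ℂ) + (z.im : ℂ) * Complex.I) ∈ Dstrip := by
        have := hzD
        simp only [Dstrip, mem_ofPred_eq, mem_Ioo] at this ⊢
        simp
        constructor <;> linarith [this.1, this.2]
      simp only [hφ]
      rw [hwe _ hx, hwe _ hx']
      have e : ((-x : ℝ) : ℂ) + (z.im : ℂ) * Complex.I =
          -(starRingEnd ℂ) ((x : ℂ) + (z.im : ℂ) * Complex.I) := by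
        apply Complex.ext <;> simp
      rw [e, hodd _ hx2, hconj _ hx]
      simp
    have h2 := deriv_comp_neg φ 0
    rw [hev, neg_zero] at h2
    linarith
  have hay : ∀ y ∈ Icc (-1 : ℝ) 1, (g (Complex.I * y)).im = 0 := by
    have h1 : ContinuousOn (fun y : ℝ => (g (Complex.I * y)).im) (Icc (-1 : ℝ) 1) := by
      refine Complex.continuous_im.comp_continuousOn (hgc.comp (by fun_prop) ?_)
      intro y hy
      simpa [clDstrip] using hy
    have := EqOn.of_subset_closure (s := Ioo (-1 : ℝ) 1) (g := fun _ => (0:ℝ)) ?_ h1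
      continuousOn_const Ioo_subset_Icc_self (by rw [closure_Ioo (by norm_num)])
    · exact fun y hy => this hy
    · intro y hy
      exact hay0 _ (by simp) (by simpa [Dstrip] using hy)
  have hay' : ∀ z : ℂ, z.re = 0 → z ∈ clDstrip → (g z).im = 0 := by
    intro z hz hz'
    have : z = Complex.I * (z.im : ℂ) := by apply Complex.ext <;> simp [hz]
    rw [this]; exact hay _ hz'
  -- positivity of g at the vortex
  have hg0 : 0 < (g 0).re := by
    by_contra hcon
    push Not at hcon
    obtain ⟨R, hR⟩ := hglim 1 one_pos
    have hRm : ((max R 0 : ℝ) : ℂ) ∈ clDstrip := by simp [clDstrip]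
    have h1 := hR _ hRm (by
      rw [Complex.ofReal_re]; exact (le_max_left R 0).trans (le_abs_self _))
    have h2 : 0 < (g ((max R 0 : ℝ) : ℂ)).re := by
      have := (Complex.abs_re_le_norm _).trans_lt h1
      rw [Complex.sub_re, Complex.one_re, abs_lt] at this
      linarith [this.1]
    have hcont : ContinuousOn (fun x : ℝ => (g x).re) (Icc 0 (max R 0)) := by
      refine Complex.continuous_re.comp_continuousOn (hgc.comp (by fun_prop) ?_)
      intro y hy
      simp [clDstrip]
    obtain ⟨x, hx, hx0⟩ := intermediate_value_Icc (le_max_right R 0) hcont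
      ⟨by simpa using hcon, h2.le⟩
    exact hgne x (by simp [clDstrip]) (Complex.ext hx0 (hax0 _ (by simp)))
  have hgβ : 0 < (g (Complex.I * β)).re := by
    by_contra hcon
    push Not at hcon
    have hcont : ContinuousOn (fun x : ℝ => (g (Complex.I * x)).re) (Icc 0 β) := by
      refine Complex.continuous_re.comp_continuousOn (hgc.comp (by fun_prop) ?_)
      intro y hy
      simp only [clDstrip, mem_ofPred_eq]
      simp
      constructor <;> linarith [hy.1, hy.2, hβ.2]
    obtain ⟨x, hx, hx0⟩ := intermediate_value_Icc' hβ.1.le hcont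
      ⟨hcon, by simpa using hg0.le⟩
    have hx1 : x ∈ Icc (-1 : ℝ) 1 := ⟨by linarith [hx.1], by linarith [hx.2, hβ.2]⟩
    exact hgne (Complex.I * x) (by simpa [clDstrip] using hx1) (Complex.ext hx0 (hay _ hx1))
  -- the velocity
  set c : ℝ := -(gammaPV κ β / 2 * Real.sin (Real.pi * β)) with hc
  have hcpos : 0 < c := by
    have hd : 0 < Real.cos (Real.pi * β) - κ * Real.sin (Real.pi * β) := by linarith
    rw [hc, gammaPV]
    have : 0 < 2 * Real.sin (Real.pi * β) * Real.sin (Real.pi * β) /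
      (Real.cos (Real.pi * β) - κ * Real.sin (Real.pi * β)) := by positivity
    convert this using 1
    ring
  have hW : ∀ z, Ed β z ≠ 0 → Wzeta (gammaPV κ β) β z = 1 - (c : ℂ) / Ed β z := by
    intro z hz
    rw [Wzeta_eq _ _ _ hz, hc]; push_cast; ring
  -- replacement for W
  set W : ℂ → ℂ := fun z => 1 - (c : ℂ) / Ed β z with hWdef
  have hWeq : ∀ z ∈ clQ, z ≠ Complex.I * β → Wzeta (gammaPV κ β) β z = W z :=
    fun z hz hne => hW z (Ed_ne β hβ z hz hne)
  have hQne : ∀ z : ℂ, 0 < z.re → z ≠ Complex.I * β := by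
    rintro z hz rfl; rw [hIβ.1] at hz; exact lt_irrefl _ hz
  -- W is real where Ed is
  have hWreal : ∀ z, (Ed β z).im = 0 → (W z).im = 0 := by
    intro z hz
    simp only [hWdef]
    rw [Complex.sub_im, Complex.div_im, hz]; simp
  have hVreal : ∀ z, (W z).im = 0 → (W z / g z).im = -((W z).re * (g z).im / Complex.normSq (g z)) := by
    intro z hz
    rw [Complex.div_im, hz]; ring
  have htop : ∀ z : ℂ, z.im = 1 → (W z).im = 0 ∧ 0 < (W z).re := by
    intro z hz
    have hi : (Ed β z).im = 0 := by rw [Ed_im, hz]; simp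
    have hr : (Ed β z).re < 0 := by
      rw [Ed_re, hz]; simp; linarith [Real.one_le_cosh (Real.pi * z.re)]
    refine ⟨hWreal z hi, ?_⟩
    have hE : Ed β z = ((Ed β z).re : ℂ) := Complex.ext rfl (by simpa using hi)
    simp only [hWdef]
    rw [hE, ← Complex.ofReal_div, Complex.sub_re, Complex.ofReal_re, Complex.one_re]
    have := div_neg_of_pos_of_neg hcpos hr
    linarith
  have htopV : ∀ z : ℂ, z.im = 1 → (-(W z / g z).im < 0 ↔ (g z).im < 0) := by
    intro z hz
    obtain ⟨h1, h2⟩ := htop z hz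
    have hn : 0 < Complex.normSq (g z) := Complex.normSq_pos.2 (hgne z (by simp [clDstrip, hz]))
    rw [hVreal z h1, neg_neg, div_neg_iff]
    constructor
    · rintro (h | h)
      · linarith [h.2]
      · by_contra hcon
        push Not at hcon
        nlinarith [h.1, mul_nonneg h2.le hcon]
    · intro h
      right
      exact ⟨mul_neg_of_pos_of_neg h2 h, hn⟩
  have hbdry : ∀ p ∈ clQ, p ∉ Qs → p.re = 0 ∨ p.im = 0 ∨ (0 < p.re ∧ p.im = 1) := by
    intro p hp1 hp2
    by_contra hcon
    push Not at hcon
    obtain ⟨h1, h2, h3⟩ := hcon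
    have h4 : 0 < p.re := lt_of_le_of_ne hp1.1 (Ne.symm h1)
    exact hp2 ⟨h4, lt_of_le_of_ne hp1.2.1 (Ne.symm h2), lt_of_le_of_ne hp1.2.2 (h3 h4)⟩
  have hg1 : Tendsto g (comap Complex.re atTop ⊓ 𝓟 Qs) (𝓝 1) := by
    rw [Metric.tendsto_nhds]
    intro ε hε
    obtain ⟨R, hR⟩ := hglim ε hε
    rw [eventually_inf_principal]
    have h2 : ∀ᶠ z : ℂ in comap Complex.re atTop, R ≤ z.re :=
      tendsto_comap.eventually (eventually_ge_atTop R)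
    filter_upwards [h2] with z hz hzQ
    rw [dist_eq_norm]
    exact hR z (hDcl (hQD hzQ)) (hz.trans (le_abs_self _))
  have htopcl : ((1 : ℂ) + Complex.I) ∈ clQ := by simp [clQ]
  have hneb : (𝓝[Qs] ((1 : ℂ) + Complex.I)).NeBot := by
    rw [← mem_closure_iff_nhdsWithin_neBot, closure_Qs]; exact htopcl
  -- generic boundary passage
  have hpass : ∀ (h : ℂ → ℂ) (p : ℂ), ContinuousWithinAt h Qs p → ∀ ε, -(h p).im < ε →
      ∀ᶠ z in 𝓝[Qs] p, -(h z).im < ε := by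
    intro h p hh ε hε
    have : Tendsto (fun z => -(h z).im) (𝓝[Qs] p) (𝓝 (-(h p).im)) :=
      ((Complex.continuous_im.tendsto _).comp hh).neg
    exact this.eventually_lt_const hε
  have hgcw : ∀ p ∈ clQ, ContinuousWithinAt g Qs p := fun p hp =>
    (hgc p (hQcl hp)).mono (hQD.trans hDcl)
  have hVcw : ∀ p ∈ clQ, p ≠ Complex.I * β → ContinuousWithinAt (fun z => W z / g z) Qs p := by
    intro p hp hne
    refine ContinuousWithinAt.div ?_ (hgcw p hp) (hgne p (hQcl hp))
    exact continuousWithinAt_const.sub (continuousWithinAt_const.div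
      (Ed_diff β).continuous.continuousWithinAt (Ed_ne β hβ p hp hne))
  constructor
  · intro hi
    have hmain : ∀ z ∈ Qs, -(W z / g z).im < 0 := by
      refine maxPrinciple (fun z => W z / g z) ?_ ?_ ?_ ?_
      · refine DifferentiableOn.div ?_ (hgd.mono hQD) (fun z hz => hgne z (hDcl (hQD hz)))
        exact (differentiableOn_const _).sub ((differentiableOn_const _).div
          (Ed_diff β).differentiableOn (fun z hz => Ed_ne β hβ z (hQQ hz) (hQne z hz.1)))
      · intro p hp1 hp2 ε hε
        by_cases hpβ : p = Complex.I * β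
        · subst hpβ
          have hβD : Complex.I * (β : ℂ) ∈ Dstrip := by
            simp only [Dstrip, mem_ofPred_eq, hIβ.2]; exact ⟨by linarith [hβ.1], hβ.2⟩
          have hgβi : (g (Complex.I * β)).im = 0 := hay0 _ hIβ.1 hβD
          have hE0 : Ed β (Complex.I * β) = 0 := by
            apply Complex.ext
            · rw [Ed_re, hIβ.1, hIβ.2]; simp
            · rw [Ed_im, hIβ.1, hIβ.2]; simp
          have hEd' : HasDerivAt (Ed β) (Complex.I * (Real.pi * Real.sin (Real.pi * β) : ℝ))
              (Complex.I * β) := by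
            have h1 : HasDerivAt (fun z : ℂ => (Real.pi : ℂ) * z) (Real.pi : ℂ) (Complex.I * β) := by
              simpa using (hasDerivAt_id (Complex.I * (β : ℂ))).const_mul (Real.pi : ℂ)
            have h2 := (h1.ccosh).sub_const ((Real.cos (Real.pi * β) : ℝ) : ℂ)
            have e : Complex.sinh ((Real.pi : ℂ) * (Complex.I * β)) * (Real.pi : ℂ) =
                Complex.I * (Real.pi * Real.sin (Real.pi * β) : ℝ) := by
              rw [show (Real.pi : ℂ) * (Complex.I * β) = (Real.pi * β : ℂ) * Complex.I by ring,
                Complex.sinh_mul_I]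
              push_cast; ring
            rw [e] at h2
            exact h2
          have hgr : g (Complex.I * β) = ((g (Complex.I * β)).re : ℂ) :=
            Complex.ext rfl (by simpa using hgβi)
          have hpole := pole_aux β (fun z => Ed β z * g z)
            (Real.pi * Real.sin (Real.pi * β) * (g (Complex.I * β)).re) (by positivity) Dstrip
            (hDo.mem_nhds hβD) ((Ed_diff β).differentiableOn.mul hgd) (by simp [hE0])
            (by
              have h3 := hEd'.mul (hgd.differentiableAt (hDo.mem_nhds hβD)).hasDerivAt
              have h4 := h3.deriv
              rw [hE0, zero_mul, add_zero, hgr] at h4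
              rw [show (fun z => Ed β z * g z) = Ed β * g from rfl, h4]
              push_cast; ring)
            (by
              have ht : Continuous (fun t : ℝ => Complex.I * (β : ℂ) + Complex.I * t) := by fun_prop
              have h5 := ht.continuousAt.preimage_mem_nhds (x := 0)
                (t := Dstrip) (by simpa using hDo.mem_nhds hβD)
              filter_upwards [h5] with t ht
              have ht : Complex.I * (β : ℂ) + Complex.I * t ∈ Dstrip := ht
              rw [Complex.mul_im, hay0 _ (by simp) ht, Ed_im]
              simp)
          have h6 := (hpole (ε / 2 / c) (by positivity)).filter_mono
            (nhdsWithin_le_nhds (s := Qs))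
          have h7 : ∀ᶠ z in 𝓝[Qs] (Complex.I * (β : ℂ)), -(1 / g z).im < ε / 2 := by
            apply hpass (fun z => 1 / g z) _ (continuousWithinAt_const.div (hgcw _ hp1)
              (hgne _ (hQcl hp1)))
            rw [hgr, ← Complex.ofReal_one, ← Complex.ofReal_div, Complex.ofReal_im]
            linarith
          filter_upwards [h6, h7, self_mem_nhdsWithin] with z h8 h9 hzQ
          have h10 := h8 hzQ.1
          have hE := Ed_ne β hβ z (hQQ hzQ) (hQne z hzQ.1)
          have hgz := hgne z (hDcl (hQD hzQ))
          have e : W z / g z = 1 / g z - (c : ℂ) * (1 / (Ed β z * g z)) := by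
            simp only [hWdef]; field_simp
          rw [e, Complex.sub_im, Complex.im_ofReal_mul]
          have h11 : c * (1 / (Ed β z * g z)).im < ε / 2 := by
            have := mul_lt_mul_of_pos_left h10 hcpos
            have e2 : c * (ε / 2 / c) = ε / 2 := by field_simp
            linarith
          linarith
        · apply hpass (fun z => W z / g z) p (hVcw p hp1 hpβ) ε
          refine lt_of_le_of_lt ?_ hε
          rcases hbdry p hp1 hp2 with h | h | h
          · have hE : (Ed β p).im = 0 := by rw [Ed_im, h]; simp
            rw [hVreal p (hWreal p hE), hay' p h (hQcl hp1)]; simp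
          · have hE : (Ed β p).im = 0 := by rw [Ed_im, h]; simp
            rw [hVreal p (hWreal p hE), hax0 p h]; simp
          · apply le_of_lt
            refine (htopV p h.2).2 ?_
            have : (g p).im = wx p := hgw (hQcl hp1)
            rw [this]; exact hi p h.1 (by linarith [h.2]) h.2.le
      · intro ε hε
        have hWt : Tendsto W (comap Complex.re atTop ⊓ 𝓟 Qs) (𝓝 1) := by
          have := ((Ed_inf β).mono_left (inf_le_left (b := 𝓟 Qs))).const_mul (c : ℂ)
          have := (tendsto_const_nhds (x := (1:ℂ))).sub this
          simpa [hWdef, div_eq_mul_inv] using this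
        have h1 := hWt.div hg1 one_ne_zero
        have h2 := ((Complex.continuous_im.tendsto _).comp h1).neg
        have h3 : -((1 : ℂ) / 1).im < ε := by simpa using hε
        exact h2.eventually_lt_const h3
      · have h1 := hpass (fun z => W z / g z) (1 + Complex.I)
          (hVcw _ htopcl (hQne _ (by simp))) 0 ((htopV _ (by simp)).2 (by
            have : (g (1 + Complex.I)).im = wx (1 + Complex.I) := hgw (hQcl htopcl)
            rw [this]; exact hi _ (by simp) (by simp) (by simp)))
        obtain ⟨z, hz1, hz2⟩ := (h1.and self_mem_nhdsWithin).exists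
        exact ⟨z, hz2, hz1⟩
    intro z h1 h2 h3 h4
    have hzc : z ∈ clQ := ⟨h1.le, h2.le, h3⟩
    rw [hWeq z hzc h4]
    rcases h3.lt_or_eq with h5 | h5
    · exact hmain z ⟨h1, h2, h5⟩
    · refine (htopV z h5).2 ?_
      have : (g z).im = wx z := hgw (hQcl hzc)
      rw [this]; exact hi z h1 h2 h3
  · intro hii
    have htopg : ∀ z : ℂ, 0 < z.re → z.im = 1 → (g z).im < 0 := by
      intro z h1 h2
      refine (htopV z h2).1 ?_
      have hzc : z ∈ clQ := ⟨h1.le, by linarith, h2.le⟩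
      rw [← hWeq z hzc (hQne z h1)]
      exact hii z h1 (by linarith) h2.le (hQne z h1)
    have hmain : ∀ z ∈ Qs, -(-g z).im < 0 := by
      refine maxPrinciple (fun z => -g z) (hgd.mono hQD).neg ?_ ?_ ?_
      · intro p hp1 hp2 ε hε
        apply hpass (fun z => -g z) p (hgcw p hp1).neg ε
        refine lt_of_le_of_lt ?_ hε
        simp only [Complex.neg_im, neg_neg]
        rcases hbdry p hp1 hp2 with h | h | h
        · exact (hay' p h (hQcl hp1)).le
        · exact (hax0 p h).le
        · exact (htopg p h.1 h.2).le
      · intro ε hε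
        have h2 := ((Complex.continuous_im.tendsto _).comp hg1.neg).neg
        have h3 : -(-(1 : ℂ)).im < ε := by simpa using hε
        exact h2.eventually_lt_const h3
      · have h1 := hpass (fun z => -g z) (1 + Complex.I) (hgcw _ htopcl).neg 0 (by
          simp only [Complex.neg_im, neg_neg]
          exact htopg _ (by simp) (by simp))
        obtain ⟨z, hz1, hz2⟩ := (h1.and self_mem_nhdsWithin).exists
        exact ⟨z, hz2, hz1⟩
    intro z h1 h2 h3
    have hzc : z ∈ clQ := ⟨h1.le, h2.le, h3⟩
    have : (g z).im = wx z := hgw (hQcl hzc)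
    rw [← this]
    rcases h3.lt_or_eq with h5 | h5
    · have := hmain z ⟨h1, h2, h5⟩
      simpa using this
    · exact htopg z h1 h5
end
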